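/- arXiv:2102.03321 — 8 statements merged into one kernel-verified Lean document; each statement's English description precedes it below -/
import Mathlib

section
/- For every computable function T : ℕ → ℕ there exists a multiway system M whose growth function g_M is nondecreasing and unbounded and satisfies, for all n ≥ 1, ∑_{k=1}^{g_M(n) − 1} T(k) ≤ n. (That is, multiway systems can realize growth functions bounded above by the inverse of the summatory function of any computable T.) -/
/-- A (string-based) multiway system: a finite set of rewrite rules together with an
initial string.  Symbols are modelled as natural numbers; since rules and the initial
string are finite, only finitely many symbols (the effective alphabet) occur. -/
structure Multiway where
  rules : Finset (List ℕ × List ℕ)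
  init : List ℕ

/-- One rewrite step: `x = u ++ r ++ v` and `y = u ++ t ++ v` for some rule `(r, t)`. -/
def Multiway.Step (M : Multiway) (x y : List ℕ) : Prop :=
  ∃ p ∈ M.rules, ∃ u v : List ℕ, x = u ++ p.1 ++ v ∧ y = u ++ p.2 ++ v

/-- Reachability from the initial string by a chain of exactly `n` rewrite steps. -/
def Multiway.StepN (M : Multiway) : ℕ → List ℕ → Prop
  | 0 => fun x => x = M.init
  | n + 1 => fun y => ∃ x, M.StepN n x ∧ M.Step x y

/-- The set of strings whose shortest rewrite distance from the initial string is exactly `n`. -/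
def Multiway.sphere (M : Multiway) (n : ℕ) : Set (List ℕ) :=
  {x | M.StepN n x ∧ ∀ k < n, ¬ M.StepN k x}

/-- The growth function of a multiway system: the number of strings whose shortest
rewrite distance from the initial string is exactly `n`.  (`growth M 0 = 1`.) -/
noncomputable def Multiway.growth (M : Multiway) (n : ℕ) : ℕ :=
  (M.sphere n).ncard

/-- Reachable states of a multiway system. -/
def Multiway.Reachable (M : Multiway) (x : List ℕ) : Prop :=
  Relation.ReflTransGen M.Step M.init x

/-- The symbols actually used by a multiway system (its effective alphabet). -/
def Multiway.symbols (M : Multiway) : Finset ℕ :=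
  M.init.toFinset ∪ M.rules.biUnion fun p => p.1.toFinset ∪ p.2.toFinset

namespace ScanMachine

/-- Instructions: append a letter, delete the last occurrence of a letter (branching on whether
there is one), or emit a signal; all followed by a jump. -/
inductive Instr
  | inc (i b : ℕ)
  | dec (i b c : ℕ)
  | sig (b : ℕ)

/-- Configurations of the scanning machine.  The word to the left of the head is stored in
reverse. The letter `0` is junk; the letter `r + 1` counts towards register `r`. -/
inductive Cfg
  | ctl (a : ℕ) (u : List ℕ)
  | scan (a : ℕ) (u v : List ℕ)
  | back (b : ℕ) (u v : List ℕ)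

/-- The transition function of the scanning machine; every transition makes the word exactly one
letter longer. -/
def next (P : ℕ → Instr) : Cfg → Cfg
  | .ctl a u =>
    match P a with
    | .inc i b => .ctl b (i :: u)
    | .dec _ _ _ => .scan a (0 :: u) []
    | .sig b => .ctl b (0 :: u)
  | .scan a u v =>
    match P a with
    | .dec i b c =>
      match u with
      | [] => .back c [0] v
      | j :: u => if j = i then .back b (0 :: 0 :: u) v else .scan a u (j :: 0 :: v)
    | _ => .scan a u v
  | .back b u [] => .ctl b (0 :: u)
  | .back b u (j :: v) => .back b (0 :: j :: u) v

/-- The machine is about to emit a signal. -/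
def Signals (P : ℕ → Instr) : Cfg → Prop
  | .ctl a _ => ∃ b, P a = .sig b
  | _ => False

/-- A transition that emits no signal. -/
def Silent (P : ℕ → Instr) (c d : Cfg) : Prop := ¬ Signals P c ∧ next P c = d

/-- Iterated silent transitions. -/
abbrev Reach (P : ℕ → Instr) : Cfg → Cfg → Prop := Relation.ReflTransGen (Silent P)

/-- Register contents of a word. -/
def regs (w : List ℕ) (r : ℕ) : ℕ := w.count (r + 1)

@[simp] theorem regs_nil : regs [] = fun _ => 0 := by
  funext r; simp [regs]

@[simp] theorem regs_zero_cons (w : List ℕ) : regs (0 :: w) = regs w := by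
  funext r; simp [regs]

theorem regs_succ_cons (i : ℕ) (w : List ℕ) :
    regs ((i + 1) :: w) = Function.update (regs w) i (regs w i + 1) := by
  funext r
  by_cases h : r = i
  · subst h; simp [regs]
  · have h' : ¬ i = r := fun e => h e.symm
    simp [regs, Function.update_of_ne h, h']

theorem reach_back (P : ℕ → Instr) (b : ℕ) (v u : List ℕ) :
    ∃ w, (∀ r, regs w r = regs u r + regs v r) ∧ Reach P (.back b u v) (.ctl b w) := by
  induction v generalizing u with
  | nil =>
    exact ⟨0 :: u, by simp, .single ⟨by simp [Signals], by simp [next]⟩⟩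
  | cons j v ih =>
    obtain ⟨w, h, hr⟩ := ih (0 :: j :: u)
    refine ⟨w, fun r => ?_, .head ⟨by simp [Signals], by simp [next]⟩ hr⟩
    rw [h r, regs_zero_cons]
    simp only [regs, List.count_cons]
    omega

theorem reach_scan_of_ne {P : ℕ → Instr} {a i b c : ℕ} (hP : P a = .dec (i + 1) b c)
    (u v : List ℕ) (hu : regs u i ≠ 0) :
    ∃ w, (∀ r, regs w r + (if r = i then 1 else 0) = regs u r + regs v r) ∧
      Reach P (.scan a u v) (.ctl b w) := by
  induction u generalizing v with
  | nil => simp at hu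
  | cons j u ih =>
    by_cases hj : j = i + 1
    · obtain ⟨w, h, hr⟩ := reach_back P b v (0 :: 0 :: u)
      refine ⟨w, fun r => ?_, .head ⟨by simp [Signals], by simp [next, hP, hj]⟩ hr⟩
      rw [h r]
      simp only [regs_zero_cons]
      simp only [regs, List.count_cons, hj]
      by_cases hr : r = i
      · simp [hr]; omega
      · have : ¬ i = r := fun e => hr e.symm
        simp [hr, this]
    · obtain ⟨w, h, hr⟩ := ih (j :: 0 :: v) (by simpa [regs, List.count_cons, hj] using hu)
      refine ⟨w, fun r => ?_, .head ⟨by simp [Signals], by simp [next, hP, hj]⟩ hr⟩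
      rw [h r]
      simp [regs, List.count_cons]
      omega

theorem reach_scan_of_eq {P : ℕ → Instr} {a i b c : ℕ} (hP : P a = .dec (i + 1) b c)
    (u v : List ℕ) (hu : regs u i = 0) :
    ∃ w, (∀ r, regs w r = regs u r + regs v r) ∧ Reach P (.scan a u v) (.ctl c w) := by
  induction u generalizing v with
  | nil =>
    obtain ⟨w, h, hr⟩ := reach_back P c v [0]
    exact ⟨w, by simpa using h, .head ⟨by simp [Signals], by simp [next, hP]⟩ hr⟩
  | cons j u ih =>
    have hj : j ≠ i + 1 := by
      rintro rfl
      simp [regs] at hu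
    obtain ⟨w, h, hr⟩ := ih (j :: 0 :: v) (by simpa [regs, List.count_cons, hj] using hu)
    refine ⟨w, fun r => ?_, .head ⟨by simp [Signals], by simp [next, hP, hj]⟩ hr⟩
    rw [h r]
    simp [regs, List.count_cons]
    omega

theorem reach_dec_of_ne {P : ℕ → Instr} {a i b c : ℕ} (hP : P a = .dec (i + 1) b c)
    (u : List ℕ) (hu : regs u i ≠ 0) :
    ∃ w, regs w = Function.update (regs u) i (regs u i - 1) ∧
      Reach P (.ctl a u) (.ctl b w) := by
  obtain ⟨w, h, hr⟩ := reach_scan_of_ne hP (0 :: u) [] (by simpa using hu)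
  refine ⟨w, ?_, .head ⟨by simp [Signals, hP], by simp [next, hP]⟩ hr⟩
  funext r
  have := h r
  by_cases hri : r = i
  · subst hri; simp at this ⊢; omega
  · simpa [hri] using this

theorem reach_dec_of_eq {P : ℕ → Instr} {a i b c : ℕ} (hP : P a = .dec (i + 1) b c)
    (u : List ℕ) (hu : regs u i = 0) :
    ∃ w, regs w = regs u ∧ Reach P (.ctl a u) (.ctl c w) := by
  obtain ⟨w, h, hr⟩ := reach_scan_of_eq hP (0 :: u) [] (by simpa using hu)
  refine ⟨w, ?_, .head ⟨by simp [Signals, hP], by simp [next, hP]⟩ hr⟩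
  funext r
  simpa using h r

/-- The program `P` contains the fragment `L` at address `a`. -/
def CodeAt (P : ℕ → Instr) : ℕ → List Instr → Prop
  | _, [] => True
  | a, I :: L => P a = I ∧ CodeAt P (a + 1) L

theorem codeAt_append {P : ℕ → Instr} {L L' : List Instr} {a : ℕ} :
    CodeAt P a (L ++ L') ↔ CodeAt P a L ∧ CodeAt P (a + L.length) L' := by
  induction L generalizing a with
  | nil => simp [CodeAt]
  | cons I L ih => simp [CodeAt, ih, and_assoc, Nat.add_assoc, Nat.add_comm 1]

theorem codeAt_getD (d : Instr) (L₀ L : List Instr) :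
    CodeAt (fun a => (L₀ ++ L).getD a d) L₀.length L := by
  induction L generalizing L₀ with
  | nil => trivial
  | cons I L ih => exact ⟨by simp, by simpa using ih (L₀ ++ [I])⟩

/-- Some relocatable signal-free fragment transforms the registers according to `R`. -/
def Impl (R : (ℕ → ℕ) → (ℕ → ℕ) → Prop) : Prop :=
  ∀ a, ∃ L : List Instr, ∀ P, CodeAt P a L → ∀ u, ∃ w, R (regs u) (regs w) ∧
    Reach P (.ctl a u) (.ctl (a + L.length) w)

theorem Impl.mono {R R' : (ℕ → ℕ) → (ℕ → ℕ) → Prop} (h : Impl R)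
    (hR : ∀ s s', R s s' → R' s s') : Impl R' := fun a => by
  obtain ⟨L, hL⟩ := h a
  refine ⟨L, fun P hP u => ?_⟩
  obtain ⟨w, hw, hr⟩ := hL P hP u
  exact ⟨w, hR _ _ hw, hr⟩

theorem impl_skip : Impl fun s s' => s' = s :=
  fun _ => ⟨[], fun _ _ u => ⟨u, rfl, .refl⟩⟩

theorem impl_inc (i : ℕ) : Impl fun s s' => s' = Function.update s i (s i + 1) :=
  fun a => ⟨[.inc (i + 1) (a + 1)], fun P hP u => by
    have hP : P a = .inc (i + 1) (a + 1) := hP.1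
    exact ⟨(i + 1) :: u, regs_succ_cons i u,
      .single ⟨by simp [Signals, hP], by simp [next, hP]⟩⟩⟩

theorem Impl.seq {R₁ R₂ R : (ℕ → ℕ) → (ℕ → ℕ) → Prop} (h₁ : Impl R₁) (h₂ : Impl R₂)
    (hR : ∀ s s₁ s₂, R₁ s s₁ → R₂ s₁ s₂ → R s s₂) : Impl R := fun a => by
  obtain ⟨L₁, hL₁⟩ := h₁ a
  obtain ⟨L₂, hL₂⟩ := h₂ (a + L₁.length)
  refine ⟨L₁ ++ L₂, fun P hP u => ?_⟩
  rw [codeAt_append] at hP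
  obtain ⟨w₁, hw₁, hr₁⟩ := hL₁ P hP.1 u
  obtain ⟨w₂, hw₂, hr₂⟩ := hL₂ P hP.2 w₁
  refine ⟨w₂, hR _ _ _ hw₁ hw₂, hr₁.trans ?_⟩
  simpa [Nat.add_assoc] using hr₂

/-- Run a body once for each unit in register `i`, counting that register down. -/
theorem Impl.loop {B R : (ℕ → ℕ) → (ℕ → ℕ) → Prop} (hB : Impl B) (i : ℕ)
    (hi : ∀ s s', B s s' → s' i = s i) (h0 : ∀ s, s i = 0 → R s s)
    (hS : ∀ s s₁ s', s i ≠ 0 → B (Function.update s i (s i - 1)) s₁ → R s₁ s' → R s s') :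
    Impl R := fun a => by
  obtain ⟨L, hL⟩ := hB (a + 1)
  refine ⟨.dec (i + 1) (a + 1) (a + L.length + 2) :: (L ++ [.inc 0 a]), fun P hP => ?_⟩
  obtain ⟨hPa, hP⟩ := hP
  rw [codeAt_append] at hP
  obtain ⟨hPL, hPj, -⟩ := hP
  have key : ∀ k u, regs u i = k → ∃ w, R (regs u) (regs w) ∧
      Reach P (.ctl a u) (.ctl (a + L.length + 2) w) := by
    intro k
    induction k with
    | zero =>
      intro u hu
      obtain ⟨w, hw, hr⟩ := reach_dec_of_eq hPa u hu
      exact ⟨w, by rw [hw]; exact h0 _ hu, hr⟩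
    | succ k ih =>
      intro u hu
      obtain ⟨w₁, hw₁, hr₁⟩ := reach_dec_of_ne hPa u (by omega)
      obtain ⟨w₂, hw₂, hr₂⟩ := hL P hPL w₁
      have h2 : regs (0 :: w₂) i = k := by
        rw [regs_zero_cons, hi _ _ hw₂, hw₁]; simp [hu]
      obtain ⟨w₃, hw₃, hr₃⟩ := ih (0 :: w₂) h2
      refine ⟨w₃, hS _ (regs w₂) _ (by omega) (by rw [← hw₁]; exact hw₂)
        (by simpa using hw₃), hr₁.trans (hr₂.trans (.head ⟨?_, ?_⟩ hr₃))⟩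
      · simp [Signals, hPj]
      · simp [next, hPj]
  intro u
  obtain ⟨w, hw, hr⟩ := key _ u rfl
  exact ⟨w, hw, by simpa [Nat.add_assoc, Nat.add_comm, Nat.add_left_comm] using hr⟩

theorem impl_clear (i : ℕ) : Impl fun s s' => s' = Function.update s i 0 := by
  refine impl_skip.loop i (by rintro s _ rfl; rfl) (fun s hs => ?_) ?_
  · rw [← hs, Function.update_eq_self]
  · rintro s _ _ - rfl rfl
    simp

/-- Drain register `i` into the registers `j` and `k`. -/
theorem impl_drain {i j k : ℕ} (hij : i ≠ j) (hik : i ≠ k) (hjk : j ≠ k) :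
    Impl fun s s' => s' i = 0 ∧ s' j = s j + s i ∧ s' k = s k + s i ∧
      ∀ r, r ≠ i → r ≠ j → r ≠ k → s' r = s r := by
  refine ((impl_inc j).seq (impl_inc k) (R := fun s s' => s' i = s i ∧ s' j = s j + 1 ∧
    s' k = s k + 1 ∧ ∀ r, r ≠ i → r ≠ j → r ≠ k → s' r = s r) ?_).loop i ?_ ?_ ?_
  · rintro s _ _ rfl rfl
    refine ⟨by simp [hij, hik], by simp [hjk], by simp [hjk.symm], fun r h1 h2 h3 => ?_⟩
    simp [h2, h3]
  · exact fun s s' h => h.1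
  · intro s hs
    simp [hs]
  · rintro s s₁ s' hs ⟨h1, h2, h3, h4⟩ ⟨g1, g2, g3, g4⟩
    simp only [Function.update_self, Function.update_of_ne hij.symm,
      Function.update_of_ne hik.symm] at h1 h2 h3
    refine ⟨g1, by omega, by omega, fun r r1 r2 r3 => ?_⟩
    rw [g4 r r1 r2 r3, h4 r r1 r2 r3, Function.update_of_ne r1]

/-- Copy register `i` to register `j`, using register `k` as scratch space. -/
theorem impl_copy {i j k : ℕ} (hij : i ≠ j) (hik : i ≠ k) (hjk : j ≠ k) :
    Impl fun s s' => s' j = s i ∧ ∀ r, r ≠ j → r ≠ k → s' r = s r := by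
  have restore : Impl fun s s' => s' i = s i + s k ∧ ∀ r, r ≠ i → r ≠ k → s' r = s r := by
    refine (impl_inc i).loop k ?_ ?_ ?_
    · rintro s _ rfl; simp [hik.symm]
    · intro s hs; simp [hs]
    · rintro s _ s' hs rfl ⟨g1, g2⟩
      simp only [Function.update_self, Function.update_of_ne hik,
        Function.update_of_ne hik.symm] at g1
      refine ⟨by omega, fun r r1 r2 => ?_⟩
      rw [g2 r r1 r2, Function.update_of_ne r1, Function.update_of_ne r2]
  refine (((impl_clear j).seq (impl_clear k)
    (R := fun s s₂ => s₂ = Function.update (Function.update s j 0) k 0) ?_).seq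
    (impl_drain hij hik hjk)
    (R := fun s s₂ => s₂ i = 0 ∧ s₂ j = s i ∧ s₂ k = s i ∧
      ∀ r, r ≠ i → r ≠ j → r ≠ k → s₂ r = s r) ?_).seq restore ?_ <;>
    intro s s₁ s₂ h₁ h₂
  · rw [h₂, h₁]
  · obtain ⟨g1, g2, g3, g4⟩ := h₂
    subst h₁
    simp only [Function.update_self, Function.update_of_ne hij,
      Function.update_of_ne hik, Function.update_of_ne hjk] at g2 g3
    refine ⟨g1, by omega, by omega, fun r r1 r2 r3 => ?_⟩
    rw [g4 r r1 r2 r3, Function.update_of_ne r3, Function.update_of_ne r2]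
  · obtain ⟨g1, g2, g3, g4⟩ := h₁
    obtain ⟨f1, f2⟩ := h₂
    refine ⟨by rw [f2 j hij.symm hjk, g2], fun r r1 r2 => ?_⟩
    by_cases hr : r = i
    · subst hr; omega
    · rw [f2 r hr r2, g4 r hr r1 r2]

/-- The vector function `f` can be computed on registers, using registers from `m` on as
scratch space. -/
def Comp {n : ℕ} (f : List.Vector ℕ n → ℕ) : Prop :=
  ∀ (m : ℕ) (inp : Fin n → ℕ) (out : ℕ), (∀ i, inp i < m) → out < m → (∀ i, inp i ≠ out) →
    Impl fun s s' => s' out = f (List.Vector.ofFn fun i => s (inp i)) ∧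
      ∀ r, r < m → r ≠ out → s' r = s r

theorem Comp.family {m n : ℕ} {g : Fin n → List.Vector ℕ m → ℕ} (hg : ∀ i, Comp (g i))
    (M : ℕ) (inp : Fin m → ℕ) (hinp : ∀ i, inp i < M) (k : ℕ) (hk : k ≤ n) :
    Impl fun s s' => (∀ i : Fin n, i < k →
      s' (M + i) = g i (List.Vector.ofFn fun i => s (inp i))) ∧ ∀ r, r < M → s' r = s r := by
  induction k with
  | zero => exact impl_skip.mono (by rintro s _ rfl; simp)
  | succ k ih =>
    refine (ih (by omega)).seq (hg ⟨k, hk⟩ (M + n) inp (M + k) (fun i => ?_) (by omega)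
      (fun i => ?_)) ?_
    · have := hinp i; omega
    · have := hinp i; omega
    · rintro s s₁ s₂ ⟨h1, h2⟩ ⟨h3, h4⟩
      refine ⟨fun i hi => ?_, fun r hr => ?_⟩
      · by_cases hik : (i : ℕ) = k
        · have : i = ⟨k, hk⟩ := Fin.ext hik
          subst this
          rw [h3]
          simp [h2 _ (hinp _)]
        · rw [h4 _ (by omega) (by omega), h1 i (by omega)]
      · rw [h4 r (by omega) (by omega), h2 r hr]

theorem Comp.prec {n : ℕ} {f : List.Vector ℕ n → ℕ} {g : List.Vector ℕ (n + 2) → ℕ}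
    (hf : Comp f) (hg : Comp g) : Comp fun v : List.Vector ℕ (n + 1) =>
      v.head.rec (f v.tail) fun y IH => g (y ::ᵥ IH ::ᵥ v.tail) := by
  intro m inp out hinp hout hne
  have init : Impl fun s s' => s' m = 0 ∧
      s' (m + 1) = f (List.Vector.ofFn fun i => s (inp i.succ)) ∧ s' (m + 2) = s (inp 0) ∧
      ∀ r, r < m → s' r = s r := by
    have h0 := hinp 0
    have e1 : m ≠ m + 1 := by omega
    refine (((impl_clear m).seq (hf (m + 2) (fun i => inp i.succ) (m + 1) ?_ (by omega) ?_)
      (R := fun s s₂ => s₂ m = 0 ∧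
        s₂ (m + 1) = f (List.Vector.ofFn fun i => s (inp i.succ)) ∧ ∀ r, r < m → s₂ r = s r)
      fun s s₁ s₂ h₁ h₂ => ?_).seq (impl_copy (i := inp 0) (j := m + 2) (k := m + 3)
        (by omega) (by omega) (by omega)) fun s s₁ s₂ h₁ h₂ => ?_)
    · intro i; have := hinp i.succ; omega
    · intro i; have := hinp i.succ; omega
    · subst h₁
      obtain ⟨g1, g2⟩ := h₂
      refine ⟨by rw [g2 m (by omega) e1]; simp, ?_, fun r hr => ?_⟩
      · rw [g1]
        congr 2
        funext i
        have := hinp i.succ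
        rw [Function.update_of_ne (by omega)]
      · rw [g2 r (by omega) (by omega), Function.update_of_ne (by omega)]
    · obtain ⟨f1, f2, f3⟩ := h₁
      obtain ⟨g1, g2⟩ := h₂
      refine ⟨?_, ?_, ?_, fun r hr => ?_⟩
      · rw [g2 m (by omega) (by omega), f1]
      · rw [g2 _ (by omega) (by omega), f2]
      · rw [g1, f3 _ h0]
      · rw [g2 r (by omega) (by omega), f3 r hr]
  let inp' : Fin (n + 2) → ℕ := Fin.cons m (Fin.cons (m + 1) fun i => inp i.succ)
  have vec : ∀ s : ℕ → ℕ, List.Vector.ofFn (fun i => s (inp' i)) =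
      s m ::ᵥ s (m + 1) ::ᵥ List.Vector.ofFn fun i => s (inp i.succ) := by
    intro s
    simp [List.Vector.ofFn, inp']
  have body : Impl fun s s' => s' (m + 2) = s (m + 2) ∧ s' m = s m + 1 ∧
      s' (m + 1) = g (s m ::ᵥ s (m + 1) ::ᵥ List.Vector.ofFn fun i => s (inp i.succ)) ∧
      ∀ r, r < m → r ≠ out → s' r = s r := by
    refine (((hg (m + 3) inp' out ?_ (by omega) ?_).seq
      (impl_copy (i := out) (j := m + 1) (k := m + 3) (by omega) (by omega) (by omega))
      (R := fun s s₂ => s₂ (m + 2) = s (m + 2) ∧ s₂ m = s m ∧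
        s₂ (m + 1) = g (s m ::ᵥ s (m + 1) ::ᵥ List.Vector.ofFn fun i => s (inp i.succ)) ∧
        ∀ r, r < m → r ≠ out → s₂ r = s r)
      fun s s₁ s₂ h₁ h₂ => ?_).seq (impl_inc m) fun s s₁ s₂ h₁ h₂ => ?_)
    · refine Fin.cases ?_ (Fin.cases ?_ fun i => ?_)
      · simp [inp']
      · simp [inp']
      · have := hinp i.succ
        simp [inp']; omega
    · refine Fin.cases ?_ (Fin.cases ?_ fun i => ?_)
      · simp [inp']; omega
      · simp [inp']; omega
      · simpa [inp'] using hne i.succ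
    · obtain ⟨f1, f2⟩ := h₁
      obtain ⟨g1, g2⟩ := h₂
      rw [vec] at f1
      refine ⟨?_, ?_, by rw [g1, f1], fun r hr hro => ?_⟩
      · rw [g2 _ (by omega) (by omega), f2 _ (by omega) (by omega)]
      · rw [g2 _ (by omega) (by omega), f2 _ (by omega) (by omega)]
      · rw [g2 _ (by omega) (by omega), f2 _ (by omega) (by omega)]
    · obtain ⟨f1, f2, f3, f4⟩ := h₁
      subst h₂
      refine ⟨by simp [f1], by simp [f2], by simp [f3], fun r hr hro => ?_⟩
      rw [Function.update_of_ne (by omega), f4 r hr hro]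
  let F : List.Vector ℕ n → ℕ → ℕ := fun v y => y.rec (f v) fun y IH => g (y ::ᵥ IH ::ᵥ v)
  have iter : Impl fun s s' => (s (m + 1) = F (List.Vector.ofFn fun i => s (inp i.succ)) (s m) →
      s' (m + 1) = F (List.Vector.ofFn fun i => s (inp i.succ)) (s m + s (m + 2))) ∧
      ∀ r, r < m → r ≠ out → s' r = s r := by
    refine body.loop (m + 2) (fun s s' h => h.1) ?_ ?_
    · intro s hs; simp [hs]
    · rintro s s₁ s' hs ⟨h1, h2, h3, h4⟩ ⟨g1, g2⟩
      have hin : ∀ i : Fin n, inp i.succ ≠ m + 2 := fun i => by have := hinp i.succ; omega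
      have e1 : m + 1 ≠ m + 2 := by omega
      have e2 : m ≠ m + 2 := by omega
      simp only [Function.update_self, Function.update_of_ne e1, Function.update_of_ne e2,
        Function.update_of_ne (hin _)] at h1 h2 h3
      have hv : (fun i : Fin n => s₁ (inp i.succ)) = fun i : Fin n => s (inp i.succ) := by
        funext i
        rw [h4 _ (hinp _) (hne _), Function.update_of_ne (hin i)]
      rw [hv] at g1
      refine ⟨fun hs1 => ?_, fun r hr hro => ?_⟩
      · rw [g1, h2, h1]
        · congr 1; omega
        · rw [h3, h2, hs1]
      · rw [g2 r hr hro, h4 r hr hro, Function.update_of_ne (by omega)]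
  refine ((init.seq iter (R := fun s s₂ =>
      s₂ (m + 1) = F (List.Vector.ofFn fun i => s (inp i.succ)) (s (inp 0)) ∧
      ∀ r, r < m → r ≠ out → s₂ r = s r) fun s s₁ s₂ h₁ h₂ => ?_).seq
    (impl_copy (i := m + 1) (j := out) (k := m + 2) (by omega) (by omega) (by omega)) fun s s₁ s₂ h₁ h₂ => ?_)
  · obtain ⟨f1, f2, f3, f4⟩ := h₁
    obtain ⟨g1, g2⟩ := h₂
    have hv : (fun i : Fin n => s₁ (inp i.succ)) = fun i : Fin n => s (inp i.succ) := by
      funext i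
      rw [f4 _ (hinp _)]
    rw [hv, f1, f3] at g1
    refine ⟨by rw [g1 f2, Nat.zero_add], fun r hr hro => ?_⟩
    rw [g2 r hr hro, f4 r hr]
  · obtain ⟨f1, f2⟩ := h₁
    obtain ⟨g1, g2⟩ := h₂
    refine ⟨?_, fun r hr hro => ?_⟩
    · rw [g1, f1]
      simp [F, List.Vector.ofFn]
    · rw [g2 r hro (by omega), f2 r hr hro]

theorem comp_of_primrec' {n : ℕ} {f : List.Vector ℕ n → ℕ} (hf : Nat.Primrec' f) : Comp f := by
  induction hf with
  | zero =>
    intro m inp out _ _ _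
    refine (impl_clear out).mono ?_
    rintro s _ rfl
    exact ⟨by simp, fun r _ hr => by simp [hr]⟩
  | succ =>
    intro m inp out hinp hout hne
    have h0 := hinp 0
    refine (impl_copy (i := inp 0) (j := out) (k := m) (hne 0) (by omega) (by omega)).seq
      (impl_inc out) ?_
    rintro s s₁ _ ⟨h1, h2⟩ rfl
    refine ⟨by simp [h1, List.Vector.ofFn], fun r hr hro => ?_⟩
    rw [Function.update_of_ne hro, h2 r hro (by omega)]
  | get i =>
    intro m inp out hinp hout hne
    have h0 := hinp i
    refine (impl_copy (i := inp i) (j := out) (k := m) (hne i) (by omega) (by omega)).mono ?_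
    rintro s s₁ ⟨h1, h2⟩
    exact ⟨by simp [h1], fun r hr hro => h2 r hro (by omega)⟩
  | @comp m n f g _ _ hf hg =>
    intro M inp out hinp hout hne
    refine (Comp.family hg M inp hinp n le_rfl).seq (hf (M + n) (fun i => M + i) out
      (fun i => by omega) (by omega) (fun i => by omega)) ?_
    rintro s s₁ s₂ ⟨h1, h2⟩ ⟨h3, h4⟩
    refine ⟨?_, fun r hr hro => ?_⟩
    · rw [h3]
      congr 2
      funext i
      exact h1 i i.2
    · rw [h4 r (by omega) hro, h2 r hr]
  | prec _ _ hf hg => exact hf.prec hg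

/-- All letters and addresses in the instruction are below `N`. -/
def Instr.Bounded (N : ℕ) : Instr → Prop
  | .inc i b => i < N ∧ b < N
  | .dec i b c => i < N ∧ b < N ∧ c < N
  | .sig b => b < N

theorem Instr.Bounded.mono {N N' : ℕ} (h : N ≤ N') {I : Instr} (hI : I.Bounded N) :
    I.Bounded N' := by
  cases I <;> simp only [Instr.Bounded] at * <;> omega

theorem Instr.exists_bounded (I : Instr) : ∃ N, I.Bounded N := by
  cases I with
  | inc i b => exact ⟨i + b + 1, by simp only [Instr.Bounded]; omega⟩
  | dec i b c => exact ⟨i + b + c + 1, by simp only [Instr.Bounded]; omega⟩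
  | sig b => exact ⟨b + 1, by simp only [Instr.Bounded]; omega⟩

theorem exists_bounded_list (L : List Instr) : ∃ N, ∀ I ∈ L, I.Bounded N := by
  induction L with
  | nil => exact ⟨0, by simp⟩
  | cons I L ih =>
    obtain ⟨N, hN⟩ := ih
    obtain ⟨N', hN'⟩ := I.exists_bounded
    refine ⟨max N N', fun J hJ => ?_⟩
    rcases List.mem_cons.1 hJ with rfl | hJ
    · exact hN'.mono (le_max_right _ _)
    · exact (hN J hJ).mono (le_max_left _ _)

theorem exists_bounded_getD (L : List Instr) (d : Instr) :
    ∃ N, ∀ a, (L.getD a d).Bounded N := by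
  obtain ⟨N, hN⟩ := exists_bounded_list (d :: L)
  refine ⟨N, fun a => hN _ ?_⟩
  by_cases ha : a < L.length
  · rw [List.getD_eq_getElem _ _ ha]
    exact List.mem_cons_of_mem _ (List.getElem_mem ha)
  · rw [List.getD_eq_default _ _ (not_lt.1 ha)]
    exact List.mem_cons_self

/-- The run of the machine from the empty word. -/
def run (P : ℕ → Instr) (t : ℕ) : Cfg := (next P)^[t] (.ctl 0 [])

@[simp] theorem run_zero (P : ℕ → Instr) : run P 0 = .ctl 0 [] := rfl

theorem run_succ (P : ℕ → Instr) (t : ℕ) : run P (t + 1) = next P (run P t) :=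
  Function.iterate_succ_apply' _ _ _

open Classical in
/-- The times before `t` at which a signal is emitted. -/
noncomputable def signalTimes (P : ℕ → Instr) (t : ℕ) : Finset ℕ :=
  (Finset.range t).filter fun m => Signals P (run P m)

theorem mem_signalTimes {P : ℕ → Instr} {t m : ℕ} :
    m ∈ signalTimes P t ↔ m < t ∧ Signals P (run P m) := by
  simp [signalTimes]

theorem signalTimes_mono (P : ℕ → Instr) : Monotone (signalTimes P) := fun s t h m hm => by
  rw [mem_signalTimes] at *
  exact ⟨by omega, hm.2⟩

theorem signalTimes_succ_of_not {P : ℕ → Instr} {t : ℕ} (h : ¬ Signals P (run P t)) :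
    signalTimes P (t + 1) = signalTimes P t := by
  simp [signalTimes, Finset.range_add_one, Finset.filter_insert, h]

theorem card_signalTimes_succ {P : ℕ → Instr} {t : ℕ} (h : Signals P (run P t)) :
    (signalTimes P (t + 1)).card = (signalTimes P t).card + 1 := by
  simp [signalTimes, Finset.range_add_one, Finset.filter_insert, h]

theorem Reach.exists_run {P : ℕ → Instr} {c d : Cfg} (h : Reach P c d) {t : ℕ}
    (ht : run P t = c) :
    ∃ t', t ≤ t' ∧ run P t' = d ∧ signalTimes P t' = signalTimes P t := by
  induction h with
  | refl => exact ⟨t, le_rfl, ht, rfl⟩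
  | tail _ hs ih =>
    obtain ⟨t', h1, h2, h3⟩ := ih
    refine ⟨t' + 1, by omega, by rw [run_succ, h2, hs.2], ?_⟩
    rw [signalTimes_succ_of_not (by rw [h2]; exact hs.1), h3]

theorem exists_program {p : ℕ → ℕ} (hp : Primrec p) :
    ∃ (P : ℕ → Instr) (N : ℕ), (∀ a, (P a).Bounded N) ∧
      ∀ n, ∃ t, n ≤ t ∧ (signalTimes P t).card = ((Finset.range n).filter (p · ≠ 0)).card := by
  obtain ⟨L, hL⟩ := comp_of_primrec' (Nat.Primrec'.prim_iff₁.2 hp) 2 (fun _ => 0) 1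
    (by simp) (by simp) (by simp) 0
  let C : List Instr := L ++ [.inc 1 (L.length + 1), .dec 2 (L.length + 2) 0, .sig 0]
  let P : ℕ → Instr := fun a => C.getD a (.inc 0 0)
  have hP : CodeAt P 0 C := codeAt_getD (.inc 0 0) [] C
  obtain ⟨N, hN⟩ := exists_bounded_getD C (.inc 0 0)
  refine ⟨P, N, hN, fun n => ?_⟩
  rw [codeAt_append] at hP
  obtain ⟨hPL, hP1, hP2, hP3, -⟩ := hP
  simp only [Nat.zero_add] at hP1 hP2 hP3
  suffices h : ∃ t u, n ≤ t ∧ run P t = .ctl 0 u ∧ regs u 0 = n ∧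
      (signalTimes P t).card = ((Finset.range n).filter (p · ≠ 0)).card by
    obtain ⟨t, u, h1, -, -, h2⟩ := h
    exact ⟨t, h1, h2⟩
  induction n with
  | zero => exact ⟨0, [], by simp, rfl, by simp, by simp [signalTimes]⟩
  | succ n ih =>
    obtain ⟨t, u, h1, h2, h3, h4⟩ := ih
    obtain ⟨w, ⟨hw1, hw0⟩, hr⟩ := hL P hPL u
    obtain ⟨t₁, g1, g2, g3⟩ := Reach.exists_run hr h2
    rw [Nat.zero_add] at g2
    have hw1 : regs w 1 = p n := by simpa [List.Vector.ofFn, h3] using hw1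
    have hw0 : regs w 0 = n := by simpa [h3] using hw0 0
    have hw' : regs (1 :: w) = Function.update (regs w) 0 (n + 1) := by
      rw [← hw0]; exact regs_succ_cons 0 w
    have hs1 : run P (t₁ + 1) = .ctl (L.length + 1) (1 :: w) := by
      rw [run_succ, g2]; simp [next, hP1]
    have hs2 : signalTimes P (t₁ + 1) = signalTimes P t₁ :=
      signalTimes_succ_of_not (by rw [g2]; simp [Signals, hP1])
    by_cases hpn : p n = 0
    · obtain ⟨w', hw', hr'⟩ := reach_dec_of_eq hP2 (1 :: w) (by rw [hw']; simp [hw1, hpn])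
      obtain ⟨t₂, f1, f2, f3⟩ := Reach.exists_run hr' hs1
      refine ⟨t₂, w', by omega, f2, by simp_all, ?_⟩
      rw [f3, hs2, g3, h4, Finset.range_add_one, Finset.filter_insert]
      simp [hpn]
    · obtain ⟨w', hw', hr'⟩ := reach_dec_of_ne hP2 (1 :: w) (by rw [hw']; simp [hw1, hpn])
      obtain ⟨t₂, f1, f2, f3⟩ := Reach.exists_run hr' hs1
      refine ⟨t₂ + 1, 0 :: w', by omega, ?_, by simp_all, ?_⟩
      · rw [run_succ, f2]; simp [next, hP3]
      · rw [card_signalTimes_succ (by rw [f2]; simp [Signals, hP3]), f3, hs2, g3, h4,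
          Finset.range_add_one, Finset.filter_insert]
        simp [hpn]

open Nat.Partrec (Code) in
/-- A primitive recursive slow count, below the inverse of a computable function. -/
theorem exists_primrec_count {S : ℕ → ℕ} (hS : Computable S) (hS0 : S 0 = 0) :
    ∃ h : ℕ → ℕ, Primrec h ∧ h 0 = 0 ∧ (∀ n, h (n + 1) = h n ∨ h (n + 1) = h n + 1) ∧
      (∀ n, S (h n) ≤ n) ∧ ∀ B, ∃ n, B ≤ h n := by
  obtain ⟨c, hc⟩ := Code.exists_code.1 (Partrec.nat_iff.1 hS)
  let h : ℕ → ℕ := fun n => n.rec 0 fun m k =>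
    (Code.evaln m c (k + 1)).casesOn k fun s => if s ≤ m then k + 1 else k
  have hsucc : ∀ m, h (m + 1) = (Code.evaln m c (h m + 1)).casesOn (h m)
      fun s => if s ≤ m then h m + 1 else h m := fun m => rfl
  have hmem : ∀ {m k s}, Code.evaln m c k = some s → s = S k := by
    intro m k s hs
    have := Code.evaln_sound (Option.mem_def.2 hs)
    rw [hc] at this
    simpa using this
  have hcase : ∀ n, h (n + 1) = h n ∨ h (n + 1) = h n + 1 ∧ S (h n + 1) ≤ n := by
    intro n
    rw [hsucc]
    rcases he : Code.evaln n c (h n + 1) with _ | s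
    · exact .inl rfl
    · have := hmem he
      subst this
      by_cases hs : S (h n + 1) ≤ n
      · simp [hs]
      · simp [hs]
  have hmono : Monotone h := monotone_nat_of_le_succ fun n => by
    rcases hcase n with h | h <;> omega
  refine ⟨h, ?_, rfl, fun n => (hcase n).imp_right And.left, fun n => ?_, fun B => ?_⟩
  · suffices step : Primrec₂ fun (_ : ℕ) (x : ℕ × ℕ) =>
        ((Code.evaln x.1 c (x.2 + 1)).casesOn x.2
          fun s => if s ≤ x.1 then x.2 + 1 else x.2 : ℕ) from
      Primrec.nat_rec' Primrec.id (.const 0) step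
    refine Primrec.option_casesOn ?_ (Primrec.snd.comp Primrec.snd) ?_
    · exact Code.primrec_evaln.comp (((Primrec.fst.comp Primrec.snd).pair (.const c)).pair
        (Primrec.succ.comp (Primrec.snd.comp Primrec.snd)))
    · have hk : Primrec fun a : (ℕ × ℕ × ℕ) × ℕ => a.1.2.2 :=
        Primrec.snd.comp (Primrec.snd.comp Primrec.fst)
      have hm : Primrec fun a : (ℕ × ℕ × ℕ) × ℕ => a.1.2.1 :=
        Primrec.fst.comp (Primrec.snd.comp Primrec.fst)
      exact Primrec.ite (Primrec.nat_le.comp Primrec.snd hm) (Primrec.succ.comp hk) hk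
  · induction n with
    | zero => exact hS0.le
    | succ n ih =>
      rcases hcase n with h | h
      · rw [h]; omega
      · rw [h.1]; omega
  · induction B with
    | zero => exact ⟨0, by simp⟩
    | succ B ih =>
      obtain ⟨n, hn⟩ := ih
      by_contra hlt
      push Not at hlt
      have hB : ∀ m, n ≤ m → h m = B := fun m hm => by
        have := hmono hm; have := hlt m; omega
      have hev : S (B + 1) ∈ c.eval (B + 1) := by rw [hc]; simp
      obtain ⟨k, hk⟩ := Code.evaln_complete.1 hev
      let m := max n (max k (S (B + 1)))
      have hm : Code.evaln m c (B + 1) = some (S (B + 1)) :=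
        Code.evaln_mono (by simp [m]) hk
      have h1 := hsucc m
      have hSm : S (B + 1) ≤ m := by simp [m]
      rw [hB m (by simp [m]), hB (m + 1) (by simp [m]; omega), hm] at h1
      simp [hSm] at h1

/-- Symbols of the rewriting system simulating a scanning machine. -/
inductive Sym
  | lb
  | rb
  | spore
  | letter (i : ℕ)
  | ctl (a : ℕ)
  | scan (a : ℕ)
  | back (b : ℕ)

/-- Injective numbering of the symbols. -/
def Sym.code : Sym → ℕ
  | .lb => 0
  | .rb => 1
  | .spore => 2
  | .letter i => 4 * i + 3
  | .ctl a => 4 * a + 4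
  | .scan a => 4 * a + 5
  | .back b => 4 * b + 6

theorem Sym.code_injective : Function.Injective Sym.code := by
  intro x y h
  cases x <;> cases y <;> simp only [Sym.code] at h <;> first | rfl | omega | (congr 1; omega)

/-- Symbols that trigger a rewrite. -/
def Sym.IsHead : Sym → Prop
  | .spore | .ctl _ | .scan _ | .back _ => True
  | _ => False

/-- The rewrite rules: simulate the machine, spawn a spore at a signal, and let spores grow. Every
rule increases the length by one. -/
inductive Rule (P : ℕ → Instr) (N : ℕ) : List Sym → List Sym → Prop
  | inc {a i b} (ha : a < N) (h : P a = .inc i b) : Rule P N [.ctl a] [.letter i, .ctl b]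
  | dec {a i b c} (ha : a < N) (h : P a = .dec i b c) :
    Rule P N [.ctl a] [.letter 0, .scan a]
  | sig {a b} (ha : a < N) (h : P a = .sig b) : Rule P N [.ctl a] [.letter 0, .ctl b]
  | spawn {a b} (ha : a < N) (h : P a = .sig b) : Rule P N [.ctl a] [.letter 0, .spore]
  | grow : Rule P N [.spore] [.spore, .letter 0]
  | pass {a i b c j} (ha : a < N) (h : P a = .dec i b c) (hj : j < N) (hji : j ≠ i) :
    Rule P N [.letter j, .scan a] [.scan a, .letter j, .letter 0]
  | hit {a i b c} (ha : a < N) (h : P a = .dec i b c) :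
    Rule P N [.letter i, .scan a] [.letter 0, .letter 0, .back b]
  | miss {a i b c} (ha : a < N) (h : P a = .dec i b c) :
    Rule P N [.lb, .scan a] [.lb, .letter 0, .back c]
  | back {b j} (hb : b < N) (hj : j < N) :
    Rule P N [.back b, .letter j] [.letter j, .letter 0, .back b]
  | land {b} (hb : b < N) : Rule P N [.back b, .rb] [.letter 0, .ctl b, .rb]

theorem Rule.length {P : ℕ → Instr} {N : ℕ} {r t : List Sym} (h : Rule P N r t) :
    t.length = r.length + 1 := by
  cases h <;> rfl

theorem Rule.mem_bounded {P : ℕ → Instr} {N : ℕ} (hP : ∀ a, (P a).Bounded N) {r t : List Sym}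
    (h : Rule P N r t) : (r.length ≤ 3 ∧ ∀ x ∈ r, x.code < 4 * N + 7) ∧
      t.length ≤ 3 ∧ ∀ x ∈ t, x.code < 4 * N + 7 := by
  cases h
  case inc a i b ha h => have := hP a; simp [h, Instr.Bounded, Sym.code] at *; omega
  case dec a i b c ha h => have := hP a; simp [h, Instr.Bounded, Sym.code] at *; omega
  case sig a b ha h => have := hP a; simp [h, Instr.Bounded, Sym.code] at *; omega
  case spawn a b ha h => have := hP a; simp [h, Instr.Bounded, Sym.code] at *; omega
  case grow => simp [Sym.code]
  case pass a i b c j hj hji ha h => have := hP a; simp [h, Instr.Bounded, Sym.code] at *; omega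
  case hit a i b c ha h => have := hP a; simp [h, Instr.Bounded, Sym.code] at *; omega
  case miss a i b c ha h => have := hP a; simp [h, Instr.Bounded, Sym.code] at *; omega
  case back => simp [Sym.code]; omega
  case land => simp [Sym.code]; omega

theorem finite_bounded_lists (n B : ℕ) :
    {l : List ℕ | l.length ≤ n ∧ ∀ x ∈ l, x < B}.Finite := by
  refine ((List.finite_length_le (Fin B) n).image (List.map Fin.val)).subset ?_
  rintro l ⟨hl, hB⟩
  exact ⟨l.pmap Fin.mk hB, by simpa using hl, by simp [List.map_pmap]⟩

theorem finite_rules {P : ℕ → Instr} {N : ℕ} (hP : ∀ a, (P a).Bounded N) :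
    {q : List ℕ × List ℕ | ∃ r t, Rule P N r t ∧ q = (r.map Sym.code, t.map Sym.code)}.Finite := by
  refine ((finite_bounded_lists 3 (4 * N + 7)).prod
    (finite_bounded_lists 3 (4 * N + 7))).subset ?_
  rintro _ ⟨r, t, h, rfl⟩
  simpa using h.mem_bounded hP

/-- Rewriting of words of symbols. -/
def SymStep (P : ℕ → Instr) (N : ℕ) (x y : List Sym) : Prop :=
  ∃ r t u v, Rule P N r t ∧ x = u ++ r ++ v ∧ y = u ++ t ++ v

theorem SymStep.length {P : ℕ → Instr} {N : ℕ} {x y : List Sym} (h : SymStep P N x y) :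
    y.length = x.length + 1 := by
  obtain ⟨r, t, u, v, h, rfl, rfl⟩ := h
  simp [h.length]
  omega

/-- The multiway system simulating a scanning machine. -/
noncomputable def system {P : ℕ → Instr} {N : ℕ} (hP : ∀ a, (P a).Bounded N) : Multiway where
  rules := (finite_rules hP).toFinset
  init := [Sym.lb, .ctl 0, .rb].map Sym.code

theorem system_step {P : ℕ → Instr} {N : ℕ} (hP : ∀ a, (P a).Bounded N) (x : List Sym)
    (y : List ℕ) : (system hP).Step (x.map Sym.code) y ↔
      ∃ z, SymStep P N x z ∧ y = z.map Sym.code := by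
  constructor
  · rintro ⟨q, hq, u, v, hx, rfl⟩
    simp only [system, Set.Finite.mem_toFinset, Set.mem_ofPred_eq] at hq
    obtain ⟨r, t, hr, rfl⟩ := hq
    obtain ⟨x', v', rfl, hx', rfl⟩ := List.map_eq_append_iff.1 hx
    obtain ⟨u', r', rfl, rfl, hr'⟩ := List.map_eq_append_iff.1 hx'
    obtain rfl := Sym.code_injective.list_map hr'
    exact ⟨u' ++ t ++ v', ⟨_, _, u', v', hr, rfl, rfl⟩, by simp⟩
  · rintro ⟨z, ⟨r, t, u, v, hr, rfl, rfl⟩, rfl⟩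
    refine ⟨(r.map Sym.code, t.map Sym.code), ?_, u.map Sym.code, v.map Sym.code, ?_, ?_⟩
    · simp only [system, Set.Finite.mem_toFinset, Set.mem_ofPred_eq]
      exact ⟨r, t, hr, rfl⟩
    · simp
    · simp

/-- A word with a single head decomposes uniquely around it. -/
theorem head_unique {x y u v : List Sym} {h h' : Sym} (hx : ∀ z ∈ x, ¬ z.IsHead)
    (hy : ∀ z ∈ y, ¬ z.IsHead) (e : x ++ h :: y = u ++ h' :: v) (hh : h'.IsHead) :
    x = u ∧ h = h' ∧ y = v := by
  induction x generalizing u with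
  | nil =>
    cases u with
    | nil => simpa using e
    | cons a u =>
      simp only [List.nil_append, List.cons_append, List.cons.injEq] at e
      exact absurd hh (hy _ (by rw [e.2]; simp))
  | cons a x ih =>
    cases u with
    | nil =>
      simp only [List.nil_append, List.cons_append, List.cons.injEq] at e
      exact absurd hh (hx _ (by rw [e.1]; simp))
    | cons b u =>
      simp only [List.cons_append, List.cons.injEq] at e
      obtain ⟨rfl, h2, h3⟩ := ih (fun z hz => hx z (by simp [hz])) e.2
      exact ⟨by rw [e.1], h2, h3⟩

/-- The part of the string left of the head. -/
def leftStr (u : List ℕ) : List Sym := .lb :: (u.reverse.map .letter)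

/-- The part of the string right of the head. -/
def rightStr (v : List ℕ) : List Sym := v.map .letter ++ [.rb]

theorem leftStr_nil : leftStr [] = [.lb] := rfl

theorem leftStr_cons (j : ℕ) (u : List ℕ) : leftStr (j :: u) = leftStr u ++ [.letter j] := by
  simp [leftStr]

theorem rightStr_nil : rightStr [] = [.rb] := rfl

theorem rightStr_cons (j : ℕ) (v : List ℕ) : rightStr (j :: v) = .letter j :: rightStr v := rfl

theorem not_isHead_of_mem_leftStr {u : List ℕ} : ∀ z ∈ leftStr u, ¬ z.IsHead := by
  simp [leftStr, Sym.IsHead]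

theorem not_isHead_of_mem_rightStr {v : List ℕ} : ∀ z ∈ rightStr v, ¬ z.IsHead := by
  simp only [rightStr, List.mem_append, List.mem_map, List.mem_singleton]
  rintro _ (⟨_, _, rfl⟩ | rfl) <;> simp [Sym.IsHead]

theorem append_eq_leftStr {x : List Sym} {j : ℕ} {u : List ℕ}
    (h : leftStr u = x ++ [.letter j]) : ∃ u', u = j :: u' ∧ x = leftStr u' := by
  cases u with
  | nil => cases x <;> simp [leftStr] at h
  | cons i u =>
    rw [leftStr_cons] at h
    obtain ⟨h1, h2⟩ := List.append_inj' h rfl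
    simp only [List.cons.injEq, Sym.letter.injEq, and_true] at h2
    exact ⟨u, by rw [h2], h1.symm⟩

theorem append_lb_eq_leftStr {x : List Sym} {u : List ℕ}
    (h : leftStr u = x ++ [.lb]) : u = [] ∧ x = [] := by
  cases u with
  | nil => cases x <;> simp [leftStr] at h ⊢
  | cons i u =>
    rw [leftStr_cons] at h
    simpa using (List.append_inj' h rfl).2

/-- The string representing a configuration. -/
def Cfg.str : Cfg → List Sym
  | .ctl a u => leftStr u ++ .ctl a :: rightStr []
  | .scan a u v => leftStr u ++ .scan a :: rightStr v
  | .back b u v => leftStr u ++ .back b :: rightStr v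

/-- The string of a spore that was spawned next to the word `u` and grew for `k` steps. -/
def sporeStr (u : List ℕ) (k : ℕ) : List Sym :=
  leftStr (0 :: u) ++ .spore :: rightStr (List.replicate k 0)

/-- Configurations with letters and addresses below `N`. -/
def Cfg.Good (P : ℕ → Instr) (N : ℕ) : Cfg → Prop
  | .ctl a u => a < N ∧ ∀ j ∈ u, j < N
  | .scan a u v => (a < N ∧ ∃ i b c, P a = .dec i b c) ∧ (∀ j ∈ u, j < N) ∧ ∀ j ∈ v, j < N
  | .back b u v => b < N ∧ (∀ j ∈ u, j < N) ∧ ∀ j ∈ v, j < N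

/-- The word of a configuration left of the head. -/
def Cfg.left : Cfg → List ℕ
  | .ctl _ u | .scan _ u _ | .back _ u _ => u

theorem good_next {P : ℕ → Instr} {N : ℕ} (hP : ∀ a, (P a).Bounded N) {c : Cfg}
    (hc : c.Good P N) : (next P c).Good P N := by
  cases c with
  | ctl a u =>
    obtain ⟨ha, hu⟩ := hc
    have hb := hP a
    have h0 : 0 < N := by omega
    rcases h : P a with ⟨i, b⟩ | ⟨i, b, c⟩ | b <;> rw [h] at hb <;>
      simp_all [next, Cfg.Good, Instr.Bounded]
  | scan a u v =>
    obtain ⟨⟨ha, i, b, c, h⟩, hu, hv⟩ := hc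
    have hb := hP a
    have h0 : 0 < N := by omega
    rw [h] at hb
    cases u with
    | nil => simp_all [next, Cfg.Good, Instr.Bounded]
    | cons j u =>
      by_cases hj : j = i <;> simp_all [next, Cfg.Good, Instr.Bounded]
  | back b u v =>
    obtain ⟨hb, hu, hv⟩ := hc
    have h0 : 0 < N := by omega
    cases v <;> simp_all [next, Cfg.Good]

theorem symStep_sporeStr {P : ℕ → Instr} {N : ℕ} (u : List ℕ) (k : ℕ) (y : List Sym) :
    SymStep P N (sporeStr u k) y ↔ y = sporeStr u (k + 1) := by
  constructor
  · rintro ⟨r, t, x, z, hr, hx, rfl⟩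
    have key : ∀ (x z : List Sym) (h : Sym), h.IsHead → sporeStr u k = x ++ h :: z →
        leftStr (0 :: u) = x ∧ Sym.spore = h ∧ rightStr (List.replicate k 0) = z :=
      fun x z h hh e => head_unique not_isHead_of_mem_leftStr not_isHead_of_mem_rightStr e hh
    cases hr
    case grow =>
      obtain ⟨rfl, -, rfl⟩ := key x z .spore trivial (by simpa using hx)
      simp [sporeStr, List.replicate_succ, rightStr_cons]
    case pass a _ _ _ j _ _ _ _ =>
      cases (key (x ++ [.letter j]) z (.scan a) trivial (by simpa using hx)).2.1
    case hit a i _ _ _ _ =>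
      cases (key (x ++ [.letter i]) z (.scan a) trivial (by simpa using hx)).2.1
    case miss a _ _ _ _ _ => cases (key (x ++ [.lb]) z (.scan a) trivial (by simpa using hx)).2.1
    case back b j _ _ => cases (key x (.letter j :: z) (.back b) trivial (by simpa using hx)).2.1
    case land b _ => cases (key x (.rb :: z) (.back b) trivial (by simpa using hx)).2.1
    case inc a _ _ _ _ => cases (key x z (.ctl a) trivial (by simpa using hx)).2.1
    case dec a _ _ _ _ _ => cases (key x z (.ctl a) trivial (by simpa using hx)).2.1
    case sig a _ _ _ => cases (key x z (.ctl a) trivial (by simpa using hx)).2.1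
    case spawn a _ _ _ => cases (key x z (.ctl a) trivial (by simpa using hx)).2.1
  · rintro rfl
    exact ⟨_, _, leftStr (0 :: u), rightStr (List.replicate k 0), .grow, by simp [sporeStr],
      by simp [sporeStr, List.replicate_succ, rightStr_cons]⟩

theorem symStep_str_next {P : ℕ → Instr} {N : ℕ} {c : Cfg} (hc : c.Good P N) :
    SymStep P N c.str (next P c).str := by
  cases c with
  | ctl a u =>
    obtain ⟨ha, hu⟩ := hc
    rcases h : P a with ⟨i, b⟩ | ⟨i, b, c⟩ | b
    · exact ⟨_, _, leftStr u, rightStr [], .inc ha h, by simp [Cfg.str],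
        by simp [next, h, Cfg.str, leftStr_cons]⟩
    · exact ⟨_, _, leftStr u, rightStr [], .dec ha h, by simp [Cfg.str],
        by simp [next, h, Cfg.str, leftStr_cons]⟩
    · exact ⟨_, _, leftStr u, rightStr [], .sig ha h, by simp [Cfg.str],
        by simp [next, h, Cfg.str, leftStr_cons]⟩
  | scan a u v =>
    obtain ⟨⟨ha, i, b, c, h⟩, hu, hv⟩ := hc
    cases u with
    | nil =>
      exact ⟨_, _, [], rightStr v, .miss ha h, by simp [Cfg.str, leftStr_nil],
        by simp [next, h, Cfg.str, leftStr_cons, leftStr_nil]⟩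
    | cons j u =>
      by_cases hj : j = i
      · subst hj
        exact ⟨_, _, leftStr u, rightStr v, .hit ha h, by simp [Cfg.str, leftStr_cons],
          by simp [next, h, Cfg.str, leftStr_cons]⟩
      · exact ⟨_, _, leftStr u, rightStr v, .pass ha h (hu j (by simp)) hj,
          by simp [Cfg.str, leftStr_cons], by simp [next, h, hj, Cfg.str, rightStr_cons]⟩
  | back b u v =>
    obtain ⟨hb, hu, hv⟩ := hc
    cases v with
    | nil =>
      exact ⟨_, _, leftStr u, [], .land hb, by simp [Cfg.str, rightStr_nil],
        by simp [next, Cfg.str, leftStr_cons, rightStr_nil]⟩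
    | cons j v =>
      exact ⟨_, _, leftStr u, rightStr v, .back hb (hv j (by simp)),
        by simp [Cfg.str, rightStr_cons], by simp [next, Cfg.str, leftStr_cons]⟩

theorem symStep_str_sporeStr {P : ℕ → Instr} {N : ℕ} {c : Cfg} (hc : c.Good P N)
    (hs : Signals P c) : SymStep P N c.str (sporeStr c.left 0) := by
  cases c with
  | ctl a u =>
    obtain ⟨b, h⟩ := hs
    exact ⟨_, _, leftStr u, rightStr [], .spawn hc.1 h, by simp [Cfg.str],
      by simp [sporeStr, Cfg.left, leftStr_cons]⟩
  | scan a u v => exact hs.elim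
  | back b u v => exact hs.elim

theorem eq_of_symStep_str {P : ℕ → Instr} {N : ℕ} {c : Cfg} {y : List Sym}
    (h : SymStep P N c.str y) :
    y = (next P c).str ∨ Signals P c ∧ y = sporeStr c.left 0 := by
  obtain ⟨r, t, x, z, hr, hx, rfl⟩ := h
  have key : ∀ (x z : List Sym) (h : Sym), h.IsHead → c.str = x ++ h :: z →
      (∃ a u, c = .ctl a u ∧ h = .ctl a ∧ x = leftStr u ∧ z = rightStr []) ∨
      (∃ a u v, c = .scan a u v ∧ h = .scan a ∧ x = leftStr u ∧ z = rightStr v) ∨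
      (∃ b u v, c = .back b u v ∧ h = .back b ∧ x = leftStr u ∧ z = rightStr v) := by
    intro x z h hh e
    cases c <;>
      obtain ⟨rfl, rfl, rfl⟩ :=
        head_unique not_isHead_of_mem_leftStr not_isHead_of_mem_rightStr e hh <;>
      simp
  have key₁ : ∀ {x z a}, c.str = x ++ [Sym.ctl a] ++ z →
      ∃ u, c = .ctl a u ∧ x = leftStr u ∧ z = rightStr [] := by
    intro x z a e
    rcases key x z (.ctl a) trivial (by simpa using e) with
      ⟨a', u, h, h', rfl, rfl⟩ | ⟨a', u, v, h, h', rfl, rfl⟩ | ⟨a', u, v, h, h', rfl, rfl⟩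
    · cases h'; exact ⟨u, h, rfl, rfl⟩
    · cases h'
    · cases h'
  have key₂ : ∀ {x z a s}, c.str = x ++ [s, Sym.scan a] ++ z →
      ∃ u v, c = .scan a u v ∧ x ++ [s] = leftStr u ∧ z = rightStr v := by
    intro x z a s e
    rcases key (x ++ [s]) z (.scan a) trivial (by simpa using e) with
      ⟨a', u, h, h', h1, h2⟩ | ⟨a', u, v, h, h', h1, h2⟩ | ⟨a', u, v, h, h', h1, h2⟩
    · cases h'
    · cases h'; exact ⟨u, v, h, h1, h2⟩
    · cases h'
  have key₃ : ∀ {x z b s}, c.str = x ++ [Sym.back b, s] ++ z →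
      ∃ u v, c = .back b u v ∧ x = leftStr u ∧ s :: z = rightStr v := by
    intro x z b s e
    rcases key x (s :: z) (.back b) trivial (by simpa using e) with
      ⟨a', u, h, h', h1, h2⟩ | ⟨a', u, v, h, h', h1, h2⟩ | ⟨a', u, v, h, h', h1, h2⟩
    · cases h'
    · cases h'
    · cases h'; exact ⟨u, v, h, h1, h2⟩
  cases hr
  case inc a i b ha h =>
    obtain ⟨u, rfl, rfl, rfl⟩ := key₁ hx
    left; simp [next, h, Cfg.str, leftStr_cons]
  case dec a i b c ha h =>
    obtain ⟨u, rfl, rfl, rfl⟩ := key₁ hx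
    left; simp [next, h, Cfg.str, leftStr_cons]
  case sig a b ha h =>
    obtain ⟨u, rfl, rfl, rfl⟩ := key₁ hx
    left; simp [next, h, Cfg.str, leftStr_cons]
  case spawn a b ha h =>
    obtain ⟨u, rfl, rfl, rfl⟩ := key₁ hx
    right; exact ⟨⟨b, h⟩, by simp [sporeStr, Cfg.left, leftStr_cons]⟩
  case grow => rcases key x z .spore trivial (by simpa using hx) with
      ⟨a', u, h, h', h1, h2⟩ | ⟨a', u, v, h, h', h1, h2⟩ | ⟨a', u, v, h, h', h1, h2⟩ <;> cases h'
  case pass a i b c j hj hji ha h =>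
    obtain ⟨u, v, rfl, h1, rfl⟩ := key₂ hx
    obtain ⟨u, rfl, rfl⟩ := append_eq_leftStr h1.symm
    left; simp [next, h, hji, Cfg.str, rightStr_cons]
  case hit a i b c ha h =>
    obtain ⟨u, v, rfl, h1, rfl⟩ := key₂ hx
    obtain ⟨u, rfl, rfl⟩ := append_eq_leftStr h1.symm
    left; simp [next, h, Cfg.str, leftStr_cons]
  case miss a i b c ha h =>
    obtain ⟨u, v, rfl, h1, rfl⟩ := key₂ hx
    obtain ⟨rfl, rfl⟩ := append_lb_eq_leftStr h1.symm
    left; simp [next, h, Cfg.str, leftStr_cons, leftStr_nil]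
  case back b j hb hj =>
    obtain ⟨u, v, rfl, rfl, h1⟩ := key₃ hx
    cases v with
    | nil => simp [rightStr] at h1
    | cons i v =>
      simp only [rightStr_cons, List.cons.injEq, Sym.letter.injEq] at h1
      obtain ⟨rfl, rfl⟩ := h1
      left; simp [next, Cfg.str, leftStr_cons]
  case land b hb =>
    obtain ⟨u, v, rfl, rfl, h1⟩ := key₃ hx
    cases v with
    | nil =>
      simp only [rightStr_nil, List.cons.injEq, true_and] at h1
      subst h1
      left; simp [next, Cfg.str, leftStr_cons, rightStr_nil]
    | cons i v => simp [rightStr_cons] at h1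

theorem good_run {P : ℕ → Instr} {N : ℕ} (hP : ∀ a, (P a).Bounded N) (t : ℕ) :
    (run P t).Good P N := by
  induction t with
  | zero =>
    refine ⟨?_, by simp⟩
    have := hP 0
    rcases h : P 0 with ⟨i, b⟩ | ⟨i, b, c⟩ | b <;> rw [h] at this <;>
      simp only [Instr.Bounded] at this <;> omega
  | succ t ih => rw [run_succ]; exact good_next hP ih

theorem length_str_run {P : ℕ → Instr} {N : ℕ} (hP : ∀ a, (P a).Bounded N) (t : ℕ) :
    (run P t).str.length = t + 3 := by
  induction t with
  | zero => rfl
  | succ t ih => rw [run_succ, (symStep_str_next (good_run hP t)).length, ih]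

theorem length_left_of_signals {P : ℕ → Instr} {N : ℕ} (hP : ∀ a, (P a).Bounded N) {t : ℕ}
    (hs : Signals P (run P t)) : (run P t).left.length = t := by
  have := length_str_run hP t
  rcases h : run P t with ⟨a, u⟩ | ⟨a, u, v⟩ | ⟨b, u, v⟩
  · rw [h] at this
    simpa [Cfg.str, leftStr, rightStr, Cfg.left] using this
  · rw [h] at hs; exact hs.elim
  · rw [h] at hs; exact hs.elim

theorem sporeStr_ne_str (u : List ℕ) (k : ℕ) (c : Cfg) : sporeStr u k ≠ c.str := by
  intro e
  cases c <;>
    cases (head_unique not_isHead_of_mem_leftStr not_isHead_of_mem_rightStr e trivial).2.1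

theorem length_eq_of_sporeStr_eq {u u' : List ℕ} {k k' : ℕ} (e : sporeStr u k = sporeStr u' k') :
    u.length = u'.length := by
  have := congrArg List.length
    (head_unique not_isHead_of_mem_leftStr not_isHead_of_mem_rightStr e trivial).1
  simpa [leftStr] using this

/-- The words of symbols reached after `t` steps. -/
def level (P : ℕ → Instr) (t : ℕ) : Set (List Sym) :=
  insert (run P t).str ((fun m => sporeStr (run P m).left (t - 1 - m)) '' signalTimes P t)

theorem mem_level_succ {P : ℕ → Instr} {N : ℕ} (hP : ∀ a, (P a).Bounded N) (t : ℕ)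
    (y : List Sym) : y ∈ level P (t + 1) ↔ ∃ x ∈ level P t, SymStep P N x y := by
  have hgood := good_run hP t
  simp only [level, Set.mem_insert_iff, Set.mem_image, Finset.mem_coe, mem_signalTimes]
  constructor
  · rintro (rfl | ⟨m, ⟨hm, hs⟩, rfl⟩)
    · exact ⟨_, .inl rfl, by rw [run_succ]; exact symStep_str_next hgood⟩
    · rcases Nat.lt_succ_iff_lt_or_eq.1 hm with hm | rfl
      · refine ⟨_, .inr ⟨m, ⟨hm, hs⟩, rfl⟩, (symStep_sporeStr _ _ _).2 ?_⟩
        congr 1; omega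
      · refine ⟨_, .inl rfl, ?_⟩
        simpa using symStep_str_sporeStr hgood hs
  · rintro ⟨x, rfl | ⟨m, ⟨hm, hs⟩, rfl⟩, hxy⟩
    · rcases eq_of_symStep_str hxy with rfl | ⟨hs, rfl⟩
      · exact .inl (by rw [run_succ])
      · exact .inr ⟨t, ⟨by omega, hs⟩, by simp⟩
    · rw [symStep_sporeStr] at hxy
      refine .inr ⟨m, ⟨by omega, hs⟩, ?_⟩
      rw [hxy]; congr 1; omega

theorem system_stepN {P : ℕ → Instr} {N : ℕ} (hP : ∀ a, (P a).Bounded N) (t : ℕ) (y : List ℕ) :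
    (system hP).StepN t y ↔ y ∈ List.map Sym.code '' level P t := by
  induction t generalizing y with
  | zero =>
    simp [Multiway.StepN, level, signalTimes, system, Cfg.str, leftStr, rightStr]
  | succ t ih =>
    simp only [Multiway.StepN, ih, Set.mem_image, mem_level_succ hP]
    constructor
    · rintro ⟨_, ⟨x, hx, rfl⟩, hxy⟩
      obtain ⟨z, hz, rfl⟩ := (system_step hP x y).1 hxy
      exact ⟨z, ⟨x, hx, hz⟩, rfl⟩
    · rintro ⟨z, ⟨x, hx, hz⟩, rfl⟩
      exact ⟨_, ⟨x, hx, rfl⟩, (system_step hP x _).2 ⟨z, hz, rfl⟩⟩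

theorem length_of_mem_level {P : ℕ → Instr} {N : ℕ} (hP : ∀ a, (P a).Bounded N) {t : ℕ}
    {y : List Sym} (hy : y ∈ level P t) : y.length = t + 3 := by
  induction t generalizing y with
  | zero =>
    have : y = (run P 0).str := by simpa [level, signalTimes] using hy
    rw [this]; rfl
  | succ t ih =>
    obtain ⟨x, hx, hxy⟩ := (mem_level_succ hP t y).1 hy
    rw [hxy.length, ih hx]

theorem ncard_level {P : ℕ → Instr} {N : ℕ} (hP : ∀ a, (P a).Bounded N) (t : ℕ) :
    (level P t).ncard = (signalTimes P t).card + 1 := by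
  rw [level, Set.ncard_insert_of_notMem, Set.InjOn.ncard_image, Set.ncard_coe_finset]
  · intro m hm m' hm' e
    have := length_eq_of_sporeStr_eq e
    rwa [length_left_of_signals hP (mem_signalTimes.1 hm).2,
      length_left_of_signals hP (mem_signalTimes.1 hm').2] at this
  · rintro ⟨m, -, e⟩
    exact sporeStr_ne_str _ _ _ e

theorem system_growth {P : ℕ → Instr} {N : ℕ} (hP : ∀ a, (P a).Bounded N) (t : ℕ) :
    (system hP).growth t = (signalTimes P t).card + 1 := by
  have : (system hP).sphere t = List.map Sym.code '' level P t := by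
    ext y
    simp only [Multiway.sphere, Set.mem_ofPred_eq, system_stepN]
    refine ⟨And.left, fun hy => ⟨hy, ?_⟩⟩
    rintro k hk ⟨x', hx', e⟩
    obtain ⟨x, hx, rfl⟩ := hy
    have h := congrArg List.length e
    simp only [List.length_map, length_of_mem_level hP hx, length_of_mem_level hP hx'] at h
    omega
  rw [Multiway.growth, this,
    Set.ncard_image_of_injective _ Sym.code_injective.list_map, ncard_level hP]

end ScanMachine

/-- for every computable `T` there is a multiway system whose (nondecreasing,
unbounded) growth function is bounded by the inverse of the summatory function of `T`. -/
theorem multiway_growth_below_inverse_summatory (T : ℕ → ℕ) (hT : Computable T) :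
    ∃ M : Multiway, Monotone M.growth ∧ (∀ B : ℕ, ∃ n : ℕ, B < M.growth n) ∧
      ∀ n : ℕ, 1 ≤ n → ∑ k ∈ Finset.Icc 1 (M.growth n - 1), T k ≤ n := by
  have hS : Computable fun n => ∑ k ∈ Finset.Icc 1 n, T k := by
    have step : Computable₂ fun (_ : ℕ) (x : ℕ × ℕ) => x.2 + T (x.1 + 1) :=
      Primrec.nat_add.to_comp.comp (Computable.snd.comp Computable.snd)
        (hT.comp (Computable.succ.comp (Computable.fst.comp Computable.snd)))
    refine (Computable.nat_rec .id (.const 0) step).of_eq fun n => ?_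
    induction n with
    | zero => simp
    | succ n ih =>
      rw [Finset.sum_Icc_succ_top (by omega), ← ih]
      rfl
  obtain ⟨h, hh, h0, hstep, hle, hunb⟩ := ScanMachine.exists_primrec_count hS (by simp)
  obtain ⟨P, N, hP, hrun⟩ := ScanMachine.exists_program
    (Primrec.nat_sub.comp (hh.comp Primrec.succ) hh)
  have hcount : ∀ n, ((Finset.range n).filter fun m => h (m + 1) - h m ≠ 0).card = h n := by
    intro n
    induction n with
    | zero => simp [h0]
    | succ n ih =>
      rw [Finset.range_add_one, Finset.filter_insert]
      rcases hstep n with e | e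
      · rw [if_neg (by omega), ih, e]
      · rw [if_pos (by omega), Finset.card_insert_of_notMem (by simp), ih, e]
  simp only [Nat.succ_eq_add_one, hcount] at hrun
  have hmono : ∀ {s t}, s ≤ t →
      (ScanMachine.signalTimes P s).card ≤ (ScanMachine.signalTimes P t).card :=
    fun hst => Finset.card_le_card (ScanMachine.signalTimes_mono P hst)
  refine ⟨ScanMachine.system hP, fun s t hst => ?_, fun B => ?_, fun n _ => ?_⟩
  · simp only [ScanMachine.system_growth]
    have := hmono hst
    omega
  · obtain ⟨n, hn⟩ := hunb B
    obtain ⟨t, -, ht⟩ := hrun n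
    exact ⟨t, by rw [ScanMachine.system_growth]; omega⟩
  · obtain ⟨t, hnt, ht⟩ := hrun n
    rw [ScanMachine.system_growth, Nat.add_sub_cancel]
    refine le_trans (Finset.sum_le_sum_of_subset (Finset.Icc_subset_Icc_right ?_)) (hle n)
    rw [← ht]
    exact hmono hnt
end

section
/- For every computable, strictly increasing function f : ℕ → ℕ there exists a multiway system M whose growth function g_M is nondecreasing and unbounded and satisfies f(g_M(n)) = O(n) as n → ∞ (i.e. g_M is asymptotically bounded by an asymptotic inverse of f). -/
/-- Restricting a Turing machine to a finite set of states that supports it. -/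
theorem Turing.TM0.Supports.exists_restrict {Γ Λ : Type} [Inhabited Γ] [Inhabited Λ]
    (M : Turing.TM0.Machine Γ Λ) (S : Set Λ) (hS : Turing.TM0.Supports M S) :
    ∃ (_ : Inhabited S) (M' : Turing.TM0.Machine Γ S),
      (default : S).1 = default ∧
      StateTransition.Respects (Turing.TM0.step M) (Turing.TM0.step M')
        fun c c' => c = ⟨c'.q.1, c'.Tape⟩ := by
  let inst : Inhabited S := ⟨⟨default, hS.1⟩⟩
  have hex (q : S) (a : Γ) : ∃ o : Option (S × Turing.TM0.Stmt Γ),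
      o.map (fun p => (p.1.1, p.2)) = M q.1 a := by
    rcases hM : M q.1 a with _ | ⟨q', s⟩
    · exact ⟨none, rfl⟩
    · exact ⟨some (⟨q', hS.2 hM q.2⟩, s), rfl⟩
  choose M' hM' using hex
  refine ⟨inst, M', rfl, ?_⟩
  rintro _ ⟨q, T⟩ rfl
  have hM := hM' q T.head
  rcases ho : M' q T.head with _ | ⟨q', s⟩
  · rw [ho] at hM
    simp [Turing.TM0.step, ← hM, ho]
  · rw [ho] at hM
    have hs : Turing.TM0.step M' ⟨q, T⟩ = some ⟨q', match (generalizing := false) s with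
      | .move d => T.move d
      | .write a => T.write a⟩ := by
      simp only [Turing.TM0.step, ho, Option.map_some]
      cases s <;> rfl
    simp only [Turing.TM0.step, ← hM, Option.map_some]
    exact ⟨_, by cases s <;> rfl, Relation.TransGen.single hs⟩

/-- A finite stack machine is simulated by a finite Turing machine, in such a way that the tape
left behind by a terminating computation is an encoding of the final stacks. -/
theorem Turing.TM2.Supports.exists_turingMachine {K : Type} [DecidableEq K] [Finite K]
    {G : K → Type} [∀ k, Fintype (G k)] {Λ σ : Type} [Inhabited Λ] [Inhabited σ] [Fintype σ]
    {M : Λ → Turing.TM2.Stmt G Λ σ} {S : Finset Λ} (hS : Turing.TM2.Supports M S) :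
    ∃ (Q Γ : Type) (_ : Finite Q) (_ : Finite Γ) (_ : Inhabited Q) (_ : Inhabited Γ)
      (N : Turing.TM0.Machine Γ Q) (T : (∀ k, List (G k)) → Turing.ListBlank Γ → Prop),
      (∀ k L, ∃ R, T (Function.update (fun _ => []) k L) R) ∧
      (∀ s v s', StateTransition.Reaches (Turing.TM2.step M)
        ⟨some default, default, s⟩ ⟨none, v, s'⟩ → ∀ R, T s R →
        ∃ q' R', StateTransition.Reaches (Turing.TM0.step N)
          ⟨default, Turing.Tape.mk' ∅ R⟩ ⟨q', Turing.Tape.mk' ∅ R'⟩ ∧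
          Turing.TM0.step N ⟨q', Turing.Tape.mk' ∅ R'⟩ = none ∧ T s' R') ∧
      ∀ s R, T s R → ∀ k, ∀ i < (s k).length, R.nth i ≠ default := by
  have hsup := Turing.TM1to0.tr_supports _ (Turing.TM2to1.tr_supports M hS)
  obtain ⟨instQ, N, hdef, hN⟩ := hsup.exists_restrict
  have hfin : Finite (Turing.TM2to1.Γ' K G) := inferInstanceAs (Finite (Bool × ∀ k, Option (G k)))
  refine ⟨_, Turing.TM2to1.Γ' K G, Finset.finite_toSet _, hfin, instQ, inferInstance, N,
    fun s R => ∃ L, R = Turing.TM2to1.addBottom L ∧ ∀ k,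
      L.map (Turing.proj k) = Turing.ListBlank.mk ((s k).map some).reverse, ?_, ?_, ?_⟩
  · intro k L
    have h := Turing.TM2to1.trCfg_init (Λ := Λ) (σ := σ) k L
    generalize hc : (Turing.TM1.init (Turing.TM2to1.trInit k L) :
      Turing.TM1.Cfg (Turing.TM2to1.Γ' K G) (Turing.TM2to1.Λ' K G Λ σ) σ) = c at h
    cases h with
    | mk L' h => exact ⟨_, L', rfl, h⟩
  · rintro s v s' hr _ ⟨L, rfl, hL⟩
    obtain ⟨_, ⟨L', hL'⟩, hr₁⟩ := StateTransition.tr_reaches (Turing.TM2to1.tr_respects M)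
      (Turing.TM2to1.TrCfg.mk L hL) hr
    obtain ⟨_, rfl, hr₂⟩ := StateTransition.tr_reaches (Turing.TM1to0.tr_respects _) rfl hr₁
    obtain ⟨⟨q, t⟩, hq, hr₃⟩ := StateTransition.tr_reaches hN
      (a₂ := ⟨default, Turing.Tape.mk' ∅ (Turing.TM2to1.addBottom L)⟩) (by rw [hdef]; rfl) hr₂
    have hstep := hN hq
    obtain ⟨hq', rfl⟩ := Turing.TM0.Cfg.mk.inj hq
    exact ⟨q, _, hr₃, hstep, L', rfl, hL'⟩
  · rintro s _ ⟨L, rfl, hL⟩ k i hi h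
    have h1 := Turing.TM2to1.addBottom_nth_snd L i
    have h2 := Turing.TM2to1.stk_nth_val i (hL k)
    rw [← h1, h, List.getElem?_eq_getElem (by simpa using hi)] at h2
    cases h2

theorem Turing.PartrecToTM2.lt_two_pow_length_trNat (n : ℕ) :
    n < 2 ^ (Turing.PartrecToTM2.trNat n).length := by
  have hpos : ∀ p : PosNum, (p : ℕ) < 2 ^ (Turing.PartrecToTM2.trPosNum p).length := by
    intro p
    induction p with
    | one => simp [Turing.PartrecToTM2.trPosNum]
    | bit0 p ih =>
      simp only [Turing.PartrecToTM2.trPosNum, List.length_cons, pow_succ, PosNum.cast_bit0]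
      omega
    | bit1 p ih =>
      simp only [Turing.PartrecToTM2.trPosNum, List.length_cons, pow_succ, PosNum.cast_bit1]
      omega
  rcases h : (n : Num) with _ | p
  · have : ((n : Num) : ℕ) = 0 := by rw [h]; rfl
    rw [Num.to_of_nat] at this
    simp [this]
  · have : ((n : Num) : ℕ) = p := by rw [h]; rfl
    rw [Num.to_of_nat] at this
    rw [Turing.PartrecToTM2.trNat, h, this]
    exact hpos p

/-- Every computable function is computed by a finite Turing machine whose output tape can be
used as an input tape, and which writes at least as many symbols as a number has binary digits. -/
theorem Computable.exists_turingMachine {F : ℕ → ℕ} (hF : Computable F) :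
    ∃ (Q Γ : Type) (_ : Finite Q) (_ : Finite Γ) (_ : Inhabited Q) (_ : Inhabited Γ)
      (N : Turing.TM0.Machine Γ Q) (T : ℕ → Turing.ListBlank Γ → Prop),
      (∀ n, ∃ R, T n R) ∧
      (∀ n R, T n R → ∃ q' R', StateTransition.Reaches (Turing.TM0.step N)
        ⟨default, Turing.Tape.mk' ∅ R⟩ ⟨q', Turing.Tape.mk' ∅ R'⟩ ∧
        Turing.TM0.step N ⟨q', Turing.Tape.mk' ∅ R'⟩ = none ∧ T (F n) R') ∧
      ∀ n R, T n R → ∃ k, n < 2 ^ k ∧ ∀ i < k, R.nth i ≠ default := by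
  obtain ⟨c, hc⟩ := Turing.ToPartrec.Code.exists_code (Nat.Partrec'.part_iff₁.2 hF.partrec)
  let _ : Inhabited Turing.PartrecToTM2.Λ' :=
    ⟨Turing.PartrecToTM2.trNormal c Turing.PartrecToTM2.Cont'.halt⟩
  have hK : Finite Turing.PartrecToTM2.K' := by
    refine Finite.of_injective (β := Bool × Bool) (fun k => match k with
      | .main => (false, false) | .rev => (false, true)
      | .aux => (true, false) | .stack => (true, true)) ?_
    rintro (_ | _) (_ | _) h <;> first | rfl | cases h
  obtain ⟨Q, Γ, hQ, hΓ, iQ, iΓ, N, T, hT, hN, hlen⟩ := Turing.TM2.Supports.exists_turingMachine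
    (Turing.PartrecToTM2.tr_supports c Turing.PartrecToTM2.Cont'.halt)
  refine ⟨Q, Γ, hQ, hΓ, iQ, iΓ, N,
    fun n => T (Turing.PartrecToTM2.K'.elim (Turing.PartrecToTM2.trList [n]) [] [] []),
    fun n => ?_, fun n => hN _ none _ ?_, fun n R hR => ⟨_,
      Turing.PartrecToTM2.lt_two_pow_length_trNat n, fun i hi => ?_⟩⟩
  · obtain ⟨R, hR⟩ := hT Turing.PartrecToTM2.K'.main (Turing.PartrecToTM2.trList [n])
    refine ⟨R, ?_⟩
    convert hR using 1
    funext k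
    cases k <;> rfl
  · have hmem : Turing.PartrecToTM2.halt [F n] ∈
        StateTransition.eval (Turing.TM2.step Turing.PartrecToTM2.tr)
          (Turing.PartrecToTM2.init c [n]) := by
      have hev : c.eval [n] = Part.some [F n] := by
        have := hc ⟨[n], rfl⟩
        simpa [List.Vector.head] using this
      have := Turing.PartrecToTM2.tr_eval c [n]
      rw [hev] at this
      rw [this, Part.map_eq_map, Part.map_some]
      exact Part.mem_some _
    exact (StateTransition.mem_eval.1 hmem).1
  · refine hlen _ R hR Turing.PartrecToTM2.K'.main i (hi.trans_le ?_)
    simp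

namespace Multiway

/-- If the graph of reachable strings is an infinite path `x` with further infinite paths `y t`
branching off at the times `t` with `H t`, then the growth function counts the branchings. -/
theorem growth_eq_count_add_one {M : Multiway} {x : ℕ → List ℕ} {y : ℕ → ℕ → List ℕ} {H : ℕ → Prop}
    [DecidablePred H] (h0 : M.init = x 0)
    (hx : ∀ t z, M.Step (x t) z ↔ z = x (t + 1) ∨ H t ∧ z = y t 0)
    (hy : ∀ t j z, M.Step (y t j) z ↔ z = y t (j + 1))
    (hxx : Function.Injective x) (hyy : ∀ t j t' j', y t j = y t' j' → t = t' ∧ j = j')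
    (hxy : ∀ t t' j, x t ≠ y t' j) (n : ℕ) :
    M.growth n = Nat.count H n + 1 := by
  have hstep (n : ℕ) (z : List ℕ) :
      M.StepN n z ↔ z = x n ∨ ∃ t j, H t ∧ t + 1 + j = n ∧ z = y t j := by
    induction n generalizing z with
    | zero => simp [StepN, h0]
    | succ n ih =>
      simp only [StepN, ih]
      constructor
      · rintro ⟨w, rfl | ⟨t, j, ht, rfl, rfl⟩, hw⟩
        · rcases (hx _ _).1 hw with rfl | ⟨ht, rfl⟩
          · exact Or.inl rfl
          · exact Or.inr ⟨n, 0, ht, rfl, rfl⟩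
        · exact Or.inr ⟨t, j + 1, ht, rfl, (hy _ _ _).1 hw⟩
      · rintro (rfl | ⟨t, j, ht, hn, rfl⟩)
        · exact ⟨_, Or.inl rfl, (hx _ _).2 (Or.inl rfl)⟩
        · cases j with
          | zero =>
            obtain rfl : t = n := by omega
            exact ⟨_, Or.inl rfl, (hx _ _).2 (Or.inr ⟨ht, rfl⟩)⟩
          | succ j => exact ⟨_, Or.inr ⟨t, j, ht, by omega, rfl⟩, (hy _ _ _).2 rfl⟩
  have hsphere : M.sphere n =
      insert (x n) ((fun t => y t (n - 1 - t)) '' ((Finset.range n).filter H : Finset ℕ)) := by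
    ext z
    simp only [sphere, Set.mem_ofPred_eq, hstep, Set.mem_insert_iff, Set.mem_image, Finset.coe_filter,
      Finset.mem_range]
    constructor
    · rintro ⟨rfl | ⟨t, j, ht, rfl, rfl⟩, -⟩
      · exact Or.inl rfl
      · exact Or.inr ⟨t, ⟨by omega, ht⟩, by congr 1; omega⟩
    · rintro (rfl | ⟨t, ⟨htn, ht⟩, rfl⟩)
      · refine ⟨Or.inl rfl, ?_⟩
        rintro k hk (h | ⟨t, j, -, -, h⟩)
        · exact hk.ne' (hxx h)
        · exact hxy _ _ _ h
      · refine ⟨Or.inr ⟨t, _, ht, by omega, rfl⟩, ?_⟩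
        rintro k hk (h | ⟨t', j, -, hk', h⟩)
        · exact hxy _ _ _ h.symm
        · have := hyy _ _ _ _ h
          omega
  rw [growth, hsphere, Set.ncard_insert_of_notMem, Set.ncard_image_of_injective, Set.ncard_coe_finset,
    Nat.count_eq_card_filter_range]
  · exact fun t t' h => (hyy _ _ _ _ h).1
  · rintro ⟨t, -, h⟩
    exact hxy _ _ _ h.symm

variable {A : Type} [Finite A]

/-- The multiway system with the rules `[x, s, y] → t` for `t ∈ rhs x s y`, over an alphabet `A`
whose symbols are encoded as natural numbers by `code`. -/
noncomputable def ofRhs (code : A → ℕ) (rhs : A → A → A → List (List A)) (init : List A) :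
    Multiway where
  rules := (Set.finite_iUnion fun x => Set.finite_iUnion fun s => Set.finite_iUnion fun y =>
    (List.finite_toSet (rhs x s y)).image
      fun t => ([x, s, y].map code, t.map code)).toFinset
  init := init.map code

theorem ofRhs_step_iff {code : A → ℕ} (hcode : Function.Injective code)
    {rhs : A → A → A → List (List A)} {init w : List A} {z : List ℕ} :
    (ofRhs code rhs init).Step (w.map code) z ↔ ∃ u x s y v t, t ∈ rhs x s y ∧
      w = u ++ x :: s :: y :: v ∧ z = (u ++ t ++ v).map code := by
  simp only [Step, ofRhs, Set.Finite.mem_toFinset, Set.mem_iUnion, Set.mem_image, Set.mem_ofPred_eq]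
  constructor
  · rintro ⟨_, ⟨x, s, y, t, ht, rfl⟩, u, v, hw, rfl⟩
    obtain ⟨w₁, v, rfl, hw₁, rfl⟩ := List.map_eq_append_iff.1 hw
    obtain ⟨u, w₂, rfl, rfl, hw₂⟩ := List.map_eq_append_iff.1 hw₁
    obtain rfl := hcode.list_map hw₂
    exact ⟨u, x, s, y, v, t, ht, by simp, by simp⟩
  · rintro ⟨u, x, s, y, v, t, ht, rfl, rfl⟩
    exact ⟨_, ⟨x, s, y, t, ht, rfl⟩, u.map code, v.map code, by simp, by simp⟩

end Multiway

namespace Turing.TM0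

/-- The alphabet of the multiway system attached to a Turing machine. -/
inductive RewriteSymbol (Γ Q : Type) : Type
  | edge
  | pad
  | letter (a : Γ)
  | state (q : Q)
  | frozen (q : Q)

namespace RewriteSymbol

variable {Γ Q : Type}

instance [Finite Γ] [Finite Q] : Finite (RewriteSymbol Γ Q) := by
  refine Finite.of_injective (β := Bool ⊕ Γ ⊕ Q ⊕ Q) (fun s => match s with
    | edge => .inl true
    | pad => .inl false
    | letter a => .inr (.inl a)
    | state q => .inr (.inr (.inl q))
    | frozen q => .inr (.inr (.inr q))) ?_
  rintro (_ | _ | _ | _ | _) (_ | _ | _ | _ | _) h <;> simp_all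

/-- The symbols of which every reachable string contains exactly one. -/
def IsActive : RewriteSymbol Γ Q → Prop
  | state _ => True
  | frozen _ => True
  | _ => False

theorem eq_of_append_isActive_cons_eq {p p' m m' : List (RewriteSymbol Γ Q)}
    {s s' : RewriteSymbol Γ Q} (hp : ∀ a ∈ p, ¬a.IsActive) (hm : ∀ a ∈ m, ¬a.IsActive)
    (hs' : s'.IsActive) (h : p ++ s :: m = p' ++ s' :: m') :
    p = p' ∧ s = s' ∧ m = m' := by
  induction p generalizing p' with
  | nil =>
    cases p' with
    | nil => simpa using h
    | cons b p' =>
      obtain ⟨-, rfl⟩ := List.cons.inj h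
      exact absurd hs' (hm s' (by simp))
  | cons a p ih =>
    cases p' with
    | nil =>
      obtain ⟨rfl, -⟩ := List.cons.inj h
      exact absurd hs' (hp a (by simp))
    | cons b p' =>
      obtain ⟨rfl, htail⟩ := List.cons.inj h
      obtain ⟨rfl, hsm⟩ := ih (fun c hc => hp c (by simp [hc])) htail
      exact ⟨rfl, hsm⟩

/-- The string with tape content `l` (in reverse order) on the left of the symbol `s`. -/
def word (l : List Γ) (s : RewriteSymbol Γ Q) (m : List (RewriteSymbol Γ Q)) :
    List (RewriteSymbol Γ Q) :=
  edge :: l.reverse.map letter ++ s :: m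

theorem word_inj {l l' : List Γ} {s s' : RewriteSymbol Γ Q} {m m' : List (RewriteSymbol Γ Q)}
    (hm : ∀ a ∈ m, ¬a.IsActive) (hs' : s'.IsActive)
    (h : word l s m = word l' s' m') : l = l' ∧ s = s' ∧ m = m' := by
  obtain ⟨hl, h⟩ := eq_of_append_isActive_cons_eq (by simp [IsActive]) hm hs' h
  refine ⟨?_, h⟩
  have hinj : Function.Injective (letter : Γ → RewriteSymbol Γ Q) := fun _ _ => letter.inj
  simpa [hinj.list_map.eq_iff] using hl

theorem replicate_pad_append_inj {r r' : List Γ} {j j' : ℕ}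
    (h : List.replicate j (pad : RewriteSymbol Γ Q) ++ r.map letter =
      List.replicate j' pad ++ r'.map letter) : j = j' ∧ r = r' := by
  induction j generalizing j' with
  | zero =>
    cases j' with
    | zero =>
      have hinj : Function.Injective (letter : Γ → RewriteSymbol Γ Q) := fun _ _ => letter.inj
      exact ⟨rfl, hinj.list_map h⟩
    | succ j' => cases r <;> simp [List.replicate_succ] at h
  | succ j ih =>
    cases j' with
    | zero => cases r' <;> simp [List.replicate_succ] at h
    | succ j' =>
      obtain ⟨rfl, rfl⟩ := ih (List.cons.inj h).2
      exact ⟨rfl, rfl⟩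

/-- The symbol just before the active symbol of `word l s m`. -/
def before : List Γ → RewriteSymbol Γ Q
  | [] => edge
  | a :: _ => letter a

/-- What precedes the symbol `before l` in `word l s m`. -/
def beforeInit : List Γ → List (RewriteSymbol Γ Q)
  | [] => []
  | _ :: l => edge :: l.reverse.map letter

theorem word_eq (l : List Γ) (s : RewriteSymbol Γ Q) (m : List (RewriteSymbol Γ Q)) :
    word l s m = beforeInit l ++ before l :: s :: m := by
  cases l <;> simp [word, beforeInit, before]

end RewriteSymbol

open RewriteSymbol

variable {Γ Q : Type} [Inhabited Γ] [Inhabited Q] (N : Machine Γ Q)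

/-- The effect of a machine step on the symbols `[x, state q, letter a]`, where halted machines
are restarted. -/
def rewriteStep (x : RewriteSymbol Γ Q) (q : Q) (a : Γ) : List (RewriteSymbol Γ Q) :=
  match N q a, x with
  | none, x => [x, state default, letter a]
  | some (q', .write b), x => [x, state q', letter b]
  | some (q', .move .right), x => [x, letter a, state q']
  | some (q', .move .left), edge => [edge, state q', letter default, letter a]
  | some (q', .move .left), x => [state q', x, letter a]

open Classical in
/-- The right hand sides of the rules with left hand side `[x, s, y]`: a machine is simulated, may
be frozen at the moment at which it halts, and thereafter the string just grows. -/
noncomputable def rewriteRhs :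
    RewriteSymbol Γ Q → RewriteSymbol Γ Q → RewriteSymbol Γ Q → List (List (RewriteSymbol Γ Q))
  | x, state q, letter a =>
    rewriteStep N x q a :: if N q a = none then [[x, frozen q, letter a]] else []
  | x, state q, edge =>
    (rewriteStep N x q default ++ [edge]) ::
      if N q default = none then [[x, frozen q, edge]] else []
  | x, frozen q, y => [[x, frozen q, pad, y]]
  | _, _, _ => []

theorem isActive_of_mem_rewriteRhs {x s y : RewriteSymbol Γ Q} {t : List (RewriteSymbol Γ Q)}
    (h : t ∈ rewriteRhs N x s y) : s.IsActive := by
  cases s <;> trivial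

variable {N} in
theorem ofRhs_step_word_iff [Finite Γ] [Finite Q] {code : RewriteSymbol Γ Q → ℕ}
    (hcode : Function.Injective code) {init m : List (RewriteSymbol Γ Q)} {l : List Γ}
    {s y : RewriteSymbol Γ Q} {z : List ℕ} (hy : ¬y.IsActive)
    (hm : ∀ a ∈ m, ¬a.IsActive) :
    (Multiway.ofRhs code (rewriteRhs N) init).Step ((word l s (y :: m)).map code) z ↔
      ∃ t ∈ rewriteRhs N (before l) s y, z = (beforeInit l ++ t ++ m).map code := by
  rw [Multiway.ofRhs_step_iff hcode]
  constructor
  · rintro ⟨u, x, s', y', v, t, ht, hw, rfl⟩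
    have hw' : (beforeInit l ++ [before l]) ++ s :: y :: m = (u ++ [x]) ++ s' :: y' :: v := by
      simpa [word_eq] using hw
    have hp : ∀ a ∈ beforeInit l ++ [before l], ¬(a : RewriteSymbol Γ Q).IsActive := by
      cases l <;> simp [before, beforeInit, IsActive, or_imp, forall_and]
    obtain ⟨hu, rfl, hv⟩ := eq_of_append_isActive_cons_eq hp (by simpa [hy] using hm)
      (isActive_of_mem_rewriteRhs N ht) hw'
    obtain ⟨rfl, hx⟩ := List.append_inj' hu rfl
    obtain ⟨rfl, rfl⟩ := List.cons.inj hv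
    obtain rfl := List.singleton_inj.1 hx
    exact ⟨t, ht, rfl⟩
  · rintro ⟨t, ht, rfl⟩
    exact ⟨_, _, _, _, _, t, ht, word_eq _ _ _, rfl⟩

/-- A configuration of a Turing machine, with explicit representatives of the two tape halves. -/
structure ListCfg (Γ Q : Type) where
  /-- The tape on the left of the head, read from the head. -/
  left : List Γ
  /-- The machine state. -/
  q : Q
  /-- The tape from the head on. -/
  right : List Γ

namespace ListCfg

/-- The string representing a running machine. -/
def runWord (c : ListCfg Γ Q) : List (RewriteSymbol Γ Q) :=
  word c.left (state c.q) (c.right.map letter ++ [edge])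

/-- The string representing a machine that has been frozen for `j` steps. -/
def frozenWord (c : ListCfg Γ Q) (j : ℕ) : List (RewriteSymbol Γ Q) :=
  word c.left (frozen c.q) (List.replicate j pad ++ (c.right.map letter ++ [edge]))

omit [Inhabited Γ] [Inhabited Q] in
theorem runWord_injective : Function.Injective (runWord : ListCfg Γ Q → _) := by
  rintro ⟨l, q, r⟩ ⟨l', q', r'⟩ h
  have hinj : Function.Injective (letter : Γ → RewriteSymbol Γ Q) := fun _ _ => letter.inj
  obtain ⟨hl, hq, hr⟩ := word_inj (by simp [IsActive, or_imp, forall_and]) (by trivial) h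
  obtain rfl := hinj.list_map (List.append_cancel_right hr)
  simp_all

omit [Inhabited Γ] [Inhabited Q] in
theorem frozenWord_inj {c c' : ListCfg Γ Q} {j j' : ℕ} (h : c.frozenWord j = c'.frozenWord j') :
    c = c' ∧ j = j' := by
  obtain ⟨l, q, r⟩ := c
  obtain ⟨l', q', r'⟩ := c'
  obtain ⟨hl, hq, hr⟩ := word_inj (by simp [IsActive, or_imp, forall_and]) (by trivial) h
  rw [← List.append_assoc, ← List.append_assoc] at hr
  obtain ⟨rfl, rfl⟩ := replicate_pad_append_inj (List.append_cancel_right hr)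
  simp_all

omit [Inhabited Γ] [Inhabited Q] in
theorem runWord_ne_frozenWord (c c' : ListCfg Γ Q) (j : ℕ) : c.runWord ≠ c'.frozenWord j := by
  intro h
  obtain ⟨-, h, -⟩ := word_inj (by simp [IsActive, or_imp, forall_and]) (by trivial) h
  cases h

/-- The machine halts in the next step. -/
def Halted (c : ListCfg Γ Q) : Prop :=
  N c.q c.right.headI = none

/-- The next configuration, where halted machines are restarted. -/
def next (c : ListCfg Γ Q) : ListCfg Γ Q :=
  match N c.q c.right.headI with
  | none => ⟨c.left, default, c.right.headI :: c.right.tail⟩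
  | some (q', .write b) => ⟨c.left, q', b :: c.right.tail⟩
  | some (q', .move .right) => ⟨c.right.headI :: c.left, q', c.right.tail⟩
  | some (q', .move .left) => ⟨c.left.tail, q', c.left.headI :: c.right.headI :: c.right.tail⟩

theorem runWord_next (c : ListCfg Γ Q) :
    (c.next N).runWord = beforeInit c.left ++ rewriteStep N (before c.left) c.q c.right.headI ++
      (c.right.tail.map letter ++ [edge]) := by
  obtain ⟨l, q, r⟩ := c
  rcases h : N q r.headI with _ | ⟨q', (_ | _) | b⟩ <;> cases l <;>
    simp [next, rewriteStep, h, runWord, word, before, beforeInit]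

/-- The multiway system simulating a machine that starts in the configuration `c`. -/
noncomputable def toMultiway [Finite Γ] [Finite Q] (code : RewriteSymbol Γ Q → ℕ)
    (c : ListCfg Γ Q) : Multiway :=
  Multiway.ofRhs code (rewriteRhs N) c.runWord

variable [Finite Γ] [Finite Q] {code : RewriteSymbol Γ Q → ℕ} (hcode : Function.Injective code)
  (c₀ c : ListCfg Γ Q)

include hcode in
theorem step_runWord_iff (z : List ℕ) :
    (c₀.toMultiway N code).Step (c.runWord.map code) z ↔
      z = (c.next N).runWord.map code ∨ c.Halted N ∧ z = (c.frozenWord 0).map code := by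
  rw [runWord_next, toMultiway]
  obtain ⟨l, q, _ | ⟨a, r⟩⟩ := c
  · refine (ofRhs_step_word_iff hcode (y := edge) (m := []) (by simp [IsActive]) (by simp)).trans ?_
    by_cases h : N q default = none <;> simp [rewriteRhs, Halted, frozenWord, word_eq, h]
  · refine (ofRhs_step_word_iff hcode (y := letter a) (m := r.map letter ++ [edge])
      (by simp [IsActive]) (by simp [IsActive, or_imp, forall_and])).trans ?_
    by_cases h : N q a = none <;> simp [rewriteRhs, Halted, frozenWord, word_eq, h]

include hcode in
theorem step_frozenWord_iff (j : ℕ) (z : List ℕ) :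
    (c₀.toMultiway N code).Step ((c.frozenWord j).map code) z ↔
      z = (c.frozenWord (j + 1)).map code := by
  obtain ⟨y, m, hm⟩ : ∃ y m, List.replicate j pad ++ (c.right.map letter ++ [edge]) =
      (y :: m : List (RewriteSymbol Γ Q)) := List.exists_cons_of_ne_nil (by simp)
  have hact : ∀ a ∈ y :: m, ¬(a : RewriteSymbol Γ Q).IsActive := by
    rw [← hm]
    simp [IsActive, or_imp, forall_and]
  rw [toMultiway, frozenWord, hm, ofRhs_step_word_iff hcode (hact _ (by simp))
    fun a ha => hact a (by simp [ha]), frozenWord, List.replicate_succ, List.cons_append, hm, word_eq]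
  simp [rewriteRhs]

omit [Finite Γ] [Finite Q]

/-- The configuration of the Turing machine represented by `c`. -/
def toCfg : Cfg Γ Q :=
  ⟨c.q, Tape.mk' (ListBlank.mk c.left) (ListBlank.mk c.right)⟩

theorem cons_headI_mk_tail (l : List Γ) :
    ListBlank.cons l.headI (ListBlank.mk l.tail) = ListBlank.mk l := by
  simpa using ListBlank.cons_head_tail (ListBlank.mk l)

variable {N c}

theorem Halted.step_toCfg (h : c.Halted N) : step N c.toCfg = none := by
  simpa [step, toCfg, Halted] using h

theorem step_toCfg_of_not_halted (h : ¬c.Halted N) : step N c.toCfg = some (c.next N).toCfg := by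
  obtain ⟨l, q, r⟩ := c
  simp only [Halted] at h
  rcases hN : N q r.headI with _ | ⟨q', (_ | _) | b⟩
  · exact absurd hN h
  all_goals simp [step, toCfg, next, hN, ← ListBlank.cons_mk, cons_headI_mk_tail]

theorem exists_halted_iterate_of_reaches {d : Cfg Γ Q}
    (hcd : StateTransition.Reaches (step N) c.toCfg d) (hd : step N d = none) :
    ∃ n, (∀ i < n, ¬((next N)^[i] c).Halted N) ∧ ((next N)^[n] c).Halted N ∧
      ((next N)^[n] c).toCfg = d := by
  generalize hc : c.toCfg = e at hcd
  induction hcd using Relation.ReflTransGen.head_induction_on generalizing c with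
  | refl =>
    refine ⟨0, by simp, ?_, hc⟩
    by_contra h
    simp [← hc, step_toCfg_of_not_halted (c := c) h] at hd
  | head hstep _ ih =>
    have h : ¬c.Halted N := fun h => by simp [← hc, h.step_toCfg] at hstep
    rw [← hc, step_toCfg_of_not_halted h] at hstep
    obtain ⟨n, hlt, hn⟩ := ih (Option.some.inj hstep)
    refine ⟨n + 1, ?_, hn⟩
    rintro (_ | i) hi
    · exact h
    · exact hlt i (by omega)

variable (N c) in
/-- The number of explicitly represented tape cells. -/
def size : ℕ :=
  c.left.length + c.right.length

theorem size_iterate_next_le (t : ℕ) : ((next N)^[t] c).size ≤ c.size + 2 * t := by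
  induction t with
  | zero => simp
  | succ t ih =>
    rw [Function.iterate_succ_apply']
    generalize (next N)^[t] c = c' at ih ⊢
    suffices (c'.next N).size ≤ c'.size + 2 by omega
    obtain ⟨l, q, r⟩ := c'
    rcases hN : N q r.headI with _ | ⟨q', (_ | _) | b⟩ <;> simp [next, size, hN] <;> omega

omit [Inhabited Q] in
theorem le_size {k : ℕ} (h : ∀ i < k, (ListBlank.mk c.right).nth i ≠ default) : k ≤ c.size := by
  refine le_trans ?_ (Nat.le_add_left _ _)
  by_contra! hlt
  exact h _ hlt (by simp [ListBlank.nth_mk, List.getI_eq_default])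

theorem injective_iterate_next (h : ∀ k, ∃ t, k ≤ ((next N)^[t] c).size) :
    Function.Injective fun t => (next N)^[t] c := by
  intro i j heq
  wlog hij : i < j generalizing i j
  · by_contra hne
    exact hne (this heq.symm (by omega)).symm
  simp only at heq
  have hle (t : ℕ) : ((next N)^[t] c).size ≤ c.size + 2 * j := by
    induction t using Nat.strong_induction_on with
    | _ t ih =>
      rcases lt_or_ge t j with htj | hjt
      · exact size_iterate_next_le t |>.trans (by omega)
      · obtain ⟨m, rfl⟩ := Nat.exists_eq_add_of_le hjt
        rw [Nat.add_comm, Function.iterate_add_apply, ← heq, ← Function.iterate_add_apply]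
        exact ih _ (by omega)
  exfalso
  obtain ⟨t, ht⟩ := h (c.size + 2 * j + 1)
  exact absurd (ht.trans (hle t)) (by omega)

/-- The configuration `c` is about to be run on the tape content `R`. -/
structure IsInit (c : ListCfg Γ Q) (R : ListBlank Γ) : Prop where
  q_eq : c.q = default
  mk_left : ListBlank.mk c.left = ∅
  mk_right : ListBlank.mk c.right = R

theorem IsInit.exists_halted {R R' : ListBlank Γ} {q' : Q} (hc : c.IsInit R)
    (hreach : StateTransition.Reaches (step N) ⟨default, Tape.mk' ∅ R⟩ ⟨q', Tape.mk' ∅ R'⟩)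
    (hhalt : step N ⟨q', Tape.mk' ∅ R'⟩ = none) :
    ∃ t, (∀ i < t, ¬((next N)^[i] c).Halted N) ∧ ((next N)^[t] c).Halted N ∧
      ListBlank.mk ((next N)^[t] c).right = R' ∧ ((next N)^[t + 1] c).IsInit R' := by
  have hcfg : c.toCfg = ⟨default, Tape.mk' ∅ R⟩ := by
    rw [toCfg, hc.q_eq, hc.mk_left, hc.mk_right]
  obtain ⟨t, hlt, ht, heq⟩ := exists_halted_iterate_of_reaches (hcfg ▸ hreach) hhalt
  have hl : ListBlank.mk ((next N)^[t] c).left = ∅ := by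
    simpa [toCfg] using congrArg (fun d => d.Tape.left) heq
  have hr : ListBlank.mk ((next N)^[t] c).right = R' := by
    simpa [toCfg] using congrArg (fun d => d.Tape.right₀) heq
  refine ⟨t, hlt, ht, hr, ?_⟩
  rw [Function.iterate_succ_apply', next, ht]
  exact ⟨rfl, hl, by rw [← hr, ← ListBlank.cons_mk, cons_headI_mk_tail]⟩

open Classical in
/-- A machine that repeatedly replaces the tape content encoding `n` by the tape content encoding
`F n` halts infinitely often. -/
theorem IsInit.exists_halted_count_eq {F : ℕ → ℕ} {T : ℕ → ListBlank Γ → Prop}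
    (hT : ∀ n R, T n R → ∃ q' R', StateTransition.Reaches (step N) ⟨default, Tape.mk' ∅ R⟩
      ⟨q', Tape.mk' ∅ R'⟩ ∧ step N ⟨q', Tape.mk' ∅ R'⟩ = none ∧ T (F n) R')
    {n : ℕ} {R : ListBlank Γ} (hR : T n R) (hc : c.IsInit R) (k : ℕ) :
    ∃ t, Nat.count (fun t => ((next N)^[t] c).Halted N) t = k ∧ ((next N)^[t] c).Halted N ∧
      T (F^[k + 1] n) (ListBlank.mk ((next N)^[t] c).right) := by
  induction k generalizing c n R with
  | zero =>
    obtain ⟨q', R', hreach, hhalt, hR'⟩ := hT n R hR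
    obtain ⟨t, hlt, ht, rfl, -⟩ := hc.exists_halted hreach hhalt
    exact ⟨t, Nat.count_of_forall_not hlt, ht, hR'⟩
  | succ k ih =>
    obtain ⟨q', R', hreach, hhalt, hR'⟩ := hT n R hR
    obtain ⟨t, hlt, ht, -, hc'⟩ := hc.exists_halted hreach hhalt
    obtain ⟨t', hcount, ht', hT'⟩ := ih hR' hc'
    simp only [← Function.iterate_add_apply, Nat.add_comm _ (t + 1)] at hcount ht' hT'
    refine ⟨t + 1 + t', ?_, ht', hT'⟩
    rw [Nat.count_add, Nat.count_succ, hcount, if_pos ht, Nat.count_of_forall_not hlt]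
    omega

end ListCfg

end Turing.TM0

open Turing.TM0.ListCfg Classical in
/-- A machine whose tape contents at the halting times outgrow `f`. -/
theorem Computable.exists_listCfg {f : ℕ → ℕ} (hf : Computable f) (hmono : Monotone f) :
    ∃ (Q Γ : Type) (_ : Finite Q) (_ : Finite Γ) (_ : Inhabited Q) (_ : Inhabited Γ)
      (N : Turing.TM0.Machine Γ Q) (c : Turing.TM0.ListCfg Γ Q), ∀ k, ∃ t,
      Nat.count (fun t => ((next N)^[t] c).Halted N) t = k ∧ ((next N)^[t] c).Halted N ∧
      f (k + 2) + k ≤ ((next N)^[t] c).size := by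
  let F (n : ℕ) : ℕ := 2 ^ (f (n + 2) + n)
  have hF : Computable F := (Primrec₂.unpaired'.1 Nat.Primrec.pow).to_comp.comp (.const 2) <|
    Primrec.nat_add.to_comp.comp
      (hf.comp (Primrec.nat_add.comp Primrec.id (Primrec.const 2)).to_comp) Computable.id
  obtain ⟨Q, Γ, _, _, _, _, N, T, hex, hT, hlen⟩ := hF.exists_turingMachine
  obtain ⟨R, hR⟩ := hex 0
  obtain ⟨r, rfl⟩ := Quotient.exists_rep R
  have hc : IsInit (⟨[], default, r⟩ : Turing.TM0.ListCfg Γ Q) (Turing.ListBlank.mk r) :=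
    ⟨rfl, rfl, rfl⟩
  have hle (k : ℕ) : k ≤ F^[k] 0 := by
    induction k with
    | zero => simp
    | succ k ih =>
      rw [Function.iterate_succ_apply']
      exact (ih.trans (Nat.le_add_left _ _)).trans_lt Nat.lt_two_pow_self
  refine ⟨Q, Γ, ‹_›, ‹_›, ‹_›, ‹_›, N, ⟨[], default, r⟩, fun k => ?_⟩
  obtain ⟨t, hcount, ht, hTt⟩ := hc.exists_halted_count_eq hT hR k
  refine ⟨t, hcount, ht, ?_⟩
  obtain ⟨m, hm, hne⟩ := hlen _ _ hTt
  rw [Function.iterate_succ_apply'] at hm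
  have hlt := (Nat.pow_lt_pow_iff_right (by norm_num)).1 hm
  have := hmono (Nat.add_le_add_right (hle k) 2)
  have := le_size hne
  have := hle k
  omega

/-- for every computable strictly increasing `f` there is a multiway system
whose (nondecreasing, unbounded) growth function `g` satisfies `f ∘ g = O(n)`. -/
theorem multiway_growth_inverse_of_computable (f : ℕ → ℕ) (hf : Computable f)
    (hmono : StrictMono f) :
    ∃ M : Multiway, Monotone M.growth ∧ (∀ B : ℕ, ∃ n : ℕ, B < M.growth n) ∧
      ∃ C : ℕ, 0 < C ∧ ∃ N : ℕ, ∀ n : ℕ, N ≤ n → f (M.growth n) ≤ C * n := by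
  classical
  obtain ⟨Q, Γ, _, _, _, _, N, c, h⟩ := hf.exists_listCfg hmono.monotone
  obtain ⟨code, hcode⟩ := Countable.exists_injective_nat (Turing.TM0.RewriteSymbol Γ Q)
  set H : ℕ → Prop := fun t => ((Turing.TM0.ListCfg.next N)^[t] c).Halted N
  have hinj := Turing.TM0.ListCfg.injective_iterate_next fun k =>
    (h k).imp fun t ht => (Nat.le_add_left _ _).trans ht.2.2
  have hgrowth (n : ℕ) : (c.toMultiway N code).growth n = Nat.count H n + 1 := by
    refine Multiway.growth_eq_count_add_one
      (x := fun t => ((Turing.TM0.ListCfg.next N)^[t] c).runWord.map code)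
      (y := fun t j => (((Turing.TM0.ListCfg.next N)^[t] c).frozenWord j).map code)
      rfl (fun t z => ?_) (fun t j z => Turing.TM0.ListCfg.step_frozenWord_iff N hcode _ _ _ _)
      ?_ ?_ ?_ n
    · rw [Turing.TM0.ListCfg.step_runWord_iff N hcode, Function.iterate_succ_apply']
    · exact hcode.list_map.comp (Turing.TM0.ListCfg.runWord_injective.comp hinj)
    · intro t j t' j' heq
      obtain ⟨ht, hj⟩ := Turing.TM0.ListCfg.frozenWord_inj (hcode.list_map heq)
      exact ⟨hinj ht, hj⟩
    · exact fun t t' j heq => Turing.TM0.ListCfg.runWord_ne_frozenWord _ _ _ (hcode.list_map heq)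
  have hbound (n : ℕ) : f (Nat.count H n + 1) ≤ 2 * n + (f 1 + c.size) := by
    induction n with
    | zero => simp
    | succ n ih =>
      rw [Nat.count_succ]
      split_ifs with hn
      · obtain ⟨t, hcount, ht, hle⟩ := h (Nat.count H n)
        obtain rfl := Nat.count_injective ht hn hcount
        have := Turing.TM0.ListCfg.size_iterate_next_le (N := N) (c := c) t
        change f (Nat.count H t + 2) ≤ _
        omega
      · exact ih.trans (by omega)
  refine ⟨c.toMultiway N code, ?_, fun B => ?_, 2 + (f 1 + c.size), by omega, 1, fun n hn => ?_⟩
  · intro m n hmn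
    simpa [hgrowth] using Nat.count_monotone H hmn
  · obtain ⟨t, hcount, -⟩ := h B
    exact ⟨t, by simpa [hgrowth] using hcount.ge⟩
  · rw [hgrowth]
    exact (hbound n).trans (by nlinarith)
end

section
/- For every multiway system M = (R, s, Σ) there is a multiway system M' = (R', s', {a, b}) over a two-element alphabet together with a bijection φ from the reachable states of M onto the reachable states of M' such that for all reachable states x, y of M, x rewrites to y in one step of M if and only if φ(x) rewrites to φ(y) in one step of M'. In particular the states graphs of M and M' are isomorphic and g_M = g_{M'}. -/
namespace Multiway

/-- The concatenation of the blocks `1 0ᵏ` over the symbols `k` of a string. -/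
def blocks (x : List ℕ) : List ℕ :=
  x.flatMap fun k => 1 :: List.replicate k 0

/-- The binary encoding of a string: its blocks, closed by a final delimiter `1`. -/
def encode (x : List ℕ) : List ℕ :=
  blocks x ++ [1]

@[simp]
theorem blocks_nil : blocks [] = [] := rfl

@[simp]
theorem blocks_cons (k : ℕ) (x : List ℕ) :
    blocks (k :: x) = 1 :: (List.replicate k 0 ++ blocks x) := by
  simp [blocks]

@[simp]
theorem blocks_append (x y : List ℕ) : blocks (x ++ y) = blocks x ++ blocks y := by
  simp [blocks]

@[simp]
theorem encode_nil : encode [] = [1] := rfl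

@[simp]
theorem encode_cons (k : ℕ) (x : List ℕ) :
    encode (k :: x) = 1 :: (List.replicate k 0 ++ encode x) := by
  simp [encode]

theorem encode_append (x y : List ℕ) : encode (x ++ y) = blocks x ++ encode y := by
  simp [encode]

theorem exists_encode_eq_cons (x : List ℕ) : ∃ w, encode x = 1 :: w := by
  cases x <;> simp

theorem exists_blocks_append_eq_cons (x w : List ℕ) : ∃ w', blocks x ++ 1 :: w = 1 :: w' := by
  cases x <;> simp

theorem mem_encode {x : List ℕ} {k : ℕ} (h : k ∈ encode x) : k = 0 ∨ k = 1 := by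
  induction x with
  | nil => simp_all
  | cons j x ih =>
    simp only [encode_cons, List.mem_cons, List.mem_append, List.mem_replicate] at h
    tauto

theorem replicate_zero_append_inj {j k : ℕ} {p q : List ℕ}
    (h : List.replicate j 0 ++ 1 :: p = List.replicate k 0 ++ 1 :: q) : j = k ∧ p = q := by
  induction j generalizing k with
  | zero => cases k <;> simp_all [List.replicate_succ]
  | succ j ih =>
    cases k with
    | zero => simp [List.replicate_succ] at h
    | succ k =>
      simp only [List.replicate_succ, List.cons_append, List.cons.injEq, true_and] at h
      simpa using ih h

theorem exists_of_replicate_zero_append_eq {j : ℕ} {p u w : List ℕ}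
    (h : List.replicate j 0 ++ p = u ++ 1 :: w) :
    ∃ u', u = List.replicate j 0 ++ u' ∧ p = u' ++ 1 :: w := by
  induction j generalizing u with
  | zero => exact ⟨u, by simp, by simpa using h⟩
  | succ j ih =>
    cases u with
    | nil => simp [List.replicate_succ] at h
    | cons a u =>
      simp only [List.replicate_succ, List.cons_append, List.cons.injEq] at h
      obtain ⟨rfl, h⟩ := h
      obtain ⟨u', rfl, hp⟩ := ih h
      exact ⟨u', by simp [List.replicate_succ], hp⟩

theorem exists_of_encode_eq_blocks_append {x r w : List ℕ} (h : encode x = blocks r ++ 1 :: w) :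
    ∃ v, x = r ++ v ∧ encode v = 1 :: w := by
  induction r generalizing x with
  | nil => exact ⟨x, rfl, h⟩
  | cons k r ih =>
    obtain ⟨w', hw'⟩ := exists_blocks_append_eq_cons r w
    cases x with
    | nil => simp [hw'] at h
    | cons j x =>
      obtain ⟨z, hz⟩ := exists_encode_eq_cons x
      simp only [encode_cons, blocks_cons, List.cons_append, List.append_assoc, List.cons.injEq,
        true_and, hz, hw'] at h
      obtain ⟨rfl, rfl⟩ := replicate_zero_append_inj h
      obtain ⟨v, rfl, hv⟩ := ih (hz.trans hw'.symm)
      exact ⟨v, rfl, hv⟩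

theorem exists_of_encode_eq_append {x u w : List ℕ} (h : encode x = u ++ 1 :: w) :
    ∃ u' v, x = u' ++ v ∧ u = blocks u' ∧ encode v = 1 :: w := by
  induction x generalizing u with
  | nil =>
    cases u with
    | nil => exact ⟨[], [], rfl, rfl, h⟩
    | cons a u => simp at h
  | cons j x ih =>
    cases u with
    | nil => exact ⟨[], j :: x, rfl, rfl, h⟩
    | cons a u =>
      simp only [encode_cons, List.cons_append, List.cons.injEq] at h
      obtain ⟨rfl, h⟩ := h
      obtain ⟨u₁, rfl, h₁⟩ := exists_of_replicate_zero_append_eq h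
      obtain ⟨u', v, rfl, rfl, hv⟩ := ih h₁
      exact ⟨j :: u', v, rfl, by simp, hv⟩

theorem encode_injective : Function.Injective encode := by
  intro x y h
  obtain ⟨v, rfl, hv⟩ := exists_of_encode_eq_blocks_append (w := []) h
  cases v with
  | nil => simp
  | cons k v =>
    obtain ⟨z, hz⟩ := exists_encode_eq_cons v
    simp [hz] at hv

/-- The two-symbol system obtained by encoding the initial string and both sides of all rules. -/
def binary (M : Multiway) : Multiway where
  rules := M.rules.image fun p => (encode p.1, encode p.2)
  init := encode M.init

theorem symbols_binary_subset (M : Multiway) : M.binary.symbols ⊆ {0, 1} := by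
  intro k hk
  simp only [symbols, binary, Finset.mem_union, Finset.mem_biUnion, Finset.mem_image,
    List.mem_toFinset] at hk
  rw [Finset.mem_insert, Finset.mem_singleton]
  rcases hk with hk | ⟨_, ⟨p, -, rfl⟩, hk | hk⟩ <;> exact mem_encode hk

theorem step_binary_iff (M : Multiway) (x z : List ℕ) :
    M.binary.Step (encode x) z ↔ ∃ y, z = encode y ∧ M.Step x y := by
  constructor
  · rintro ⟨_, hp, u, v, hx, rfl⟩
    obtain ⟨⟨r, t⟩, hrt, rfl⟩ := Finset.mem_image.1 hp
    obtain ⟨w, hw⟩ := exists_encode_eq_cons r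
    obtain ⟨u, x, rfl, rfl, h⟩ :
        ∃ u' x', x = u' ++ x' ∧ u = blocks u' ∧ encode x' = 1 :: (w ++ v) :=
      exists_of_encode_eq_append (by simpa [hw] using hx)
    obtain ⟨v', rfl, hv⟩ : ∃ v', x = r ++ v' ∧ encode v' = 1 :: v := by
      apply exists_of_encode_eq_blocks_append
      rw [h, ← List.cons_append, ← hw]
      simp [encode]
    refine ⟨u ++ t ++ v', ?_, (r, t), hrt, u, v', by simp, rfl⟩
    simpa [encode] using hv.symm
  · rintro ⟨_, rfl, ⟨r, t⟩, hrt, u, v, rfl, rfl⟩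
    obtain ⟨w, hw⟩ := exists_encode_eq_cons v
    refine ⟨_, Finset.mem_image_of_mem _ hrt, blocks u, w, ?_, ?_⟩ <;>
      simp [encode_append, hw] <;> simp [encode]

theorem step_encode_iff (M : Multiway) (x y : List ℕ) :
    M.Step x y ↔ M.binary.Step (encode x) (encode y) := by
  simp [step_binary_iff, encode_injective.eq_iff]

theorem reachable_binary_iff (M : Multiway) (z : List ℕ) :
    M.binary.Reachable z ↔ ∃ x, z = encode x ∧ M.Reachable x := by
  constructor
  · intro h
    induction h with
    | refl => exact ⟨_, rfl, .refl⟩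
    | tail _ hs ih =>
      obtain ⟨x, rfl, hx⟩ := ih
      obtain ⟨y, rfl, hy⟩ := (step_binary_iff M x _).1 hs
      exact ⟨y, rfl, hx.tail hy⟩
  · rintro ⟨x, rfl, hx⟩
    exact Relation.ReflTransGen.lift encode (fun a b => (step_encode_iff M a b).1) _ _ hx

theorem stepN_binary_iff (M : Multiway) (n : ℕ) (z : List ℕ) :
    M.binary.StepN n z ↔ ∃ x, z = encode x ∧ M.StepN n x := by
  induction n generalizing z with
  | zero => simp [StepN, binary]
  | succ n ih =>
    constructor
    · rintro ⟨w, hw, hs⟩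
      obtain ⟨x, rfl, hx⟩ := (ih w).1 hw
      obtain ⟨y, rfl, hy⟩ := (step_binary_iff M x z).1 hs
      exact ⟨y, rfl, x, hx, hy⟩
    · rintro ⟨y, rfl, x, hx, hy⟩
      exact ⟨encode x, (ih _).2 ⟨x, rfl, hx⟩, (step_encode_iff M x y).1 hy⟩

theorem stepN_encode_iff (M : Multiway) (n : ℕ) (x : List ℕ) :
    M.binary.StepN n (encode x) ↔ M.StepN n x := by
  simp [stepN_binary_iff, encode_injective.eq_iff]

theorem sphere_binary (M : Multiway) (n : ℕ) : M.binary.sphere n = encode '' M.sphere n := by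
  ext z
  constructor
  · rintro ⟨hz, hlt⟩
    obtain ⟨x, rfl, hx⟩ := (stepN_binary_iff M n z).1 hz
    exact ⟨x, ⟨hx, fun k hk h => hlt k hk ((stepN_encode_iff M k x).2 h)⟩, rfl⟩
  · rintro ⟨x, ⟨hx, hlt⟩, rfl⟩
    exact ⟨(stepN_encode_iff M n x).2 hx, fun k hk h => hlt k hk ((stepN_encode_iff M k x).1 h)⟩

theorem growth_binary (M : Multiway) (n : ℕ) : M.binary.growth n = M.growth n := by
  rw [growth, growth, sphere_binary, Set.ncard_image_of_injective _ encode_injective]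

end Multiway

/-- every multiway system can be emulated by one over a two-element alphabet:
there is a bijection between the reachable states preserving one-step rewrites; in
particular the states graphs are isomorphic and the growth functions coincide. -/
theorem multiway_two_symbol_emulation (M : Multiway) :
    ∃ M' : Multiway, ∃ a b : ℕ, a ≠ b ∧ M'.symbols ⊆ {a, b} ∧
      ∃ φ : List ℕ → List ℕ,
        Set.BijOn φ {x : List ℕ | M.Reachable x} {y : List ℕ | M'.Reachable y} ∧
        (∀ x y : List ℕ, M.Reachable x → M.Reachable y →
          (M.Step x y ↔ M'.Step (φ x) (φ y))) ∧
        ∀ n : ℕ, M.growth n = M'.growth n := by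
  refine ⟨M.binary, 0, 1, zero_ne_one, M.symbols_binary_subset, Multiway.encode,
    ⟨fun x hx => (M.reachable_binary_iff _).2 ⟨x, rfl, hx⟩, Multiway.encode_injective.injOn, ?_⟩,
    fun x y _ _ => M.step_encode_iff x y, fun n => (M.growth_binary n).symm⟩
  intro z hz
  obtain ⟨x, rfl, hx⟩ := (M.reachable_binary_iff z).1 hz
  exact ⟨x, hx, rfl⟩
end

section
/- If f₁, f₂ : ℕ → ℕ are the growth functions of two multiway systems, then there exists a multiway system whose growth function h satisfies h(0) = 1 and h(n) = f₁(n) + f₂(n) for all n ≥ 1, and there exists a multiway system whose growth function equals the discrete convolution n ↦ ∑_{k=0}^n f₁(k)·f₂(n−k). Hence the set of multiway growth functions is closed under pointwise addition (away from the origin) and under discrete convolution. -/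
namespace Multiway

/-- `WalkN R a n x`: there is an `R`-walk with exactly `n` steps from `a` to `x`. -/
def WalkN {α : Type*} (R : α → α → Prop) (a : α) : ℕ → α → Prop
  | 0 => fun x => x = a
  | n + 1 => fun y => ∃ x, WalkN R a n x ∧ R x y

/-- The vertices at distance exactly `n` from `a`. -/
def walkSphere {α : Type*} (R : α → α → Prop) (a : α) (n : ℕ) : Set α :=
  {x | WalkN R a n x ∧ ∀ k < n, ¬ WalkN R a k x}

theorem stepN_eq_walkN (M : Multiway) : M.StepN = WalkN M.Step M.init := by
  funext n
  induction n with
  | zero => rfl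
  | succ n ih => funext y; simp only [StepN, WalkN, ih]

theorem sphere_eq_walkSphere (M : Multiway) (n : ℕ) :
    M.sphere n = walkSphere M.Step M.init n := by
  simp only [sphere, walkSphere, stepN_eq_walkN]

theorem WalkN.invariant {α : Type*} {R : α → α → Prop} {a : α} {p : α → Prop} (ha : p a)
    (hR : ∀ x y, p x → R x y → p y) {n : ℕ} {x : α} (h : WalkN R a n x) : p x := by
  induction n generalizing x with
  | zero => cases h; exact ha
  | succ n ih => obtain ⟨y, hy, hyx⟩ := h; exact hR y x (ih hy) hyx

theorem walkSphere_disjoint {α : Type*} {R : α → α → Prop} {a x : α} {m n : ℕ}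
    (hm : x ∈ walkSphere R a m) (hn : x ∈ walkSphere R a n) : m = n := by
  rcases lt_trichotomy m n with h | h | h
  · exact absurd hm.1 (hn.2 m h)
  · exact h
  · exact absurd hn.1 (hm.2 n h)

/-- Deleting all edges into the base point changes no distance. -/
theorem walkSphere_avoid {α : Type*} (R : α → α → Prop) (a : α) (n : ℕ) :
    walkSphere (fun x y => R x y ∧ y ≠ a) a n = walkSphere R a n := by
  have of_avoid : ∀ {n x}, WalkN (fun x y => R x y ∧ y ≠ a) a n x → WalkN R a n x := by
    intro n
    induction n with
    | zero => exact id
    | succ n ih => rintro x ⟨y, hy, hyx, -⟩; exact ⟨y, ih hy, hyx⟩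
  have avoid_of : ∀ {n x}, WalkN R a n x →
      ∃ k ≤ n, WalkN (fun x y => R x y ∧ y ≠ a) a k x := by
    intro n
    induction n with
    | zero => intro x h; exact ⟨0, le_rfl, h⟩
    | succ n ih =>
      rintro x ⟨y, hy, hyx⟩
      by_cases hx : x = a
      · exact ⟨0, by omega, hx⟩
      · obtain ⟨k, hk, hky⟩ := ih hy
        exact ⟨k + 1, by omega, y, hky, hyx, hx⟩
  ext x
  constructor
  · rintro ⟨h, hmin⟩
    refine ⟨of_avoid h, fun k hk hkx => ?_⟩
    obtain ⟨l, hl, hlx⟩ := avoid_of hkx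
    exact hmin l (by omega) hlx
  · rintro ⟨h, hmin⟩
    refine ⟨?_, fun k hk hkx => hmin k hk (of_avoid hkx)⟩
    obtain ⟨l, hl, hlx⟩ := avoid_of h
    rcases hl.eq_or_lt with rfl | hlt
    · exact hlx
    · exact absurd (of_avoid hlx) (hmin l hlt)

/-- One rewrite step by an arbitrary set of rules. -/
def StepBy (P : Set (List ℕ × List ℕ)) (x y : List ℕ) : Prop :=
  ∃ p ∈ P, ∃ u v : List ℕ, x = u ++ p.1 ++ v ∧ y = u ++ p.2 ++ v

theorem finite_step (M : Multiway) (x : List ℕ) : {y | M.Step x y}.Finite := by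
  have h : ((fun q : (List ℕ × List ℕ) × ℕ × ℕ =>
      x.take q.2.1 ++ q.1.2 ++ x.drop q.2.2) ''
      ((M.rules : Set (List ℕ × List ℕ)) ×ˢ
        (Set.Iic x.length ×ˢ Set.Iic x.length))).Finite :=
    ((M.rules.finite_toSet).prod ((Set.finite_Iic _).prod (Set.finite_Iic _))).image _
  refine h.subset ?_
  rintro y ⟨p, hp, u, v, rfl, rfl⟩
  refine ⟨(p, u.length, (u ++ p.1).length), ⟨hp, ?_, ?_⟩, ?_⟩
  · simp
  · simp
  · have h₁ : (u ++ p.1 ++ v).take u.length = u := by simp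
    have h₂ : (u ++ p.1 ++ v).drop (u ++ p.1).length = v := List.drop_left
    simp only [h₁, h₂]

theorem finite_walkN (M : Multiway) (n : ℕ) : {x | WalkN M.Step M.init n x}.Finite := by
  induction n with
  | zero => exact Set.finite_singleton M.init
  | succ n ih =>
    refine (ih.biUnion fun x _ => M.finite_step x).subset ?_
    rintro y ⟨x, hx, hxy⟩
    exact Set.mem_biUnion hx hxy

theorem finite_sphere (M : Multiway) (n : ℕ) : (M.sphere n).Finite := by
  rw [sphere_eq_walkSphere]
  exact (M.finite_walkN n).subset fun _ h => h.1

/-- Strings over the effective alphabet. -/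
def Over (M : Multiway) (x : List ℕ) : Prop := ∀ c ∈ x, c ∈ M.symbols

theorem over_init (M : Multiway) : M.Over M.init := by
  intro c hc
  simp [symbols, hc]

theorem Over.step {M : Multiway} {x y : List ℕ} (hx : M.Over x) (h : M.Step x y) :
    M.Over y := by
  obtain ⟨p, hp, u, v, rfl, rfl⟩ := h
  intro c hc
  simp only [List.mem_append] at hc
  rcases hc with (hc | hc) | hc
  · exact hx c (by simp [hc])
  · simp only [symbols, Finset.mem_union, Finset.mem_biUnion, List.mem_toFinset]
    exact Or.inr ⟨p, hp, Or.inr hc⟩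
  · exact hx c (by simp [hc])

theorem finite_over_length_le (M : Multiway) (K : ℕ) :
    {x | M.Over x ∧ x.length ≤ K}.Finite := by
  refine ((List.finite_length_le M.symbols K).image (List.map Subtype.val)).subset ?_
  rintro x ⟨hx, hK⟩
  exact ⟨x.attach.map fun c => ⟨c.1, hx c.1 c.2⟩, by simpa using hK, by simp⟩

/-- The edges of the multiway graph that do not return to the initial string. -/
def AvoidStep (M : Multiway) (x y : List ℕ) : Prop := M.Step x y ∧ y ≠ M.init

theorem sphere_eq_avoid (M : Multiway) (n : ℕ) :
    M.sphere n = walkSphere M.AvoidStep M.init n := by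
  rw [sphere_eq_walkSphere]
  exact (walkSphere_avoid M.Step M.init n).symm

theorem over_of_walkN {M : Multiway} {n : ℕ} {x : List ℕ}
    (h : WalkN M.AvoidStep M.init n x) : M.Over x :=
  h.invariant M.over_init fun _ _ hx hxy => hx.step hxy.1

/-- Encoding of a symbol; the residue modulo `3` records the system it belongs to. -/
def encSymbol (i c : ℕ) : ℕ := 3 * (c + 1) + i

/-- Encoding of a string, delimited on both sides by the marker `i`. -/
def enc (i : ℕ) (x : List ℕ) : List ℕ := i :: (x.map (encSymbol i) ++ [i])

theorem encSymbol_injective (i : ℕ) : Function.Injective (encSymbol i) := by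
  intro a b h
  simp only [encSymbol] at h
  omega

theorem enc_injective (i : ℕ) : Function.Injective (enc i) := by
  intro x y h
  simp only [enc, List.cons.injEq, true_and, List.append_cancel_right_eq] at h
  exact (encSymbol_injective i).list_map h

theorem mod_of_mem_enc {i : ℕ} (hi : i < 3) {x : List ℕ} : ∀ c ∈ enc i x, c % 3 = i := by
  intro c hc
  simp only [enc, encSymbol, List.mem_cons, List.mem_append, List.mem_map,
    List.not_mem_nil, or_false] at hc
  rcases hc with rfl | ⟨a, -, rfl⟩ | rfl <;> omega

theorem marker_notMem (i : ℕ) (x : List ℕ) : i ∉ x.map (encSymbol i) := by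
  simp only [List.mem_map, encSymbol, not_exists, not_and]
  intro a _
  omega

/-- A length beyond which no rule application can produce the initial string. -/
def bound (M : Multiway) : ℕ := M.init.length + ∑ p ∈ M.rules, p.1.length

theorem length_lhs_add_le_bound {M : Multiway} {p : List ℕ × List ℕ} (hp : p ∈ M.rules) :
    M.init.length + p.1.length ≤ M.bound := by
  have := Finset.single_le_sum (f := fun p : List ℕ × List ℕ => p.1.length)
    (fun _ _ => Nat.zero_le _) hp
  simp only [bound]
  omega

/-- Rules simulating `AvoidStep` on encoded strings: short strings are rewritten as a whole,
long strings inside a window of length `M.bound + 1`. -/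
def windowRules (M : Multiway) (i : ℕ) : Set (List ℕ × List ℕ) :=
  {p | ∃ x y, (M.Over x ∧ x.length ≤ M.bound) ∧ M.AvoidStep x y ∧ p = (enc i x, enc i y)} ∪
  {p | ∃ x y, (M.Over x ∧ x.length ≤ M.bound + 1) ∧ x.length = M.bound + 1 ∧ M.Step x y ∧
    p = (x.map (encSymbol i), y.map (encSymbol i))}

theorem finite_windowRules (M : Multiway) (i : ℕ) : (M.windowRules i).Finite := by
  refine Set.Finite.union ?_ ?_
  · refine ((M.finite_over_length_le M.bound).biUnion fun x _ =>
      (M.finite_step x).image fun y => (enc i x, enc i y)).subset ?_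
    rintro _ ⟨x, y, hx, hxy, rfl⟩
    exact Set.mem_biUnion hx ⟨y, hxy.1, rfl⟩
  · refine ((M.finite_over_length_le (M.bound + 1)).biUnion fun x _ =>
      (M.finite_step x).image fun y => (x.map (encSymbol i), y.map (encSymbol i))).subset ?_
    rintro _ ⟨x, y, hx, -, hxy, rfl⟩
    exact Set.mem_biUnion hx ⟨y, hxy, rfl⟩

/-- All left-hand sides are nonempty and consist of symbols in the residue class `i`. -/
def LhsIn (i : ℕ) (P : Set (List ℕ × List ℕ)) : Prop :=
  ∀ p ∈ P, p.1 ≠ [] ∧ ∀ c ∈ p.1, c % 3 = i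

theorem lhsIn_windowRules (M : Multiway) {i : ℕ} (hi : i < 3) :
    LhsIn i (M.windowRules i) := by
  rintro _ (⟨x, y, -, -, rfl⟩ | ⟨x, y, -, hx, -, rfl⟩)
  · exact ⟨by simp [enc], mod_of_mem_enc hi⟩
  · refine ⟨?_, fun c hc => mod_of_mem_enc hi (x := x) c (by simp only [enc]; simp_all)⟩
    rintro h
    simp only [List.map_eq_nil_iff] at h
    simp [h] at hx

theorem enc_eq_append_enc {i : ℕ} {x y u v : List ℕ} (h : enc i x = u ++ enc i y ++ v) :
    u = [] ∧ v = [] ∧ x = y := by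
  have hc := congrArg (List.count i) h
  have hx := List.count_eq_zero_of_not_mem (marker_notMem i x)
  have hy := List.count_eq_zero_of_not_mem (marker_notMem i y)
  have hu : u = [] := by
    rcases u with _ | ⟨a, u⟩
    · rfl
    · simp only [enc, List.cons_append, List.cons.injEq] at h
      obtain ⟨rfl, -⟩ := h
      simp [enc, hx, hy] at hc
      omega
  have hv : v = [] := by
    rcases List.eq_nil_or_concat v with rfl | ⟨v, b, rfl⟩
    · rfl
    · have hl := congrArg List.getLast? h
      simp only [enc, List.concat_eq_append, ← List.append_assoc, ← List.cons_append,
        List.getLast?_concat] at hl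
      cases hl
      simp [enc, hx, hy] at hc
      omega
  subst hu hv
  exact ⟨rfl, rfl, enc_injective i (by simpa using h)⟩

theorem enc_eq_append_map {i : ℕ} {x w u v : List ℕ} (hw : w ≠ [])
    (h : enc i x = u ++ w.map (encSymbol i) ++ v) :
    ∃ a b, x = a ++ w ++ b ∧ u = i :: a.map (encSymbol i) ∧
      v = b.map (encSymbol i) ++ [i] := by
  have hmem := marker_notMem i w
  obtain ⟨u, rfl⟩ : ∃ u', u = i :: u' := by
    rcases u with _ | ⟨c, u⟩
    · obtain ⟨d, w, rfl⟩ := List.exists_cons_of_ne_nil hw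
      simp only [enc, List.nil_append, List.map_cons, List.cons_append, List.cons.injEq] at h
      simp [← h.1] at hmem
    · simp only [enc, List.cons_append, List.cons.injEq] at h
      exact ⟨u, by rw [h.1]⟩
  obtain ⟨v, rfl⟩ : ∃ v', v = v' ++ [i] := by
    rcases List.eq_nil_or_concat v with rfl | ⟨v, c, rfl⟩
    · rcases List.eq_nil_or_concat w with rfl | ⟨w, d, rfl⟩
      · exact absurd rfl hw
      · have hl := congrArg List.getLast? h
        simp only [enc, List.concat_eq_append, List.map_append, List.map_cons, List.map_nil,
          List.append_nil, ← List.append_assoc, ← List.cons_append,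
          List.getLast?_concat, Option.some.injEq] at hl
        simp [← hl] at hmem
    · have hl := congrArg List.getLast? h
      simp only [enc, List.concat_eq_append, ← List.append_assoc, ← List.cons_append,
        List.getLast?_concat, Option.some.injEq] at hl
      exact ⟨v, by simp [hl]⟩
  simp only [enc, List.cons_append, ← List.append_assoc, List.cons.injEq, true_and,
    List.append_cancel_right_eq] at h
  obtain ⟨l, b, rfl, h', rfl⟩ := List.map_eq_append_iff.1 h
  obtain ⟨a, w', rfl, rfl, hw'⟩ := List.map_eq_append_iff.1 h'
  obtain rfl := (encSymbol_injective i).list_map hw'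
  exact ⟨a, b, rfl, rfl, rfl⟩

theorem exists_window {a r b : List ℕ} {K : ℕ} (hr : r.length ≤ K)
    (hK : K < (a ++ r ++ b).length) :
    ∃ a₁ a₂ b₁ b₂, a = a₁ ++ a₂ ∧ b = b₁ ++ b₂ ∧ (a₂ ++ r ++ b₁).length = K + 1 := by
  simp only [List.length_append] at hK
  refine ⟨a.take (a.length - (K + 1 - r.length)), a.drop (a.length - (K + 1 - r.length)),
    b.take (K + 1 - r.length - a.length), b.drop (K + 1 - r.length - a.length),
    by simp, by simp, ?_⟩
  simp only [List.length_append, List.length_drop, List.length_take]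
  omega

theorem stepBy_windowRules (M : Multiway) (i : ℕ) {x : List ℕ} (hx : M.Over x)
    (z : List ℕ) :
    StepBy (M.windowRules i) (enc i x) z ↔ ∃ y, M.AvoidStep x y ∧ z = enc i y := by
  constructor
  · rintro ⟨_, ⟨x', y, -, hxy, rfl⟩ | ⟨w, w', -, hw, hstep, rfl⟩, u, v, hxuv, rfl⟩
    · obtain ⟨rfl, rfl, rfl⟩ := enc_eq_append_enc hxuv
      exact ⟨y, hxy, by simp⟩
    · obtain ⟨a, b, rfl, rfl, rfl⟩ := enc_eq_append_map (by rintro rfl; simp at hw) hxuv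
      obtain ⟨p, hp, c, d, rfl, rfl⟩ := hstep
      refine ⟨a ++ (c ++ p.2 ++ d) ++ b, ⟨⟨p, hp, a ++ c, d ++ b, by simp, by simp⟩, ?_⟩,
        by simp [enc]⟩
      intro h
      have hl := congrArg List.length h
      have hb := length_lhs_add_le_bound hp
      simp only [List.length_append] at hl hw
      omega
  · rintro ⟨y, hxy, rfl⟩
    by_cases hl : x.length ≤ M.bound
    · exact ⟨_, Or.inl ⟨x, y, ⟨hx, hl⟩, hxy, rfl⟩, [], [], by simp, by simp⟩
    · obtain ⟨⟨p, hp, a, b, rfl, rfl⟩, -⟩ := hxy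
      obtain ⟨a₁, a₂, b₁, b₂, rfl, rfl, hlen⟩ := exists_window
        (K := M.bound) (by have := length_lhs_add_le_bound hp; omega) (not_le.1 hl)
      refine ⟨_, Or.inr ⟨a₂ ++ p.1 ++ b₁, a₂ ++ p.2 ++ b₁, ⟨?_, hlen.le⟩, hlen,
        ⟨p, hp, a₂, b₁, rfl, rfl⟩, rfl⟩, i :: a₁.map (encSymbol i),
        b₂.map (encSymbol i) ++ [i], by simp [enc], by simp [enc]⟩
      intro c hc
      apply hx
      simp only [List.mem_append] at hc ⊢
      tauto

theorem stepBy_union {P Q : Set (List ℕ × List ℕ)} {x y : List ℕ} :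
    StepBy (P ∪ Q) x y ↔ StepBy P x y ∨ StepBy Q x y := by
  constructor
  · rintro ⟨p, hp | hp, h⟩
    exacts [Or.inl ⟨p, hp, h⟩, Or.inr ⟨p, hp, h⟩]
  · rintro (⟨p, hp, h⟩ | ⟨p, hp, h⟩)
    exacts [⟨p, Or.inl hp, h⟩, ⟨p, Or.inr hp, h⟩]

theorem StepBy.context {P : Set (List ℕ × List ℕ)} {x y : List ℕ} (h : StepBy P x y)
    (a b : List ℕ) : StepBy P (a ++ x ++ b) (a ++ y ++ b) := by
  obtain ⟨p, hp, u, v, rfl, rfl⟩ := h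
  exact ⟨p, hp, a ++ u, v ++ b, by simp, by simp⟩

theorem not_stepBy {i : ℕ} {P : Set (List ℕ × List ℕ)} (hP : LhsIn i P)
    {x : List ℕ} (hx : ∀ c ∈ x, c % 3 ≠ i) (y : List ℕ) : ¬ StepBy P x y := by
  rintro ⟨p, hp, u, v, rfl, -⟩
  obtain ⟨hne, hmod⟩ := hP p hp
  obtain ⟨c, hc⟩ := List.exists_mem_of_ne_nil _ hne
  exact hx c (by simp [hc]) (hmod c hc)

theorem stepBy_append_right {i : ℕ} {P : Set (List ℕ × List ℕ)} (hP : LhsIn i P)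
    {x b : List ℕ} (hb : ∀ c ∈ b, c % 3 ≠ i) (z : List ℕ) :
    StepBy P (x ++ b) z ↔ ∃ y, StepBy P x y ∧ z = y ++ b := by
  constructor
  · rintro ⟨p, hp, u, v, h, rfl⟩
    obtain ⟨hne, hmod⟩ := hP p hp
    suffices ∃ v', v = v' ++ b ∧ x = u ++ p.1 ++ v' by
      obtain ⟨v', rfl, rfl⟩ := this
      exact ⟨u ++ p.2 ++ v', ⟨p, hp, u, v', rfl, rfl⟩, by simp⟩
    rcases List.append_eq_append_iff.1 h with ⟨c, hc, rfl⟩ | ⟨c, rfl, rfl⟩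
    · rcases List.append_eq_append_iff.1 hc with ⟨d, rfl, hd⟩ | ⟨d, rfl, rfl⟩
      · rcases c with _ | ⟨e, c⟩
        · exact ⟨[], by simp, by simp [hd]⟩
        · exact absurd (hmod e (by simp [hd])) (hb e (by simp))
      · obtain ⟨e, he⟩ := List.exists_mem_of_ne_nil _ hne
        exact absurd (hmod e he) (hb e (by simp [he]))
    · exact ⟨c, rfl, rfl⟩
  · rintro ⟨y, hxy, rfl⟩
    simpa using hxy.context [] b

theorem stepBy_append_left {i : ℕ} {P : Set (List ℕ × List ℕ)} (hP : LhsIn i P)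
    {a x : List ℕ} (ha : ∀ c ∈ a, c % 3 ≠ i) (z : List ℕ) :
    StepBy P (a ++ x) z ↔ ∃ y, StepBy P x y ∧ z = a ++ y := by
  constructor
  · rintro ⟨p, hp, u, v, h, rfl⟩
    obtain ⟨hne, hmod⟩ := hP p hp
    suffices ∃ u', u = a ++ u' ∧ x = u' ++ p.1 ++ v by
      obtain ⟨u', rfl, rfl⟩ := this
      exact ⟨u' ++ p.2 ++ v, ⟨p, hp, u', v, rfl, rfl⟩, by simp⟩
    rw [List.append_assoc] at h
    rcases List.append_eq_append_iff.1 h with ⟨c, rfl, hc⟩ | ⟨c, rfl, hc⟩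
    · exact ⟨c, rfl, by simp [hc]⟩
    · obtain ⟨d, l, hdl⟩ := List.exists_cons_of_ne_nil hne
      rcases c with _ | ⟨e, c⟩
      · exact ⟨[], by simp, by simpa using hc.symm⟩
      · simp only [hdl, List.cons_append, List.cons.injEq] at hc
        exact absurd (hmod e (by simp [hdl, hc.1])) (ha e (by simp))
  · rintro ⟨y, hxy, rfl⟩
    simpa using hxy.context a []

/-- The multiway system with a given finite set of rules. -/
noncomputable def ofFinite {P : Set (List ℕ × List ℕ)} (hP : P.Finite) (s : List ℕ) :
    Multiway := ⟨hP.toFinset, s⟩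

theorem step_ofFinite {P : Set (List ℕ × List ℕ)} (hP : P.Finite) (s : List ℕ) :
    (ofFinite hP s).Step = StepBy P := by
  funext x y
  simp [Step, StepBy, ofFinite]

theorem sphere_ofFinite {P : Set (List ℕ × List ℕ)} (hP : P.Finite) (s : List ℕ) (n : ℕ) :
    (ofFinite hP s).sphere n = walkSphere (StepBy P) s n := by
  rw [sphere_eq_walkSphere, step_ofFinite]
  rfl

theorem growth_zero (M : Multiway) : M.growth 0 = 1 := by
  have : M.sphere 0 = {M.init} := by ext; simp [sphere, StepN]
  rw [growth, this, Set.ncard_singleton]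

/-- Encoded strings from different systems are juxtaposed injectively. -/
theorem enc_append_enc_injective {x x' y y' : List ℕ}
    (h : enc 1 x ++ enc 2 y = enc 1 x' ++ enc 2 y') : x = x' ∧ y = y' := by
  have key : ∀ i (hi : i < 3) z, (enc i z).filter (fun c => c % 3 = 1) =
      if i = 1 then enc i z else [] := by
    intro i hi z
    split_ifs with h1
    · exact List.filter_eq_self.2 fun c hc => by simp [mod_of_mem_enc hi c hc, h1]
    · exact List.filter_eq_nil_iff.2 fun c hc => by simp [mod_of_mem_enc hi c hc, h1]
  have h1 := congrArg (List.filter fun c => c % 3 = 1) h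
  simp only [List.filter_append, key 1 (by norm_num), key 2 (by norm_num)] at h1
  have hx : x = x' := enc_injective 1 (by simpa using h1)
  subst hx
  exact ⟨rfl, enc_injective 2 (List.append_cancel_left h)⟩

theorem exists_growth_conv (M₁ M₂ : Multiway) : ∃ M : Multiway, ∀ n : ℕ,
    M.growth n = ∑ k ∈ Finset.range (n + 1), M₁.growth k * M₂.growth (n - k) := by
  have hfin := (M₁.finite_windowRules 1).union (M₂.finite_windowRules 2)
  let F : List ℕ × List ℕ → List ℕ := fun q => enc 1 q.1 ++ enc 2 q.2
  have hF : Function.Injective F := fun q q' h => by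
    obtain ⟨h1, h2⟩ := enc_append_enc_injective h
    exact Prod.ext h1 h2
  have hstep : ∀ {x y}, M₁.Over x → M₂.Over y → ∀ z,
      StepBy (M₁.windowRules 1 ∪ M₂.windowRules 2) (F (x, y)) z ↔
        (∃ x', M₁.AvoidStep x x' ∧ z = F (x', y)) ∨
        (∃ y', M₂.AvoidStep y y' ∧ z = F (x, y')) := by
    intro x y hx hy z
    rw [stepBy_union,
      stepBy_append_right (M₁.lhsIn_windowRules (by norm_num))
        (fun c hc => by rw [mod_of_mem_enc (by norm_num) c hc]; norm_num),
      stepBy_append_left (M₂.lhsIn_windowRules (by norm_num))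
        (fun c hc => by rw [mod_of_mem_enc (by norm_num) c hc]; norm_num)]
    simp only [stepBy_windowRules _ _ hx, stepBy_windowRules _ _ hy]
    constructor
    · rintro (⟨_, ⟨x', hx', rfl⟩, rfl⟩ | ⟨_, ⟨y', hy', rfl⟩, rfl⟩)
      exacts [Or.inl ⟨x', hx', rfl⟩, Or.inr ⟨y', hy', rfl⟩]
    · rintro (⟨x', hx', rfl⟩ | ⟨y', hy', rfl⟩)
      exacts [Or.inl ⟨_, ⟨x', hx', rfl⟩, rfl⟩, Or.inr ⟨_, ⟨y', hy', rfl⟩, rfl⟩]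
  have hwalk : ∀ n z, WalkN (StepBy (M₁.windowRules 1 ∪ M₂.windowRules 2))
      (F (M₁.init, M₂.init)) n z ↔ ∃ i j x y, i + j = n ∧ WalkN M₁.AvoidStep M₁.init i x ∧
        WalkN M₂.AvoidStep M₂.init j y ∧ z = F (x, y) := by
    intro n
    induction n with
    | zero =>
      intro z
      constructor
      · rintro rfl
        exact ⟨0, 0, _, _, rfl, rfl, rfl, rfl⟩
      · rintro ⟨i, j, x, y, hij, hx, hy, rfl⟩
        obtain ⟨rfl, rfl⟩ : i = 0 ∧ j = 0 := by omega
        cases hx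
        cases hy
        rfl
    | succ n ih =>
      intro z
      constructor
      · rintro ⟨z', hz', hzz⟩
        obtain ⟨i, j, x, y, hij, hx, hy, rfl⟩ := (ih z').1 hz'
        rcases (hstep (over_of_walkN hx) (over_of_walkN hy) z).1 hzz with
          ⟨x', hxx, rfl⟩ | ⟨y', hyy, rfl⟩
        · exact ⟨i + 1, j, x', y, by omega, ⟨x, hx, hxx⟩, hy, rfl⟩
        · exact ⟨i, j + 1, x, y', by omega, hx, ⟨y, hy, hyy⟩, rfl⟩
      · rintro ⟨i, j, x, y, hij, hx, hy, rfl⟩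
        rcases i with _ | i
        · obtain ⟨j, rfl⟩ : ∃ j', j = j' + 1 := ⟨n, by omega⟩
          obtain ⟨y', hy', hyy⟩ := hy
          exact ⟨F (x, y'), (ih _).2 ⟨0, j, x, y', by omega, hx, hy', rfl⟩,
            (hstep (over_of_walkN hx) (over_of_walkN hy') _).2 (Or.inr ⟨y, hyy, rfl⟩)⟩
        · obtain ⟨x', hx', hxx⟩ := hx
          exact ⟨F (x', y), (ih _).2 ⟨i, j, x', y, by omega, hx', hy, rfl⟩,
            (hstep (over_of_walkN hx') (over_of_walkN hy) _).2 (Or.inl ⟨x, hxx, rfl⟩)⟩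
  refine ⟨ofFinite hfin (F (M₁.init, M₂.init)), fun n => ?_⟩
  have hsphere : (ofFinite hfin (F (M₁.init, M₂.init))).sphere n =
      F '' ⋃ k ∈ Finset.range (n + 1), M₁.sphere k ×ˢ M₂.sphere (n - k) := by
    rw [sphere_ofFinite]
    ext z
    simp only [sphere_eq_avoid, Set.mem_image, Set.mem_iUnion, Finset.mem_range, Set.mem_prod,
      Prod.exists, exists_prop]
    constructor
    · rintro ⟨hz, hmin⟩
      obtain ⟨i, j, x, y, rfl, hx, hy, rfl⟩ := (hwalk n z).1 hz
      refine ⟨x, y, ⟨i, by omega, ⟨hx, fun k hk hkx => ?_⟩, ?_⟩, rfl⟩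
      · exact hmin (k + j) (by omega) ((hwalk _ _).2 ⟨k, j, x, y, rfl, hkx, hy, rfl⟩)
      · rw [Nat.add_sub_cancel_left]
        exact ⟨hy, fun k hk hky =>
          hmin (i + k) (by omega) ((hwalk _ _).2 ⟨i, k, x, y, rfl, hx, hky, rfl⟩)⟩
    · rintro ⟨x, y, ⟨i, hi, hx, hy⟩, rfl⟩
      refine ⟨(hwalk _ _).2 ⟨i, n - i, x, y, by omega, hx.1, hy.1, rfl⟩, fun k hk hkz => ?_⟩
      obtain ⟨i', j', x', y', rfl, hx', hy', h⟩ := (hwalk _ _).1 hkz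
      obtain ⟨rfl, rfl⟩ := Prod.mk.inj (hF h)
      have h1 : i ≤ i' := not_lt.1 fun hlt => hx.2 _ hlt hx'
      have h2 : n - i ≤ j' := not_lt.1 fun hlt => hy.2 _ hlt hy'
      omega
  rw [growth, hsphere, Set.ncard_image_of_injective _ hF]
  have hdisj : ((Finset.range (n + 1) : Finset ℕ) : Set ℕ).PairwiseDisjoint
      fun k => M₁.sphere k ×ˢ M₂.sphere (n - k) := by
    intro k _ l _ hkl
    refine Set.disjoint_left.2 fun q hq hq' => hkl ?_
    have h1 := hq.1
    have h2 := hq'.1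
    rw [sphere_eq_avoid] at h1 h2
    exact walkSphere_disjoint h1 h2
  have hcard := (Finset.finite_toSet (Finset.range (n + 1))).ncard_biUnion
    (fun k _ => (M₁.finite_sphere k).prod (M₂.finite_sphere (n - k))) hdisj
  rw [finsum_mem_coe_finset] at hcard
  simp only [Finset.mem_coe] at hcard
  simp only [hcard, Set.ncard_prod, growth]

theorem exists_growth_add (M₁ M₂ : Multiway) : ∃ M : Multiway, M.growth 0 = 1 ∧
    ∀ n : ℕ, 1 ≤ n → M.growth n = M₁.growth n + M₂.growth n := by
  let S : Set (List ℕ × List ℕ) :=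
    {p | ∃ y, M₁.AvoidStep M₁.init y ∧ p = ([0], enc 1 y)} ∪
    {p | ∃ y, M₂.AvoidStep M₂.init y ∧ p = ([0], enc 2 y)}
  have hSfin : S.Finite := by
    refine Set.Finite.union ?_ ?_
    · refine ((M₁.finite_step M₁.init).image fun y => ([0], enc 1 y)).subset ?_
      rintro _ ⟨y, hy, rfl⟩
      exact ⟨y, hy.1, rfl⟩
    · refine ((M₂.finite_step M₂.init).image fun y => ([0], enc 2 y)).subset ?_
      rintro _ ⟨y, hy, rfl⟩
      exact ⟨y, hy.1, rfl⟩
  have hS : LhsIn 0 S := by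
    rintro _ (⟨y, -, rfl⟩ | ⟨y, -, rfl⟩) <;> simp
  have hR₁ := M₁.lhsIn_windowRules (i := 1) (by norm_num)
  have hR₂ := M₂.lhsIn_windowRules (i := 2) (by norm_num)
  let R : Set (List ℕ × List ℕ) := M₁.windowRules 1 ∪ M₂.windowRules 2 ∪ S
  have hfin : R.Finite :=
    ((M₁.finite_windowRules 1).union (M₂.finite_windowRules 2)).union hSfin
  have hmod : ∀ {i j x}, i < 3 → i ≠ j → ∀ c ∈ enc i x, c % 3 ≠ j := by
    intro i j x hi hij c hc
    rwa [mod_of_mem_enc hi c hc]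
  have hstep₀ : ∀ z, StepBy R [0] z ↔ (∃ y, M₁.AvoidStep M₁.init y ∧ z = enc 1 y) ∨
      (∃ y, M₂.AvoidStep M₂.init y ∧ z = enc 2 y) := by
    intro z
    have hz : ∀ p : List ℕ × List ℕ, p.1 = [0] →
        ((∃ u v, [0] = u ++ p.1 ++ v ∧ z = u ++ p.2 ++ v) ↔ z = p.2) := by
      intro p hp
      constructor
      · rintro ⟨u, v, h, rfl⟩
        have hl := congrArg List.length h
        simp only [hp, List.length_append, List.length_cons, List.length_nil] at hl
        obtain rfl := List.length_eq_zero_iff.1 (show u.length = 0 by omega)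
        obtain rfl := List.length_eq_zero_iff.1 (show v.length = 0 by omega)
        simp
      · rintro rfl
        exact ⟨[], [], by simp [hp], by simp⟩
    rw [stepBy_union, stepBy_union, iff_false_intro (not_stepBy hR₁ (by simp) z),
      iff_false_intro (not_stepBy hR₂ (by simp) z), false_or, false_or]
    constructor
    · rintro ⟨_, ⟨y, hy, rfl⟩ | ⟨y, hy, rfl⟩, h⟩
      · exact Or.inl ⟨y, hy, (hz _ rfl).1 h⟩
      · exact Or.inr ⟨y, hy, (hz _ rfl).1 h⟩
    · rintro (⟨y, hy, h⟩ | ⟨y, hy, h⟩)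
      · exact ⟨_, Or.inl ⟨y, hy, rfl⟩, (hz _ rfl).2 h⟩
      · exact ⟨_, Or.inr ⟨y, hy, rfl⟩, (hz _ rfl).2 h⟩
  have hstep₁ : ∀ {x}, M₁.Over x → ∀ z,
      StepBy R (enc 1 x) z ↔ ∃ y, M₁.AvoidStep x y ∧ z = enc 1 y := by
    intro x hx z
    rw [stepBy_union, stepBy_union, stepBy_windowRules _ _ hx,
      iff_false_intro (not_stepBy hR₂ (hmod (by norm_num) (by norm_num)) z),
      iff_false_intro (not_stepBy hS (hmod (by norm_num) (by norm_num)) z), or_false, or_false]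
  have hstep₂ : ∀ {x}, M₂.Over x → ∀ z,
      StepBy R (enc 2 x) z ↔ ∃ y, M₂.AvoidStep x y ∧ z = enc 2 y := by
    intro x hx z
    rw [stepBy_union, stepBy_union, stepBy_windowRules _ _ hx,
      iff_false_intro (not_stepBy hR₁ (hmod (by norm_num) (by norm_num)) z),
      iff_false_intro (not_stepBy hS (hmod (by norm_num) (by norm_num)) z), false_or, or_false]
  have hwalk : ∀ n z, WalkN (StepBy R) [0] (n + 1) z ↔
      (∃ x, WalkN M₁.AvoidStep M₁.init (n + 1) x ∧ z = enc 1 x) ∨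
      (∃ x, WalkN M₂.AvoidStep M₂.init (n + 1) x ∧ z = enc 2 x) := by
    intro n
    induction n with
    | zero =>
      intro z
      simp only [WalkN, exists_eq_left, hstep₀]
    | succ n ih =>
      intro z
      constructor
      · rintro ⟨z', hz', hzz⟩
        rcases (ih z').1 hz' with ⟨x, hx, rfl⟩ | ⟨x, hx, rfl⟩
        · obtain ⟨y, hy, rfl⟩ := (hstep₁ (over_of_walkN hx) z).1 hzz
          exact Or.inl ⟨y, ⟨x, hx, hy⟩, rfl⟩
        · obtain ⟨y, hy, rfl⟩ := (hstep₂ (over_of_walkN hx) z).1 hzz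
          exact Or.inr ⟨y, ⟨x, hx, hy⟩, rfl⟩
      · rintro (⟨y, ⟨x, hx, hy⟩, rfl⟩ | ⟨y, ⟨x, hx, hy⟩, rfl⟩)
        · exact ⟨enc 1 x, (ih _).2 (Or.inl ⟨x, hx, rfl⟩),
            (hstep₁ (over_of_walkN hx) _).2 ⟨y, hy, rfl⟩⟩
        · exact ⟨enc 2 x, (ih _).2 (Or.inr ⟨x, hx, rfl⟩),
            (hstep₂ (over_of_walkN hx) _).2 ⟨y, hy, rfl⟩⟩
  have henc : ∀ x y, enc 1 x ≠ enc 2 y := by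
    intro x y h
    simp [enc] at h
  have hwalk₁ : ∀ n x, WalkN (StepBy R) [0] (n + 1) (enc 1 x) ↔
      WalkN M₁.AvoidStep M₁.init (n + 1) x := by
    intro n x
    simp [hwalk, henc, (enc_injective 1).eq_iff]
  have hwalk₂ : ∀ n x, WalkN (StepBy R) [0] (n + 1) (enc 2 x) ↔
      WalkN M₂.AvoidStep M₂.init (n + 1) x := by
    intro n x
    simp [hwalk, (henc _ _).symm, (enc_injective 2).eq_iff]
  have hmin : ∀ (M : Multiway) i, (∀ n x, WalkN (StepBy R) [0] (n + 1) (enc i x) ↔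
      WalkN M.AvoidStep M.init (n + 1) x) → ∀ n x,
      enc i x ∈ walkSphere (StepBy R) [0] (n + 1) ↔
        x ∈ walkSphere M.AvoidStep M.init (n + 1) := by
    intro M i h n x
    refine and_congr_right_iff.2 ?_ |>.trans (and_congr_left' (h n x))
    rw [h]
    rintro ⟨w, -, hwx⟩
    refine forall₂_congr fun k _ => not_congr ?_
    rcases k with _ | k
    · refine iff_of_false ?_ hwx.2
      simp [WalkN, enc]
    · exact h k x
  refine ⟨ofFinite hfin [0], growth_zero _, fun n hn => ?_⟩
  obtain ⟨n, rfl⟩ : ∃ m, n = m + 1 := ⟨n - 1, by omega⟩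
  have hsphere : (ofFinite hfin [0]).sphere (n + 1) =
      enc 1 '' M₁.sphere (n + 1) ∪ enc 2 '' M₂.sphere (n + 1) := by
    rw [sphere_ofFinite, sphere_eq_avoid, sphere_eq_avoid]
    ext z
    constructor
    · intro hz
      rcases (hwalk n z).1 hz.1 with ⟨x, -, rfl⟩ | ⟨x, -, rfl⟩
      · exact Or.inl ⟨x, (hmin M₁ 1 hwalk₁ n x).1 hz, rfl⟩
      · exact Or.inr ⟨x, (hmin M₂ 2 hwalk₂ n x).1 hz, rfl⟩
    · rintro (⟨x, hx, rfl⟩ | ⟨x, hx, rfl⟩)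
      · exact (hmin M₁ 1 hwalk₁ n x).2 hx
      · exact (hmin M₂ 2 hwalk₂ n x).2 hx
  rw [growth, hsphere, Set.ncard_union_eq ?_ ((M₁.finite_sphere _).image _)
    ((M₂.finite_sphere _).image _), Set.ncard_image_of_injective _ (enc_injective 1),
    Set.ncard_image_of_injective _ (enc_injective 2)]
  · rfl
  · rw [Set.disjoint_left]
    rintro _ ⟨x, -, rfl⟩ ⟨y, -, h⟩
    exact henc x y h.symm

end Multiway

/-- the set of multiway growth functions is closed under pointwise addition
(away from the origin) and under discrete convolution. -/
theorem multiway_growth_closed_under_add_and_conv (M₁ M₂ : Multiway)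
    (hs₁ : M₁.init ≠ []) (hs₂ : M₂.init ≠ [])
    (hrhs : ∀ p ∈ M₁.rules ∪ M₂.rules, p.2 ≠ ([] : List ℕ)) :
    (∃ M : Multiway, M.growth 0 = 1 ∧
      ∀ n : ℕ, 1 ≤ n → M.growth n = M₁.growth n + M₂.growth n) ∧
    (∃ M : Multiway, ∀ n : ℕ,
      M.growth n = ∑ k ∈ Finset.range (n + 1), M₁.growth k * M₂.growth (n - k)) := by
  exact ⟨Multiway.exists_growth_add M₁ M₂, Multiway.exists_growth_conv M₁ M₂⟩
end

section
/- For every multiway system M, the growth function g_M : ℕ → ℕ is a primitive recursive function. -/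
theorem PrimrecRel.list_mem {α : Type*} [Primcodable α] :
    PrimrecRel fun (a : α) (l : List α) => a ∈ l := by
  refine PrimrecRel.of_eq ((PrimrecRel.exists_mem_list Primrec.eq).comp₂ Primrec₂.right
    Primrec₂.left) fun a l => ?_
  simp

theorem Primrec.list_dedup {α : Type*} [Primcodable α] [DecidableEq α] :
    Primrec (List.dedup : List α → List α) := by
  have h : Primrec fun l : List α =>
      l.foldr (fun a acc => if a ∈ acc then acc else a :: acc) [] :=
    Primrec.list_foldr (h := fun _ p => if p.1 ∈ p.2 then p.2 else p.1 :: p.2)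
      Primrec.id (Primrec.const [])
      (Primrec.ite
        (PrimrecRel.list_mem.comp (Primrec.fst.comp Primrec.snd) (Primrec.snd.comp Primrec.snd))
        (Primrec.snd.comp Primrec.snd)
        (Primrec.list_cons.comp (Primrec.fst.comp Primrec.snd) (Primrec.snd.comp Primrec.snd)))
  refine h.of_eq fun l => ?_
  induction l with
  | nil => rfl
  | cons a l ih =>
    rw [List.foldr_cons, ih]
    by_cases ha : a ∈ l
    · simp [ha]
    · simp [ha]

theorem Primrec.list_toFinset_card {α : Type*} [Primcodable α] [DecidableEq α] :
    Primrec fun l : List α => l.toFinset.card :=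
  (Primrec.list_length.comp Primrec.list_dedup).of_eq fun l => (List.card_toFinset l).symm

namespace Multiway

/-- All strings obtained from `x` by rewriting one occurrence of `p.1` to `p.2`. -/
def rewrites (x : List ℕ) (p : List ℕ × List ℕ) : List (List ℕ) :=
  (List.range (x.length + 1)).flatMap fun i =>
    if (x.drop i).take p.1.length = p.1 then
      [x.take i ++ p.2 ++ (x.drop i).drop p.1.length]
    else []

theorem mem_rewrites {x y : List ℕ} {p : List ℕ × List ℕ} :
    y ∈ rewrites x p ↔ ∃ u v, x = u ++ p.1 ++ v ∧ y = u ++ p.2 ++ v := by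
  simp only [rewrites, List.mem_flatMap, List.mem_range, List.mem_ite_nil_right,
    List.mem_singleton]
  constructor
  · rintro ⟨i, -, hi, rfl⟩
    refine ⟨x.take i, (x.drop i).drop p.1.length, ?_, rfl⟩
    conv_lhs => rw [← List.take_append_drop i x, ← List.take_append_drop p.1.length (x.drop i), hi]
    rw [List.append_assoc]
  · rintro ⟨u, v, rfl, rfl⟩
    exact ⟨u.length, by simp, by simp, by simp⟩

theorem primrec_rewrites : Primrec₂ rewrites := by
  refine Primrec.list_flatMap
    (Primrec.list_range.comp (Primrec.succ.comp (Primrec.list_length.comp Primrec.fst))) ?_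
  have hx : Primrec fun q : (List ℕ × (List ℕ × List ℕ)) × ℕ => q.1.1 :=
    Primrec.fst.comp Primrec.fst
  have hr : Primrec fun q : (List ℕ × (List ℕ × List ℕ)) × ℕ => q.1.2.1 :=
    Primrec.fst.comp (Primrec.snd.comp Primrec.fst)
  have ht : Primrec fun q : (List ℕ × (List ℕ × List ℕ)) × ℕ => q.1.2.2 :=
    Primrec.snd.comp (Primrec.snd.comp Primrec.fst)
  have hlen := Primrec.list_length.comp hr
  have hdrop := Primrec.list_drop.comp Primrec.snd hx
  exact Primrec.ite (Primrec.eq.comp (Primrec.list_take.comp hlen hdrop) hr)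
    (Primrec.list_cons.comp
      (Primrec.list_append.comp
        (Primrec.list_append.comp (Primrec.list_take.comp Primrec.snd hx) ht)
        (Primrec.list_drop.comp hlen hdrop))
      (Primrec.const []))
    (Primrec.const [])

/-- The strings obtained from `x` by one rewrite step. -/
noncomputable def successors (M : Multiway) (x : List ℕ) : List (List ℕ) :=
  M.rules.toList.flatMap (rewrites x)

variable (M : Multiway)

theorem mem_successors {x y : List ℕ} : y ∈ M.successors x ↔ M.Step x y := by
  simp [successors, mem_rewrites, Step]

theorem primrec_successors : Primrec M.successors :=
  Primrec.list_flatMap (Primrec.const _) primrec_rewrites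

/-- The strings reachable by exactly `n` rewrite steps. -/
noncomputable def level (n : ℕ) : List (List ℕ) :=
  n.rec [M.init] fun _ l => l.flatMap M.successors

theorem mem_level {n : ℕ} {x : List ℕ} : x ∈ M.level n ↔ M.StepN n x := by
  induction n generalizing x with
  | zero => simp [level, StepN]
  | succ n ih =>
    change x ∈ (M.level n).flatMap M.successors ↔ ∃ y, M.StepN n y ∧ M.Step y x
    simp [ih, mem_successors]

theorem primrec_level : Primrec M.level :=
  Primrec.nat_rec₁ [M.init]
    (Primrec.list_flatMap Primrec.snd (M.primrec_successors.comp Primrec.snd).to₂)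

/-- The strings reachable by fewer than `n` rewrite steps. -/
noncomputable def ball (n : ℕ) : List (List ℕ) :=
  (List.range n).flatMap M.level

theorem mem_ball {n : ℕ} {x : List ℕ} : x ∈ M.ball n ↔ ∃ k < n, M.StepN k x := by
  simp [ball, mem_level]

theorem primrec_ball : Primrec M.ball :=
  Primrec.list_flatMap Primrec.list_range (M.primrec_level.comp Primrec.snd).to₂

theorem sphere_eq (n : ℕ) :
    M.sphere n = ((M.ball (n + 1)).toFinset \ (M.ball n).toFinset : Finset (List ℕ)) := by
  ext x
  simp only [sphere, Set.mem_ofPred_eq, Finset.coe_sdiff, Set.mem_sdiff, List.coe_toFinset,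
    mem_ball, Nat.exists_lt_succ_right, not_exists, not_and]
  grind

theorem growth_eq (n : ℕ) :
    M.growth n = (M.ball (n + 1)).toFinset.card - (M.ball n).toFinset.card := by
  rw [growth, sphere_eq, Set.ncard_coe_finset, Finset.card_sdiff_of_subset]
  intro x
  simp only [List.mem_toFinset, mem_ball]
  rintro ⟨k, hk, hx⟩
  exact ⟨k, hk.trans n.lt_succ_self, hx⟩

end Multiway

/-- the growth function of every multiway system is primitive recursive. -/
theorem multiway_growth_primrec (M : Multiway) : Primrec M.growth := by
  have hcard := Primrec.list_toFinset_card.comp M.primrec_ball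
  exact (Primrec.nat_sub.comp (hcard.comp Primrec.succ) hcard).of_eq fun n => (M.growth_eq n).symm
end

section
/- For every N ≥ 1, the multiway system over the alphabet {A, B} with the single rule A → AB and initial string A^N (N copies of A) has growth function g(n) = C(n + N − 1, N − 1) (the binomial coefficient), i.e. the n-th (N−1)-polytopic number; in particular g is a polynomial in n of degree N − 1. -/
/-- The words consisting of `a` letters `0` and `b` letters `1`. -/
def binaryWords (a b : ℕ) : Set (List ℕ) :=
  {w | w.Perm (List.replicate a 0 ++ List.replicate b 1)}

theorem mem_binaryWords {a b : ℕ} {w : List ℕ} :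
    w ∈ binaryWords a b ↔ w.Perm (List.replicate a 0 ++ List.replicate b 1) :=
  Iff.rfl

theorem finite_binaryWords (a b : ℕ) : (binaryWords a b).Finite :=
  (List.replicate a 0 ++ List.replicate b 1).permutations.finite_toSet.subset
    fun _ hw => List.mem_permutations.2 (mem_binaryWords.1 hw)

theorem zero_cons_mem_binaryWords {a b : ℕ} {w : List ℕ} :
    0 :: w ∈ binaryWords (a + 1) b ↔ w ∈ binaryWords a b := by
  simp [mem_binaryWords, List.replicate_succ]

theorem one_cons_mem_binaryWords {a b : ℕ} {w : List ℕ} :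
    1 :: w ∈ binaryWords a (b + 1) ↔ w ∈ binaryWords a b := by
  rw [mem_binaryWords, mem_binaryWords, List.replicate_succ,
    List.perm_middle.congr_right, List.perm_cons]

theorem eq_zero_or_one_of_cons_mem_binaryWords {a b c : ℕ} {w : List ℕ}
    (hw : c :: w ∈ binaryWords a b) : c = 0 ∨ c = 1 := by
  have h := (mem_binaryWords.1 hw).subset (List.mem_cons_self (a := c))
  rw [List.mem_append] at h
  exact h.imp List.eq_of_mem_replicate List.eq_of_mem_replicate

theorem binaryWords_succ_succ (a b : ℕ) :
    binaryWords (a + 1) (b + 1) =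
      List.cons 0 '' binaryWords a (b + 1) ∪ List.cons 1 '' binaryWords (a + 1) b := by
  ext w
  constructor
  · intro hw
    cases w with
    | nil => simpa using (mem_binaryWords.1 hw).length_eq
    | cons c w =>
      rcases eq_zero_or_one_of_cons_mem_binaryWords hw with rfl | rfl
      · exact Or.inl ⟨w, zero_cons_mem_binaryWords.1 hw, rfl⟩
      · exact Or.inr ⟨w, one_cons_mem_binaryWords.1 hw, rfl⟩
  · rintro (⟨w, hw, rfl⟩ | ⟨w, hw, rfl⟩)
    · exact zero_cons_mem_binaryWords.2 hw
    · exact one_cons_mem_binaryWords.2 hw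

theorem ncard_binaryWords (a b : ℕ) : (binaryWords a b).ncard = (a + b).choose a := by
  induction a generalizing b with
  | zero => simp [binaryWords, List.perm_replicate]
  | succ a iha =>
    induction b with
    | zero => simp [binaryWords, List.perm_replicate]
    | succ b ihb =>
      have hdisj : Disjoint (List.cons 0 '' binaryWords a (b + 1))
          (List.cons 1 '' binaryWords (a + 1) b) := by
        rw [Set.disjoint_left]
        rintro _ ⟨w, -, rfl⟩ ⟨v, -, h⟩
        simp at h
      rw [binaryWords_succ_succ, Set.ncard_union_eq hdisj
        ((finite_binaryWords _ _).image _) ((finite_binaryWords _ _).image _),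
        Set.ncard_image_of_injective _ List.cons_injective,
        Set.ncard_image_of_injective _ List.cons_injective, iha, ihb,
        show a + 1 + (b + 1) = a + (b + 1) + 1 by ring, Nat.choose_succ_succ,
        show a + 1 + b = a + (b + 1) by ring]

/-- A `0`-headed word with a letter `1` contains the factor `01`, after whose contraction to `0`
it is still `0`-headed. -/
theorem exists_zero_one_factor {a b : ℕ} {w : List ℕ} (hw : w ∈ binaryWords a (b + 1)) :
    ∃ u v v' : List ℕ, 0 :: w = u ++ [0, 1] ++ v ∧ u ++ [0] ++ v = 0 :: v' := by
  induction w generalizing a b with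
  | nil => simpa using (mem_binaryWords.1 hw).length_eq
  | cons c w ih =>
    rcases eq_zero_or_one_of_cons_mem_binaryWords hw with rfl | rfl
    · cases a with
      | zero => simpa using (mem_binaryWords.1 hw).subset (List.mem_cons_self (a := 0))
      | succ a =>
        obtain ⟨u, v, -, huv, -⟩ := ih (zero_cons_mem_binaryWords.1 hw)
        exact ⟨0 :: u, v, u ++ [0] ++ v, by rw [huv]; simp, by simp⟩
    · exact ⟨[], w, w, by simp, by simp⟩

theorem stepN_iff (a n : ℕ) (x : List ℕ) :
    (Multiway.mk {([0], [0, 1])} (List.replicate (a + 1) 0)).StepN n x ↔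
      ∃ w ∈ binaryWords a n, x = 0 :: w := by
  induction n generalizing x with
  | zero => simp [Multiway.StepN, binaryWords, List.perm_replicate, List.replicate_succ]
  | succ n ih =>
    have key (u v : List ℕ) : u ++ [0, 1] ++ v ∈ binaryWords (a + 1) (n + 1) ↔
        u ++ [0] ++ v ∈ binaryWords (a + 1) n := by
      rw [← one_cons_mem_binaryWords (w := u ++ [0] ++ v), mem_binaryWords, mem_binaryWords]
      refine List.Perm.congr_left ?_ _
      have h : (u ++ [0] ++ 1 :: v).Perm (1 :: (u ++ [0] ++ v)) := List.perm_middle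
      simpa only [List.append_assoc, List.cons_append, List.nil_append] using h
    constructor
    · rintro ⟨y, hy, p, hp, u, v, rfl, rfl⟩
      obtain rfl : p = ([0], [0, 1]) := by simpa using hp
      obtain ⟨w, hw, h⟩ := (ih _).1 hy
      have hmem := (key u v).2 (h ▸ zero_cons_mem_binaryWords.2 hw)
      obtain ⟨w', hw'⟩ : ∃ w', u ++ [0, 1] ++ v = 0 :: w' := by
        cases u with
        | nil => simp
        | cons c u => simp_all
      exact ⟨w', zero_cons_mem_binaryWords.1 (hw' ▸ hmem), hw'⟩
    · rintro ⟨w, hw, rfl⟩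
      obtain ⟨u, v, v', h, h'⟩ := exists_zero_one_factor hw
      refine ⟨u ++ [0] ++ v, (ih _).2 ⟨v', ?_, h'⟩, _, Finset.mem_singleton_self _, u, v, rfl, h⟩
      have := (key u v).1 (h ▸ zero_cons_mem_binaryWords.2 hw)
      exact zero_cons_mem_binaryWords.1 (h' ▸ this)

theorem sphere_eq_image (a n : ℕ) :
    (Multiway.mk {([0], [0, 1])} (List.replicate (a + 1) 0)).sphere n =
      List.cons 0 '' binaryWords a n := by
  ext x
  simp only [Multiway.sphere, Set.mem_ofPred_eq, stepN_iff, Set.mem_image]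
  constructor
  · rintro ⟨⟨w, hw, rfl⟩, -⟩
    exact ⟨w, hw, rfl⟩
  · rintro ⟨w, hw, rfl⟩
    refine ⟨⟨w, hw, rfl⟩, ?_⟩
    rintro k hk ⟨v, hv, h⟩
    obtain rfl : w = v := by simpa using h
    have h1 := (mem_binaryWords.1 hw).length_eq
    have h2 := (mem_binaryWords.1 hv).length_eq
    simp only [List.length_append, List.length_replicate] at h1 h2
    omega

/-- the system with the single rule `A → AB` started on `A^N` (here `A = 0`,
`B = 1`) has growth function `n ↦ C(n + N - 1, N - 1)`, the `(N-1)`-polytopic numbers. -/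
theorem growth_of_polytopic_system (N : ℕ) (hN : 1 ≤ N) :
    ∀ n : ℕ,
      (Multiway.mk {([0], [0, 1])} (List.replicate N 0)).growth n =
        Nat.choose (n + N - 1) (N - 1) := by
  intro n
  obtain ⟨a, rfl⟩ := Nat.exists_eq_add_of_le' hN
  rw [Multiway.growth, sphere_eq_image, Set.ncard_image_of_injective _ List.cons_injective,
    ncard_binaryWords, Nat.add_comm a n]
  rfl
end

section
/- For every N ≥ 1, the multiway system over the alphabet {Q, x₁, …, x_N} with rules Q → Q·x_i for i = 1, …, N and initial string Q has growth function g(n) = N^n for all n ∈ ℕ. -/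
/-- The system over the symbols `0, …, N` with the rules `0 → 0 i` for `i = 1, …, N`, started
on `0`. -/
def exponentialSystem (N : ℕ) : Multiway :=
  Multiway.mk (Finset.image (fun i : ℕ => (([0] : List ℕ), [0, i])) (Finset.Icc 1 N)) [0]

/-- The string consisting of `0` followed by the word `l` over the symbols `1, …, N`. -/
def wordState {N : ℕ} (l : List (Fin N)) : List ℕ :=
  0 :: l.map fun i : Fin N => (i : ℕ) + 1

theorem wordState_injective {N : ℕ} :
    Function.Injective (wordState : List (Fin N) → List ℕ) := by
  intro l l' h
  have hinj : Function.Injective fun i : Fin N => (i : ℕ) + 1 :=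
    fun i j hij => Fin.ext (Nat.succ.inj hij)
  exact List.map_injective_iff.mpr hinj (List.cons.inj h).2

theorem exponentialSystem_step_wordState {N : ℕ} (l : List (Fin N)) (y : List ℕ) :
    (exponentialSystem N).Step (wordState l) y ↔ ∃ i : Fin N, y = wordState (i :: l) := by
  constructor
  · rintro ⟨p, hp, u, v, hx, rfl⟩
    obtain ⟨i, hi, rfl⟩ := Finset.mem_image.mp hp
    obtain ⟨hi₁, hi₂⟩ := Finset.mem_Icc.mp hi
    cases u with
    | nil =>
      have hv : v = l.map fun i : Fin N => (i : ℕ) + 1 := by simpa [wordState] using hx.symm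
      refine ⟨⟨i - 1, by omega⟩, ?_⟩
      simp [wordState, hv, Nat.sub_add_cancel hi₁]
    | cons a u =>
      have hmem : 0 ∈ l.map fun i : Fin N => (i : ℕ) + 1 := by
        rw [(List.cons.inj hx).2]
        simp
      simp at hmem
  · rintro ⟨i, rfl⟩
    refine ⟨([0], [0, (i : ℕ) + 1]), Finset.mem_image_of_mem _ ?_, [],
      l.map fun i : Fin N => (i : ℕ) + 1, rfl, rfl⟩
    exact Finset.mem_Icc.mpr ⟨by omega, i.isLt⟩

theorem exponentialSystem_stepN_iff {N : ℕ} (n : ℕ) (x : List ℕ) :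
    (exponentialSystem N).StepN n x ↔ ∃ l : List (Fin N), l.length = n ∧ wordState l = x := by
  induction n generalizing x with
  | zero =>
    constructor
    · rintro rfl
      exact ⟨[], rfl, rfl⟩
    · rintro ⟨l, hl, rfl⟩
      rw [List.length_eq_zero_iff.mp hl]
      rfl
  | succ n ih =>
    constructor
    · rintro ⟨y, hy, hstep⟩
      obtain ⟨l, hl, rfl⟩ := (ih y).mp hy
      obtain ⟨i, rfl⟩ := (exponentialSystem_step_wordState l x).mp hstep
      exact ⟨i :: l, by simp [hl], rfl⟩
    · rintro ⟨_ | ⟨i, l⟩, hl, rfl⟩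
      · simp at hl
      · exact ⟨wordState l, (ih _).mpr ⟨l, by simpa using hl, rfl⟩,
          (exponentialSystem_step_wordState l _).mpr ⟨i, rfl⟩⟩

theorem exponentialSystem_sphere (N n : ℕ) :
    (exponentialSystem N).sphere n = wordState '' {l : List (Fin N) | l.length = n} := by
  ext x
  refine ⟨fun hx => (exponentialSystem_stepN_iff n x).mp hx.1, fun hx =>
    ⟨(exponentialSystem_stepN_iff n x).mpr hx, fun k hk hkx => ?_⟩⟩
  obtain ⟨l, hl, rfl⟩ := hx
  obtain ⟨l', hl', h⟩ := (exponentialSystem_stepN_iff k _).mp hkx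
  rw [wordState_injective h] at hl'
  exact hk.ne (hl'.symm.trans hl)

/-- the system with rules `Q → Q xᵢ` (`i = 1, …, N`; here `Q = 0`, `xᵢ = i`)
started on `Q` has growth function `n ↦ N ^ n`. -/
theorem growth_of_exponential_system (N : ℕ) (hN : 1 ≤ N) :
    ∀ n : ℕ,
      (Multiway.mk (Finset.image (fun i : ℕ => (([0] : List ℕ), [0, i])) (Finset.Icc 1 N))
          [0]).growth n = N ^ n := by
  intro n
  change ((exponentialSystem N).sphere n).ncard = N ^ n
  rw [exponentialSystem_sphere, Set.ncard_image_of_injective _ wordState_injective]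
  change Nat.card (List.Vector (Fin N) n) = N ^ n
  rw [Nat.card_eq_fintype_card, card_vector, Fintype.card_fin]
end

section
/- There exists a multiway system M whose growth function has logarithmic growth: there are constants 0 < c ≤ C and N such that c · log n ≤ g_M(n) ≤ C · log n for all n ≥ N (i.e. g_M ∈ Θ(log n)). -/
namespace DoublingSystem

/-- A head `2` sweeps right over a block of `1`s, doubling it; at the marker `0` it becomes a
head `3`, which returns to the left marker and there either restarts the sweep or turns into
the symbol `4`, which emits `0`s forever. -/
def system : Multiway where
  rules := {([2, 1], [1, 1, 2]), ([2, 0], [3, 0]), ([1, 3], [3, 1]), ([0, 3], [0, 2]),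
    ([0, 3], [4]), ([4], [0, 4])}
  init := [0, 2, 1, 0]

/-- The string in which the head `h` is sweeping, with `i` ones to its left and `j` ones to its
right. -/
def sweep (h i j : ℕ) : List ℕ :=
  (0 :: List.replicate i 1) ++ h :: (List.replicate j 1 ++ [0])

/-- The string of a spawned branch after `d` emissions. -/
def branch (d m : ℕ) : List ℕ :=
  List.replicate d 0 ++ 4 :: (List.replicate m 1 ++ [0])

/-- The time at which the `k`-th rightward sweep starts. -/
def startTime : ℕ → ℕ
  | 0 => 0
  | k + 1 => startTime k + 3 * 2 ^ k + 2

lemma startTime_strictMono : StrictMono startTime :=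
  strictMono_nat_of_lt_succ fun k => by simp only [startTime]; omega

lemma startTime_add (k : ℕ) : startTime k + 3 = 3 * 2 ^ k + 2 * k := by
  induction k with
  | zero => rfl
  | succ k ih => simp only [startTime, pow_succ]; omega

lemma append_cons_eq_iff {p q u v : List ℕ} {h g : ℕ} (hg : 2 ≤ g)
    (hp : ∀ x ∈ p, x < 2) (hq : ∀ x ∈ q, x < 2) :
    p ++ h :: q = u ++ g :: v ↔ p = u ∧ h = g ∧ q = v :=
  List.append_cons_inj_of_notMem (fun hm => absurd (hp g hm) (by omega))
    (fun hm => absurd (hq g hm) (by omega))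

lemma step_iff {p q y : List ℕ} {h : ℕ} (hp : ∀ x ∈ p, x < 2) (hq : ∀ x ∈ q, x < 2) :
    system.Step (p ++ h :: q) y ↔
      (h = 2 ∧ ∃ v, q = 1 :: v ∧ y = p ++ 1 :: 1 :: 2 :: v) ∨
      (h = 2 ∧ ∃ v, q = 0 :: v ∧ y = p ++ 3 :: 0 :: v) ∨
      (h = 3 ∧ ∃ u, p = u ++ [1] ∧ y = u ++ 3 :: 1 :: q) ∨
      (h = 3 ∧ ∃ u, p = u ++ [0] ∧ y = u ++ 0 :: 2 :: q) ∨
      (h = 3 ∧ ∃ u, p = u ++ [0] ∧ y = u ++ 4 :: q) ∨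
      (h = 4 ∧ y = p ++ 0 :: 4 :: q) := by
  have right (g c : ℕ) (hg : 2 ≤ g) (u v : List ℕ) :
      p ++ h :: q = u ++ [g, c] ++ v ↔ p = u ∧ h = g ∧ q = c :: v := by
    rw [← append_cons_eq_iff hg hp hq]; simp
  have left (g c : ℕ) (hg : 2 ≤ g) (u v : List ℕ) :
      p ++ h :: q = u ++ [c, g] ++ v ↔ p = u ++ [c] ∧ h = g ∧ q = v := by
    rw [← append_cons_eq_iff hg hp hq]; simp
  have single (g : ℕ) (hg : 2 ≤ g) (u v : List ℕ) :
      p ++ h :: q = u ++ [g] ++ v ↔ p = u ∧ h = g ∧ q = v := by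
    rw [← append_cons_eq_iff hg hp hq]; simp
  simp only [Multiway.Step, system, Finset.mem_insert, Finset.mem_singleton, or_and_right,
    exists_or, exists_eq_left, right 2 1 le_rfl, right 2 0 le_rfl, left 3 1 (by norm_num),
    left 3 0 (by norm_num), single 4 (by norm_num)]
  constructor
  · rintro (⟨u, v, ⟨rfl, rfl, rfl⟩, rfl⟩ | ⟨u, v, ⟨rfl, rfl, rfl⟩, rfl⟩ |
      ⟨u, v, ⟨rfl, rfl, rfl⟩, rfl⟩ | ⟨u, v, ⟨rfl, rfl, rfl⟩, rfl⟩ |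
      ⟨u, v, ⟨rfl, rfl, rfl⟩, rfl⟩ | ⟨u, v, ⟨rfl, rfl, rfl⟩, rfl⟩) <;> simp
  · rintro (⟨rfl, v, rfl, rfl⟩ | ⟨rfl, v, rfl, rfl⟩ | ⟨rfl, u, rfl, rfl⟩ | ⟨rfl, u, rfl, rfl⟩ |
      ⟨rfl, u, rfl, rfl⟩ | ⟨rfl, rfl⟩) <;> simp

lemma lt_two_of_mem_left {i : ℕ} : ∀ x ∈ 0 :: List.replicate i 1, x < 2 := by
  simp +contextual [List.mem_replicate, or_imp]

lemma lt_two_of_mem_right {j : ℕ} : ∀ x ∈ List.replicate j 1 ++ [0], x < 2 := by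
  simp +contextual [List.mem_replicate, or_imp]

lemma lt_two_of_mem_zeros {d : ℕ} : ∀ x ∈ List.replicate d 0, x < 2 := by
  simp +contextual [List.mem_replicate]

lemma left_succ (i : ℕ) :
    (0 :: List.replicate (i + 1) 1 : List ℕ) = (0 :: List.replicate i 1) ++ [1] := by
  simp [List.replicate_succ']

lemma step_sweep_right_succ {i j : ℕ} {y : List ℕ} :
    system.Step (sweep 2 i (j + 1)) y ↔ y = sweep 2 (i + 2) j := by
  rw [sweep, sweep, step_iff lt_two_of_mem_left lt_two_of_mem_right, left_succ (i + 1), left_succ i]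
  simp [List.replicate_succ]

lemma step_sweep_right_zero {i : ℕ} {y : List ℕ} :
    system.Step (sweep 2 i 0) y ↔ y = sweep 3 i 0 := by
  rw [sweep, step_iff lt_two_of_mem_left lt_two_of_mem_right]
  simp [sweep]

lemma step_sweep_left_succ {i j : ℕ} {y : List ℕ} :
    system.Step (sweep 3 (i + 1) j) y ↔ y = sweep 3 i (j + 1) := by
  have hne (u v : List ℕ) : u ++ [1] ≠ v ++ [0] := fun h => by
    simpa using congrArg List.getLast? h
  rw [sweep, step_iff lt_two_of_mem_left lt_two_of_mem_right, left_succ]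
  simp only [List.append_left_inj, hne]
  simp [sweep, List.replicate_succ]

lemma step_sweep_left_zero {j : ℕ} {y : List ℕ} :
    system.Step (sweep 3 0 j) y ↔ y = sweep 2 0 j ∨ y = branch 0 j := by
  rw [sweep, step_iff lt_two_of_mem_left lt_two_of_mem_right]
  simp [sweep, branch, List.singleton_eq_append_iff]

lemma step_branch {d m : ℕ} {y : List ℕ} :
    system.Step (branch d m) y ↔ y = branch (d + 1) m := by
  rw [branch, step_iff lt_two_of_mem_zeros lt_two_of_mem_right]
  simp [branch, List.replicate_succ']

lemma sweep_inj {h i j h' i' j' : ℕ} (hh : 2 ≤ h') :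
    sweep h i j = sweep h' i' j' ↔ i = i' ∧ h = h' ∧ j = j' := by
  rw [sweep, sweep, append_cons_eq_iff hh lt_two_of_mem_left lt_two_of_mem_right]
  simp

lemma branch_inj {d m d' m' : ℕ} : branch d m = branch d' m' ↔ d = d' ∧ m = m' := by
  rw [branch, branch, append_cons_eq_iff (by norm_num) lt_two_of_mem_zeros lt_two_of_mem_right]
  simp

lemma sweep_ne_branch {h i j d m : ℕ} (hh : h ≠ 4) : sweep h i j ≠ branch d m := by
  rw [sweep, branch, Ne, append_cons_eq_iff (by norm_num) lt_two_of_mem_left lt_two_of_mem_right]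
  tauto

/-- `x` belongs, at time `n`, to a branch spawned no later than `n`. -/
def IsBranchAt (n : ℕ) (x : List ℕ) : Prop :=
  ∃ q d, 1 ≤ q ∧ startTime q + d = n ∧ x = branch d (2 ^ q)

/-- `x` is the sweeping string at time `n`, during the `k`-th round trip. -/
def IsSweepAt (n k : ℕ) (x : List ℕ) : Prop :=
  (∃ s r, s + r = 2 ^ k ∧ n = startTime k + s ∧ x = sweep 2 (2 * s) r) ∨
    ∃ i j, i + j = 2 ^ (k + 1) ∧ n = startTime k + 2 ^ k + 1 + j ∧ x = sweep 3 i j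

lemma IsSweepAt.bounds {n k : ℕ} {x : List ℕ} (h : IsSweepAt n k x) :
    startTime k ≤ n ∧ n < startTime (k + 1) := by
  rcases h with ⟨s, r, h, rfl, -⟩ | ⟨i, j, h, rfl, -⟩ <;>
    simp only [startTime, pow_succ] at * <;> omega

lemma IsSweepAt.not_isBranchAt {n n' k : ℕ} {x : List ℕ} (h : IsSweepAt n k x) :
    ¬ IsBranchAt n' x := by
  rintro ⟨q, d, -, -, hx⟩
  rcases h with ⟨s, r, -, -, rfl⟩ | ⟨i, j, -, -, rfl⟩ <;>
    exact sweep_ne_branch (by norm_num) hx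

lemma IsSweepAt.time_unique {n n' k k' : ℕ} {x : List ℕ} (h : IsSweepAt n k x)
    (h' : IsSweepAt n' k' x) : n = n' := by
  rcases h with ⟨s, r, h, rfl, rfl⟩ | ⟨s, r, h, rfl, rfl⟩ <;>
  rcases h' with ⟨s', r', h', rfl, hx⟩ | ⟨s', r', h', rfl, hx⟩ <;>
  obtain ⟨h1, h2, h3⟩ := (sweep_inj (by norm_num)).1 hx
  · have hk : k = k' := Nat.pow_right_injective le_rfl (show 2 ^ k = 2 ^ k' by omega)
    subst hk; omega
  · omega
  · omega
  · have hk : k + 1 = k' + 1 :=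
      Nat.pow_right_injective le_rfl (show 2 ^ (k + 1) = 2 ^ (k' + 1) by omega)
    obtain rfl : k = k' := by omega
    omega

lemma IsBranchAt.time_unique {n n' : ℕ} {x : List ℕ} (h : IsBranchAt n x)
    (h' : IsBranchAt n' x) : n = n' := by
  obtain ⟨q, d, -, rfl, rfl⟩ := h
  obtain ⟨q', d', -, rfl, hx⟩ := h'
  obtain ⟨rfl, hq⟩ := branch_inj.1 hx
  rw [Nat.pow_right_injective le_rfl hq]

lemma exists_step_iff {n : ℕ} {w y : List ℕ} :
    (∃ x, (x = w ∨ IsBranchAt n x) ∧ system.Step x y) ↔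
      system.Step w y ∨ ∃ q d, 1 ≤ q ∧ startTime q + d = n ∧ y = branch (d + 1) (2 ^ q) := by
  constructor
  · rintro ⟨x, rfl | ⟨q, d, hq, hn, rfl⟩, h⟩
    · exact Or.inl h
    · exact Or.inr ⟨q, d, hq, hn, step_branch.1 h⟩
  · rintro (h | ⟨q, d, hq, hn, rfl⟩)
    · exact ⟨w, Or.inl rfl, h⟩
    · exact ⟨_, Or.inr ⟨q, d, hq, hn, rfl⟩, step_branch.2 rfl⟩

lemma isBranchAt_succ_iff {n : ℕ} {y : List ℕ} :
    IsBranchAt (n + 1) y ↔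
      (∃ q, 1 ≤ q ∧ startTime q = n + 1 ∧ y = branch 0 (2 ^ q)) ∨
      ∃ q d, 1 ≤ q ∧ startTime q + d = n ∧ y = branch (d + 1) (2 ^ q) := by
  constructor
  · rintro ⟨q, _ | d, hq, hn, rfl⟩
    · exact Or.inl ⟨q, hq, hn, rfl⟩
    · exact Or.inr ⟨q, d, hq, by omega, rfl⟩
  · rintro (⟨q, hq, hn, rfl⟩ | ⟨q, d, hq, hn, rfl⟩)
    · exact ⟨q, 0, hq, hn, rfl⟩
    · exact ⟨q, d + 1, hq, by omega, rfl⟩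

lemma isBranchAt_succ_iff_of_lt {n k : ℕ} {y : List ℕ} (h1 : startTime k ≤ n)
    (h2 : n + 1 < startTime (k + 1)) :
    IsBranchAt (n + 1) y ↔
      ∃ q d, 1 ≤ q ∧ startTime q + d = n ∧ y = branch (d + 1) (2 ^ q) := by
  rw [isBranchAt_succ_iff, or_iff_right]
  rintro ⟨q, -, hq, -⟩
  have h3 : k < q := startTime_strictMono.lt_iff_lt.1 (by omega)
  have h4 : q < k + 1 := startTime_strictMono.lt_iff_lt.1 (by omega)
  omega

lemma exists_stepN_iff (n : ℕ) :
    ∃ k w, IsSweepAt n k w ∧ ∀ x, system.StepN n x ↔ x = w ∨ IsBranchAt n x := by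
  induction n with
  | zero =>
    refine ⟨0, sweep 2 0 1, Or.inl ⟨0, 1, rfl, rfl, rfl⟩, fun x => ?_⟩
    rw [or_iff_left]
    · rfl
    · rintro ⟨q, d, hq, hn, -⟩
      have := startTime_strictMono (show 0 < q by omega)
      omega
  | succ n ih =>
    obtain ⟨k, w, hw, ih⟩ := ih
    have hb := hw.bounds
    simp only [Multiway.StepN, ih, exists_step_iff]
    rcases hw with ⟨s, r, h, hn, rfl⟩ | ⟨i, j, h, hn, rfl⟩
    · rcases r with _ | r
      · have hw' : IsSweepAt (n + 1) k (sweep 3 (2 * s) 0) :=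
          Or.inr ⟨2 * s, 0, by rw [pow_succ]; omega, by omega, rfl⟩
        refine ⟨k, _, hw', fun x => ?_⟩
        rw [step_sweep_right_zero, isBranchAt_succ_iff_of_lt hb.1 hw'.bounds.2]
      · have hw' : IsSweepAt (n + 1) k (sweep 2 (2 * s + 2) r) :=
          Or.inl ⟨s + 1, r, by omega, by omega, rfl⟩
        refine ⟨k, _, hw', fun x => ?_⟩
        rw [step_sweep_right_succ, isBranchAt_succ_iff_of_lt hb.1 hw'.bounds.2]
    · rcases i with _ | i
      · have hT : startTime (k + 1) = n + 1 := by
          simp only [startTime, pow_succ] at *; omega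
        obtain rfl : j = 2 ^ (k + 1) := by omega
        refine ⟨k + 1, _, Or.inl ⟨0, 2 ^ (k + 1), by omega, by omega, rfl⟩, fun x => ?_⟩
        rw [step_sweep_left_zero, isBranchAt_succ_iff, or_assoc]
        refine or_congr Iff.rfl (or_congr ⟨fun hx => ⟨k + 1, by omega, hT, hx⟩, ?_⟩ Iff.rfl)
        rintro ⟨q, -, hq, rfl⟩
        rw [startTime_strictMono.injective (hq.trans hT.symm)]
      · have hw' : IsSweepAt (n + 1) k (sweep 3 i (j + 1)) :=
          Or.inr ⟨i, j + 1, by omega, by omega, rfl⟩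
        refine ⟨k, _, hw', fun x => ?_⟩
        rw [step_sweep_left_succ, isBranchAt_succ_iff_of_lt hb.1 hw'.bounds.2]

lemma stepN_time_unique {n n' : ℕ} {x : List ℕ} (h : system.StepN n x)
    (h' : system.StepN n' x) : n = n' := by
  obtain ⟨k, w, hw, H⟩ := exists_stepN_iff n
  obtain ⟨k', w', hw', H'⟩ := exists_stepN_iff n'
  rcases (H x).1 h with rfl | hb <;> rcases (H' x).1 h' with rfl | hb'
  · exact hw.time_unique hw'
  · exact absurd hb' hw.not_isBranchAt
  · exact absurd hb hw'.not_isBranchAt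
  · exact hb.time_unique hb'

lemma exists_growth_eq (n : ℕ) :
    ∃ k, startTime k ≤ n ∧ n < startTime (k + 1) ∧ system.growth n = k + 1 := by
  obtain ⟨k, w, hw, H⟩ := exists_stepN_iff n
  obtain ⟨h1, h2⟩ := hw.bounds
  refine ⟨k, h1, h2, ?_⟩
  set f : ℕ → List ℕ := fun q => branch (n - startTime q) (2 ^ q)
  have hf : Function.Injective f := fun q q' h =>
    Nat.pow_right_injective le_rfl (branch_inj.1 h).2
  have hS : system.sphere n = insert w (f '' (Finset.Icc 1 k : Set ℕ)) := by
    ext x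
    have : x ∈ system.sphere n ↔ system.StepN n x :=
      ⟨And.left, fun h => ⟨h, fun m hm h' => hm.ne (stepN_time_unique h' h)⟩⟩
    rw [this, H, Set.mem_insert_iff]
    refine or_congr Iff.rfl ⟨?_, ?_⟩
    · rintro ⟨q, d, hq, rfl, rfl⟩
      have : q < k + 1 := startTime_strictMono.lt_iff_lt.1 (by omega)
      exact ⟨q, by simp; omega, by simp [f]⟩
    · rintro ⟨q, hq, rfl⟩
      simp only [Finset.coe_Icc, Set.mem_Icc] at hq
      have := startTime_strictMono.monotone hq.2
      exact ⟨q, n - startTime q, hq.1, by omega, rfl⟩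
  have hwf : w ∉ f '' (Finset.Icc 1 k : Set ℕ) := by
    rintro ⟨q, hq, rfl⟩
    simp only [Finset.coe_Icc, Set.mem_Icc] at hq
    exact hw.not_isBranchAt (n' := startTime q + (n - startTime q)) ⟨q, _, hq.1, rfl, rfl⟩
  rw [Multiway.growth, hS, Set.ncard_insert_of_notMem hwf ((Finset.finite_toSet _).image f),
    Set.ncard_image_of_injective _ hf, Set.ncard_coe_finset, Nat.card_Icc, Nat.add_sub_cancel]

lemma exists_growth_eq_and_pow_bounds {n : ℕ} (hn : 1 ≤ n) :
    ∃ k, 2 ^ k ≤ n ∧ n ≤ 2 ^ (k + 3) ∧ system.growth n = k + 1 := by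
  obtain ⟨k, h1, h2, h3⟩ := exists_growth_eq n
  have e1 := startTime_add k
  have e2 := startTime_add (k + 1)
  have hk : k < 2 ^ k := Nat.lt_two_pow_self
  refine ⟨k, ?_, ?_, h3⟩
  · rcases k with _ | k
    · simpa using hn
    · omega
  · simp only [pow_succ] at *; omega

end DoublingSystem

/-- there exists a multiway system whose growth function is `Θ(log n)`. -/
theorem exists_multiway_of_logarithmic_growth :
    ∃ M : Multiway, ∃ c C : ℝ, 0 < c ∧ c ≤ C ∧ ∃ N : ℕ, ∀ n : ℕ, N ≤ n →
      c * Real.log (n : ℝ) ≤ (M.growth n : ℝ) ∧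
      (M.growth n : ℝ) ≤ C * Real.log (n : ℝ) := by
  refine ⟨DoublingSystem.system, 1 / 3, 3, by norm_num, by norm_num, 4, fun n hn => ?_⟩
  obtain ⟨k, h1, h2, h3⟩ :=
    DoublingSystem.exists_growth_eq_and_pow_bounds (show 1 ≤ n by omega)
  have hpos : (0 : ℝ) < n := by exact_mod_cast (show 0 < n by omega)
  have l1 : (k : ℝ) * Real.log 2 ≤ Real.log n := by
    rw [← Real.log_pow]
    exact Real.log_le_log (by positivity) (by exact_mod_cast h1)
  have l2 : Real.log n ≤ ((k + 3 : ℕ) : ℝ) * Real.log 2 := by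
    rw [← Real.log_pow]
    exact Real.log_le_log hpos (by exact_mod_cast h2)
  have l3 : ((2 : ℕ) : ℝ) * Real.log 2 ≤ Real.log n := by
    rw [← Real.log_pow]
    exact Real.log_le_log (by positivity) (by exact_mod_cast hn)
  have lo := Real.log_two_gt_d9
  have hi := Real.log_two_lt_d9
  have hk : (0 : ℝ) ≤ k := k.cast_nonneg
  rw [h3]
  push_cast at *
  constructor <;> nlinarith
end
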